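/- Let S be a boundaryless surface and 𝒞 a circle decomposition of S such that every element of 𝒞 is two-sided in S (this holds in particular when S is orientable). If 𝒞 is upper semicontinuous, then every C ∈ 𝒞 admits a 𝒞-annular neighborhood. -/

import Mathlib

open Topology Set

/-- A circle in a topological space `X`: a subset homeomorphic to the unit circle. -/
def IsCircle {X : Type*} [TopologicalSpace X] (C : Set X) : Prop :=
  Nonempty (C ≃ₜ Circle)

/-- A circle decomposition of `X`: a set of pairwise disjoint circles whose union is `X`. -/
def IsCircleDecomposition {X : Type*} [TopologicalSpace X] (𝒞 : Set (Set X)) : Prop :=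
  (∀ C ∈ 𝒞, IsCircle C) ∧
  (∀ C ∈ 𝒞, ∀ D ∈ 𝒞, C ≠ D → Disjoint C D) ∧
  ⋃₀ 𝒞 = Set.univ

/-- A decomposition `𝒞` of `X` is upper semicontinuous if for every `C ∈ 𝒞` and every
open `U ⊇ C` there is an open `V ⊇ C` such that every `D ∈ 𝒞` meeting `V` lies in `U`. -/
def IsUpperSemicontinuousDecomposition {X : Type*} [TopologicalSpace X]
    (𝒞 : Set (Set X)) : Prop :=
  ∀ C ∈ 𝒞, ∀ U : Set X, IsOpen U → C ⊆ U →
    ∃ V : Set X, IsOpen V ∧ C ⊆ V ∧ ∀ D ∈ 𝒞, (D ∩ V) ≠ ∅ → D ⊆ U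

/-- A circle `C` in `S` is two-sided if there is an embedding of the annulus
`Circle × [-1,1]` into `S` carrying the middle circle onto `C`. -/
def IsTwoSided {S : Type*} [TopologicalSpace S] (C : Set S) : Prop :=
  ∃ h : Circle × Set.Icc (-1:ℝ) 1 → S, Topology.IsEmbedding h ∧
    h '' {p : Circle × Set.Icc (-1:ℝ) 1 | (p.2 : ℝ) = 0} = C

/-- A `𝒞`-annular neighborhood of a circle `C`: an embedded annulus whose middle circle
is `C`, whose image is a neighborhood of `C`, and whose two boundary circles belong
to `𝒞`. -/
def HasAnnularNbhd {S : Type*} [TopologicalSpace S] (𝒞 : Set (Set S)) (C : Set S) : Prop :=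
  ∃ h : Circle × Set.Icc (-1:ℝ) 1 → S, Topology.IsEmbedding h ∧
    h '' {p : Circle × Set.Icc (-1:ℝ) 1 | (p.2 : ℝ) = 0} = C ∧
    Set.range h ∈ nhdsSet C ∧
    h '' {p : Circle × Set.Icc (-1:ℝ) 1 | (p.2 : ℝ) = -1} ∈ 𝒞 ∧
    h '' {p : Circle × Set.Icc (-1:ℝ) 1 | (p.2 : ℝ) = 1} ∈ 𝒞

/-! ### Continuous logarithms -/

theorem exists_continuous_log {A : Type*} [TopologicalSpace A] [SimplyConnectedSpace A]
    [LocallyPathConnectedSpace A] {f : A → ℂ} (hf : Continuous f) (h0 : ∀ x, f x ≠ 0) :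
    ∃ l : A → ℂ, Continuous l ∧ ∀ x, Complex.exp (l x) = f x := by
  obtain ⟨a⟩ : Nonempty A := inferInstance
  obtain ⟨l, ⟨-, hl⟩, -⟩ := Complex.isCoveringMapOn_exp.existsUnique_continuousMap_lifts
    ⟨f, hf⟩ (Complex.exp_log (h0 a)) h0
  exact ⟨l, l.continuous, fun x => congrFun hl x⟩

theorem continuous_log_unique {A : Type*} [TopologicalSpace A] [PreconnectedSpace A]
    {f g : A → ℂ} (hf : Continuous f) (hg : Continuous g)
    (h : ∀ x, Complex.exp (f x) = Complex.exp (g x)) {a : A} (ha : f a = g a) : f = g :=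
  Complex.isCoveringMap_exp.eq_of_comp_eq hf hg (funext fun x => Subtype.ext (h x)) a ha

theorem exists_continuous_log_of_homotopy {A : Type*} [TopologicalSpace A]
    {H : unitInterval × A → ℂ} (hH : Continuous H) (h0 : ∀ x, H x ≠ 0)
    {l : A → ℂ} (hl : Continuous l) (hlH : ∀ a, Complex.exp (l a) = H (0, a)) :
    ∃ m : A → ℂ, Continuous m ∧ ∀ a, Complex.exp (m a) = H (1, a) := by
  let H' : C(unitInterval × A, {z : ℂ // z ≠ 0}) :=
    ⟨fun x => ⟨H x, h0 x⟩, hH.subtype_mk h0⟩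
  have key : ∀ a, H' (0, a) = ⟨_, Complex.exp_ne_zero ((⟨l, hl⟩ : C(A, ℂ)) a)⟩ :=
    fun a => Subtype.ext (hlH a).symm
  refine ⟨fun a => Complex.isCoveringMap_exp.liftHomotopy H' ⟨l, hl⟩ key (1, a),
    by fun_prop, fun a => ?_⟩
  have := congrFun (Complex.isCoveringMap_exp.liftHomotopy_lifts H' ⟨l, hl⟩ key) (1, a)
  exact congrArg Subtype.val this

/-- An odd nonvanishing map on the circle has no continuous logarithm. -/
theorem not_exists_log_of_odd {f l : Circle → ℂ} (hl : Continuous l)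
    (hlf : ∀ x, Complex.exp (l x) = f x) (hodd : ∀ x, f (-x) = - f x) : False := by
  have hc : ∀ x, Complex.exp (l (-x) - l x) = -1 := by
    intro x
    rw [Complex.exp_sub, hlf, hlf, hodd, neg_div, div_self]
    rw [← hlf]; exact Complex.exp_ne_zero _
  have hre : ∀ x, (l (-x) - l x).re = 0 := by
    intro x
    have := congrArg norm (hc x)
    simpa [Complex.norm_exp] using this
  have hcont : Continuous fun x : Circle => (l (-x) - l x).im := by
    have : Continuous fun x : Circle => -x := continuous_neg
    fun_prop
  have hneg : ∀ x : Circle, (l (-(-x)) - l (-x)).im = - (l (-x) - l x).im := by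
    intro x; rw [neg_neg]; simp
  obtain ⟨x, hx⟩ : ∃ x : Circle, (l (-x) - l x).im = 0 := by
    rcases le_total ((l (-1) - l 1).im) 0 with h | h
    · exact mem_range_of_exists_le_of_exists_ge hcont ⟨1, h⟩ ⟨-1, by rw [hneg]; linarith⟩
    · exact mem_range_of_exists_le_of_exists_ge hcont ⟨-1, by rw [hneg]; linarith⟩ ⟨1, h⟩
  have h0 : l (-x) - l x = 0 := Complex.ext (hre x) hx
  have := hc x
  rw [h0, Complex.exp_zero] at this
  norm_num at this

/-- A power of the standard coordinate with a continuous logarithm is trivial. -/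
theorem zpow_eq_zero_of_log {n : ℤ} {l : Circle → ℂ} (hl : Continuous l)
    (h : ∀ x : Circle, Complex.exp (l x) = (x : ℂ) ^ n) : n = 0 := by
  have h1 : (fun x : ℝ => l (Circle.exp x)) =
      fun x : ℝ => (n : ℂ) * (x * Complex.I) + l (Circle.exp 0) := by
    refine continuous_log_unique (a := 0) (by fun_prop) (by fun_prop) (fun x => ?_) (by simp)
    rw [h, Complex.exp_add, h, Complex.exp_int_mul]
    simp [Circle.coe_exp]
  have h2 := congrFun h1 (2 * Real.pi)
  simp only [Circle.exp_two_pi, Circle.exp_zero] at h2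
  have h3 : (n : ℂ) * ((2 * Real.pi : ℝ) * Complex.I) = 0 := by linear_combination -h2
  simpa [Real.pi_ne_zero] using h3

/-- Every nonvanishing map on the circle is a power of the coordinate up to a logarithm. -/
theorem exists_zpow_mul_exp {f : Circle → ℂ} (hf : Continuous f) (h0 : ∀ x, f x ≠ 0) :
    ∃ (n : ℤ) (l : Circle → ℂ), Continuous l ∧ ∀ x, f x = (x : ℂ) ^ n * Complex.exp (l x) := by
  obtain ⟨L, hL, hLf⟩ := exists_continuous_log (A := ℝ) (f := fun x => f (Circle.exp x))
    (by fun_prop) (fun x => h0 _)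
  obtain ⟨n, hn⟩ : ∃ n : ℤ, L (2 * Real.pi) = L 0 + n * (2 * Real.pi * Complex.I) := by
    rw [← Complex.exp_eq_exp_iff_exists_int, hLf, hLf]; simp
  have hper : (fun x : ℝ => L (x + 2 * Real.pi)) =
      fun x => L x + n * (2 * Real.pi * Complex.I) := by
    refine continuous_log_unique (a := 0) (by fun_prop) (by fun_prop) (fun x => ?_) (by simpa)
    rw [Complex.exp_add, Complex.exp_int_mul_two_pi_mul_I, mul_one, hLf, hLf]
    simp [Circle.exp_add]
  have hM : ∀ x y : ℝ, Circle.exp x = Circle.exp y →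
      L x - n * (x * Complex.I) = L y - n * (y * Complex.I) := by
    intro x y hxy
    obtain ⟨m, hm⟩ := Circle.exp_eq_exp.1 hxy
    have hp : Function.Periodic (fun x : ℝ => L x - n * (x * Complex.I)) (2 * Real.pi) := by
      intro x
      have := congrFun hper x
      have e : L (x + 2 * Real.pi) = L x + n * (2 * Real.pi * Complex.I) := this
      simp only [e]; push_cast; ring
    have := hp.int_mul m y
    rw [hm]; simpa using this
  have hq : IsQuotientMap (Circle.exp : ℝ → Circle) :=
    Circle.isCoveringMap_exp.isLocalHomeomorph.isOpenMap.isQuotientMap (by fun_prop)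
      (fun z => ⟨Complex.arg z, Circle.exp_arg z⟩)
  refine ⟨n, fun z => L (Complex.arg z) - n * (Complex.arg z * Complex.I), ?_, ?_⟩
  · rw [hq.continuous_iff]
    have : ((fun z : Circle => L (Complex.arg z) - n * (Complex.arg z * Complex.I)) ∘ Circle.exp)
        = fun x : ℝ => L x - n * (x * Complex.I) := by
      ext x
      exact hM _ _ (Circle.exp_arg _)
    rw [this]; fun_prop
  · intro z
    have h1 : (z : ℂ) = Complex.exp (Complex.arg z * Complex.I) := by
      rw [← Circle.coe_exp, Circle.exp_arg]
    rw [Complex.exp_sub, hLf, Circle.exp_arg, Complex.exp_int_mul, ← h1, mul_div_cancel₀]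
    exact zpow_ne_zero _ (Circle.coe_ne_zero z)

/-- A nonvanishing continuous function on a closed disc has a continuous logarithm. -/
theorem exists_log_on_closedBall {f : ℂ → ℂ} {a : ℂ} {r : ℝ} (hr : 0 < r)
    (hf : ContinuousOn f (Metric.closedBall a r)) (h0 : ∀ x ∈ Metric.closedBall a r, f x ≠ 0) :
    ∃ l : ℂ → ℂ, Continuous l ∧ ∀ x ∈ Metric.closedBall a r, Complex.exp (l x) = f x := by
  let ρ : ℂ → ℂ := fun z => a + (r / max r ‖z - a‖ : ℝ) * (z - a)
  have hm : ∀ z : ℂ, 0 < max r ‖z - a‖ := fun z => lt_max_of_lt_left hr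
  have hρ : Continuous ρ := by
    have : Continuous fun z : ℂ => r / max r ‖z - a‖ :=
      continuous_const.div (by fun_prop) fun z => (hm z).ne'
    fun_prop
  have hρm : ∀ z, ρ z ∈ Metric.closedBall a r := by
    intro z
    simp only [ρ, Metric.mem_closedBall, dist_eq_norm, add_sub_cancel_left, norm_mul,
      Complex.norm_real, Real.norm_eq_abs, abs_of_pos (div_pos hr (hm z))]
    rw [div_mul_eq_mul_div, div_le_iff₀ (hm z)]
    exact mul_le_mul_of_nonneg_left (le_max_right _ _) hr.le
  obtain ⟨l, hl, hlf⟩ := exists_continuous_log (A := ℂ) (f := fun z => f (ρ z))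
    (hf.comp_continuous hρ hρm) (fun z => h0 _ (hρm z))
  refine ⟨l, hl, fun z hz => ?_⟩
  rw [hlf]
  congr 1
  have : max r ‖z - a‖ = r := max_eq_left (by simpa [dist_eq_norm] using hz)
  simp [ρ, this, ne_of_gt hr]

/-! ### Invariance of domain in the plane -/

theorem mem_interior_image_closedBall {f : ℂ → ℂ} {a : ℂ} {r : ℝ} (hr : 0 < r)
    (hf : ContinuousOn f (Metric.closedBall a r)) (hinj : InjOn f (Metric.closedBall a r)) :
    f '' Metric.closedBall a r ∈ 𝓝 (f a) := by
  have haB : a ∈ Metric.closedBall a r := Metric.mem_closedBall_self hr.le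
  have hB : ∀ (c : Circle) (s : ℝ), |s| ≤ 1 → a + s * r * c ∈ Metric.closedBall a r := by
    intro c s hs
    simp only [Metric.mem_closedBall, dist_eq_norm, add_sub_cancel_left, norm_mul,
      Complex.norm_real, Real.norm_eq_abs, Circle.norm_coe, mul_one, abs_of_pos hr]
    nlinarith
  by_contra hnot
  have hScomp : IsCompact (f '' Metric.sphere a r) :=
    (isCompact_sphere a r).image_of_continuousOn (hf.mono Metric.sphere_subset_closedBall)
  have haS : f a ∉ f '' Metric.sphere a r := by
    rintro ⟨x, hx, hxa⟩
    have := hinj (Metric.sphere_subset_closedBall hx) haB hxa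
    subst this
    simp [hr.ne] at hx
  obtain ⟨δ, hδ, hδS⟩ := Metric.mem_nhds_iff.1 (hScomp.isClosed.isOpen_compl.mem_nhds haS)
  obtain ⟨w, hwδ, hw⟩ : ∃ w ∈ Metric.ball (f a) δ, w ∉ f '' Metric.closedBall a r := by
    by_contra! h
    exact hnot (Filter.mem_of_superset (Metric.ball_mem_nhds _ hδ) h)
  obtain ⟨l, hl, hlf⟩ := exists_log_on_closedBall hr (f := fun z => f z - w)
    (hf.sub continuousOn_const) (fun z hz h => hw ⟨z, hz, sub_eq_zero.1 h⟩)
  let p : Circle → ℂ := fun c => a + r * c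
  have hpS : ∀ c, p c ∈ Metric.sphere a r := by
    intro c; simp [p, abs_of_pos hr, Circle.norm_coe]
  have hpB : ∀ c, p c ∈ Metric.closedBall a r := fun c => Metric.sphere_subset_closedBall (hpS c)
  have hfar : ∀ c, δ ≤ ‖f (p c) - f a‖ := by
    intro c
    by_contra! h
    exact hδS (by simpa [dist_eq_norm] using h) ⟨_, hpS c, rfl⟩
  have hfp : Continuous fun c => f (p c) := hf.comp_continuous (by fun_prop) hpB
  have hne : ∀ c, f (p c) - f a ≠ 0 := fun c h => by
    have := hfar c; rw [h, norm_zero] at this; linarith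
  have hq : ∀ c, (f (p c) - w) / (f (p c) - f a) ∈ Complex.slitPlane := by
    intro c
    have h : ‖(f a - w) / (f (p c) - f a)‖ < 1 := by
      rw [norm_div, div_lt_one (norm_pos_iff.2 (hne c))]
      refine lt_of_lt_of_le ?_ (hfar c)
      rw [norm_sub_rev]; simpa [dist_eq_norm] using hwδ
    convert Complex.mem_slitPlane_of_norm_lt_one h using 1
    have := hne c
    field_simp
    ring
  let m : Circle → ℂ := fun c => l (p c) - Complex.log ((f (p c) - w) / (f (p c) - f a))
  have hm : Continuous m := by
    have : Continuous fun c => Complex.log ((f (p c) - w) / (f (p c) - f a)) :=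
      Continuous.clog ((hfp.sub continuous_const).div (hfp.sub continuous_const) hne) hq
    have : Continuous p := by fun_prop
    fun_prop
  have hmf : ∀ c, Complex.exp (m c) = f (p c) - f a := by
    intro c
    have h1 := Complex.slitPlane_ne_zero (hq c)
    have h2 : f (p c) - w ≠ 0 := fun h => by simp [h] at h1
    rw [Complex.exp_sub, hlf _ (hpB c), Complex.exp_log h1]
    field_simp
  let H : unitInterval × Circle → ℂ := fun x =>
    f (a + ((1 / (1 + x.1) : ℝ) : ℂ) * r * x.2) - f (a + ((-(x.1 / (1 + x.1)) : ℝ) : ℂ) * r * x.2)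
  have hpos : ∀ s : unitInterval, (0 : ℝ) < 1 + s := fun s => by have := s.2.1; linarith
  have hs1 : ∀ s : unitInterval, |(1 / (1 + s) : ℝ)| ≤ 1 := by
    intro s
    rw [abs_of_pos (div_pos one_pos (hpos s)), div_le_one (hpos s)]
    have := s.2.1; linarith
  have hs2 : ∀ s : unitInterval, |(-(s / (1 + s)) : ℝ)| ≤ 1 := by
    intro s
    rw [abs_neg, abs_of_nonneg (div_nonneg s.2.1 (hpos s).le), div_le_one (hpos s)]
    linarith
  have hH : Continuous H := by
    have c1 : Continuous fun x : unitInterval × Circle => (1 / (1 + x.1) : ℝ) :=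
      continuous_const.div (by fun_prop) fun x => (hpos x.1).ne'
    have c2 : Continuous fun x : unitInterval × Circle => (x.1 / (1 + x.1) : ℝ) :=
      Continuous.div (by fun_prop) (by fun_prop) fun x => (hpos x.1).ne'
    refine Continuous.sub (hf.comp_continuous ?_ fun x => hB x.2 _ (hs1 x.1))
      (hf.comp_continuous ?_ fun x => hB x.2 _ (hs2 x.1)) <;> fun_prop
  have hH0 : ∀ x, H x ≠ 0 := by
    rintro ⟨s, c⟩ h
    have h1 := hinj (hB c _ (hs1 s)) (hB c _ (hs2 s)) (sub_eq_zero.1 h)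
    have h2 : (((1 / (1 + s) : ℝ) : ℂ) - ((-(s / (1 + s)) : ℝ) : ℂ)) * (r * c) = 0 := by
      linear_combination h1
    have h3 : (1 / (1 + s) : ℝ) - (-(s / (1 + s)) : ℝ) = 1 := by
      have := (hpos s).ne'; field_simp; ring
    rw [← Complex.ofReal_sub, h3] at h2
    simp [hr.ne'] at h2
  obtain ⟨m', hm', hm'H⟩ := exists_continuous_log_of_homotopy hH hH0 hm (fun c => by
    rw [hmf]; simp [H, p])
  refine not_exists_log_of_odd hm' hm'H fun c => ?_
  simp only [H, Circle.coe_neg, Icc.coe_one, mul_neg, Complex.ofReal_neg, neg_mul]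
  rw [neg_sub]; norm_num

/-- Each point has an open neighbourhood homeomorphic to an open subset of the plane. -/
def IsLocallyPlanar (Y : Type*) [TopologicalSpace Y] : Prop :=
  ∀ y : Y, ∃ e : OpenPartialHomeomorph Y ℂ, y ∈ e.source

theorem isLocallyPlanar_complex : IsLocallyPlanar ℂ :=
  fun _ => ⟨OpenPartialHomeomorph.refl ℂ, mem_univ _⟩

theorem isLocallyPlanar_of_chartedSpace (S : Type*) [TopologicalSpace S]
    [ChartedSpace (EuclideanSpace ℝ (Fin 2)) S] : IsLocallyPlanar S := fun y =>
  ⟨(chartAt (EuclideanSpace ℝ (Fin 2)) y).trans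
    Complex.orthonormalBasisOneI.repr.symm.toHomeomorph.toOpenPartialHomeomorph, by simp⟩

/-- Invariance of domain: an injective continuous map from an open subset of the plane to a
surface is open. -/
theorem IsLocallyPlanar.isOpen_image {Y : Type*} [TopologicalSpace Y] (hY : IsLocallyPlanar Y)
    {f : ℂ → Y} {O : Set ℂ} (hO : IsOpen O) (hf : ContinuousOn f O) (hinj : InjOn f O) :
    IsOpen (f '' O) := by
  rw [isOpen_iff_mem_nhds]
  rintro _ ⟨a, ha, rfl⟩
  obtain ⟨e, he⟩ := hY (f a)
  have h1 : O ∩ f ⁻¹' e.source ∈ 𝓝 a :=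
    (hf.isOpen_inter_preimage hO e.open_source).mem_nhds ⟨ha, he⟩
  obtain ⟨r, hr, hrB⟩ := Metric.nhds_basis_closedBall.mem_iff.1 h1
  have h2 := mem_interior_image_closedBall (f := e ∘ f) hr
    (e.continuousOn.comp (hf.mono fun z hz => (hrB hz).1) fun z hz => (hrB hz).2)
    (e.injOn.comp (hinj.mono fun z hz => (hrB hz).1) fun z hz => (hrB hz).2)
  have h3 := e.continuousAt he h2
  filter_upwards [h3, e.open_source.mem_nhds he]
  rintro y ⟨z, hz, hzy⟩ hy
  exact ⟨z, (hrB hz).1, e.injOn (hrB hz).2 hy hzy⟩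

/-! ### Collars and their defining functions -/

theorem continuousOn_image_of_comp {X Y Z : Type*} [TopologicalSpace X] [TopologicalSpace Y]
    [T2Space Y] [TopologicalSpace Z] {s : Set X} (hs : IsCompact s) {g : X → Y} {φ : Y → Z}
    (hg : ContinuousOn g s) (h : ContinuousOn (φ ∘ g) s) : ContinuousOn φ (g '' s) := by
  rw [continuousOn_iff_isClosed]
  intro t ht
  obtain ⟨u, hu, hut⟩ := continuousOn_iff_isClosed.1 h t ht
  refine ⟨g '' (s ∩ u), ((hs.inter_right hu).image_of_continuousOn
    (hg.mono inter_subset_left)).isClosed, ?_⟩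
  ext y
  constructor
  · rintro ⟨hy, x, hx, rfl⟩
    have : x ∈ (φ ∘ g) ⁻¹' t ∩ s := ⟨hy, hx⟩
    rw [hut] at this
    exact ⟨⟨x, ⟨hx, this.1⟩, rfl⟩, x, hx, rfl⟩
  · rintro ⟨⟨x, ⟨hx, hxu⟩, rfl⟩, -⟩
    have : x ∈ u ∩ s := ⟨hxu, hx⟩
    rw [← hut] at this
    exact ⟨this.1, x, hx, rfl⟩

theorem IsLocallyPlanar.isOpen_image_cylinder {Y : Type*} [TopologicalSpace Y]
    (hY : IsLocallyPlanar Y) {f : Circle × ℝ → Y} {O : Set (Circle × ℝ)} (hO : IsOpen O)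
    (hf : ContinuousOn f O) (hinj : InjOn f O) : IsOpen (f '' O) := by
  rw [isOpen_iff_mem_nhds]
  rintro _ ⟨⟨c, t⟩, ha, rfl⟩
  let E : ℂ → Circle × ℝ := fun z => (Circle.exp z.re, z.im)
  have hE : Continuous E := by fun_prop
  let z₀ : ℂ := ⟨Complex.arg c, t⟩
  have hz₀ : E z₀ = (c, t) := by simp [E, z₀]
  let B := E ⁻¹' O ∩ Metric.ball z₀ 1
  have hB : IsOpen B := (hO.preimage hE).inter Metric.isOpen_ball
  have hEinj : InjOn E B := by
    intro x hx y hy hxy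
    simp only [E, Prod.mk.injEq, Circle.exp_eq_exp] at hxy
    obtain ⟨⟨m, hm⟩, him⟩ := hxy
    have h1 : |x.re - y.re| < 2 := by
      have h2 : ‖x - y‖ < 2 := by
        have := dist_triangle_right x y z₀
        rw [dist_eq_norm] at this
        have h3 := hx.2; have h4 := hy.2
        rw [Metric.mem_ball] at h3 h4
        linarith
      exact (Complex.abs_re_le_norm (x - y)).trans_lt h2
    have hm0 : m = 0 := by
      rw [hm, add_sub_cancel_left, abs_mul, abs_of_pos Real.two_pi_pos] at h1
      by_contra hne
      have h5 : (1 : ℝ) ≤ |(m : ℝ)| := by exact_mod_cast Int.one_le_abs hne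
      nlinarith [Real.pi_gt_three]
    subst hm0
    exact Complex.ext (by simpa using hm) him
  have h := hY.isOpen_image hB (hf.comp hE.continuousOn fun z hz => hz.1)
    (hinj.comp hEinj fun z hz => hz.1)
  refine Filter.mem_of_superset (h.mem_nhds ⟨z₀, ⟨?_, Metric.mem_ball_self one_pos⟩, ?_⟩) ?_
  · simpa [hz₀] using ha
  · simp [hz₀]
  · rintro _ ⟨z, hz, rfl⟩
    exact ⟨E z, hz.1, rfl⟩

/-- A (parametrised, globally defined) collar: injective on `Circle × [-1,1]`. -/
def IsCollar {X : Type*} [TopologicalSpace X] (g : Circle × ℝ → X) : Prop :=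
  Continuous g ∧ InjOn g (univ ×ˢ Icc (-1) 1)

theorem isCompact_cylinder (a b : ℝ) : IsCompact ((univ : Set Circle) ×ˢ Icc a b) :=
  isCompact_univ.prod isCompact_Icc

theorem isPreconnected_circle_prod {s : Set ℝ} (hs : IsPreconnected s) :
    IsPreconnected ((univ : Set Circle) ×ˢ s) :=
  isPreconnected_univ.prod hs

theorem IsCollar.isOpen_image {X : Type*} [TopologicalSpace X] (hX : IsLocallyPlanar X)
    {g : Circle × ℝ → X} (hg : IsCollar g) {s : Set ℝ} (hs : IsOpen s) (h : s ⊆ Icc (-1) 1) :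
    IsOpen (g '' (univ ×ˢ s)) :=
  hX.isOpen_image_cylinder (isOpen_univ.prod hs) hg.1.continuousOn
    (hg.2.mono (prod_mono_right h))

theorem IsCollar.eq_of_eq {X : Type*} [TopologicalSpace X] {g : Circle × ℝ → X}
    (hg : IsCollar g) {a b : Circle} {s t : ℝ} (hs : s ∈ Icc (-1 : ℝ) 1) (ht : t ∈ Icc (-1 : ℝ) 1)
    (h : g (a, s) = g (b, t)) : a = b ∧ s = t := by
  have := hg.2 (show ((a, s) : Circle × ℝ) ∈ _ from ⟨mem_univ _, hs⟩) ⟨mem_univ _, ht⟩ h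
  simpa using this

/-- `G` is a function on the plane with regular zero set the core of the collar `g`, negative
inside and positive outside. -/
structure IsDefining (g : Circle × ℝ → ℂ) (G : ℂ → ℝ) : Prop where
  collar : IsCollar g
  cont : Continuous G
  fiber : ∀ c t, t ∈ Icc (-1 : ℝ) 1 → G (g (c, t)) = t
  off : ∀ z, z ∉ g '' (univ ×ˢ Ioo (-1) 1) → 1 ≤ |G z|
  bdd : Bornology.IsBounded {z | G z ≤ 0}

theorem isPreconnected_compl_closedBall {R : ℝ} (hR : 0 ≤ R) :
    IsPreconnected (Metric.closedBall (0 : ℂ) R)ᶜ := by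
  have : (Metric.closedBall (0 : ℂ) R)ᶜ =
      (fun p : Circle × ℝ => (p.2 : ℂ) * p.1) '' (univ ×ˢ Ioi R) := by
    ext z
    simp only [mem_compl_iff, Metric.mem_closedBall, dist_zero_right, not_le, mem_image,
      mem_prod, mem_univ, true_and, mem_Ioi, Prod.exists]
    constructor
    · intro hz
      refine ⟨Circle.exp z.arg, ‖z‖, hz, ?_⟩
      rw [Circle.coe_exp, Complex.norm_mul_exp_arg_mul_I]
    · rintro ⟨c, t, ht, rfl⟩
      simpa [abs_of_pos (hR.trans_lt ht), Circle.norm_coe] using ht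
  rw [this]
  exact (isPreconnected_circle_prod isPreconnected_Ioi).image _ (by fun_prop)

theorem IsCollar.exists_cont_fiber {g : Circle × ℝ → ℂ} (hg : IsCollar g) :
    ∃ G : ℂ → ℝ, Continuous G ∧ (∀ c t, t ∈ Icc (-1 : ℝ) 1 → G (g (c, t)) = t) ∧
      ∀ z, z ∉ g '' (univ ×ˢ Ioo (-1) 1) → 1 ≤ |G z| := by
  classical
  set Q : Set (Circle × ℝ) := univ ×ˢ Icc (-1) 1 with hQ
  let T : ℂ → ℝ := fun z => (Function.invFunOn g Q z).2
  have hT : ∀ c t, t ∈ Icc (-1 : ℝ) 1 → T (g (c, t)) = t := by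
    intro c t ht
    have : (c, t) ∈ Q := ⟨mem_univ _, ht⟩
    change (Function.invFunOn g Q (g (c, t))).2 = t
    rw [hg.2.leftInvOn_invFunOn this]
  let ψ : ℂ → ℂ := fun z => if z ∈ g '' Q then Complex.exp (Real.pi * (T z + 1) * Complex.I) else 1
  have hQc : IsCompact Q := isCompact_cylinder _ _
  have hN : IsOpen (g '' (univ ×ˢ Ioo (-1) 1)) :=
    hg.isOpen_image isLocallyPlanar_complex isOpen_Ioo Ioo_subset_Icc_self
  have hψg : ∀ c t, t ∈ Icc (-1 : ℝ) 1 →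
      ψ (g (c, t)) = Complex.exp (Real.pi * (t + 1) * Complex.I) := by
    intro c t ht
    have : g (c, t) ∈ g '' Q := ⟨_, ⟨mem_univ _, ht⟩, rfl⟩
    simp only [ψ, if_pos this, hT c t ht]
  have hψ1 : ∀ z, z ∉ g '' (univ ×ˢ Ioo (-1) 1) → ψ z = 1 := by
    intro z hz
    by_cases hzQ : z ∈ g '' Q
    · obtain ⟨⟨c, t⟩, ⟨-, ht⟩, rfl⟩ := hzQ
      rw [hψg c t ht]
      have : t = -1 ∨ t = 1 := by
        by_contra! h
        exact hz ⟨(c, t), ⟨mem_univ _, lt_of_le_of_ne ht.1 h.1.symm, lt_of_le_of_ne ht.2 h.2⟩, rfl⟩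
      rcases this with rfl | rfl
      · simp
      · rw [Complex.exp_eq_one_iff]
        exact ⟨1, by push_cast; ring⟩
    · simp only [ψ, if_neg hzQ]
  have hψ : Continuous ψ := by
    have h1 : ContinuousOn ψ (g '' Q) := by
      refine continuousOn_image_of_comp hQc hg.1.continuousOn ?_
      refine ContinuousOn.congr (f := fun p : Circle × ℝ =>
        Complex.exp (Real.pi * (p.2 + 1) * Complex.I)) (by fun_prop) ?_
      rintro ⟨c, t⟩ ⟨-, ht⟩
      exact hψg c t ht
    have h2 : ContinuousOn ψ (g '' (univ ×ˢ Ioo (-1) 1))ᶜ :=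
      continuousOn_const.congr hψ1
    have h3 := h1.union_of_isClosed h2 (hQc.image hg.1).isClosed hN.isClosed_compl
    rw [← continuousOn_univ]
    convert h3
    symm
    rw [eq_univ_iff_forall]
    intro z
    by_cases hz : z ∈ g '' (univ ×ˢ Ioo (-1) 1)
    · exact Or.inl (image_mono (prod_mono_right Ioo_subset_Icc_self) hz)
    · exact Or.inr hz
  have hnorm : ∀ z, ‖ψ z‖ = 1 := by
    intro z
    simp only [ψ]
    split_ifs
    · have := Complex.norm_exp_ofReal_mul_I (Real.pi * (T z + 1))
      push_cast at this; exact this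
    · simp
  obtain ⟨l, hl, hlψ⟩ := exists_continuous_log hψ (fun z h => by
    have := hnorm z; rw [h] at this; simp at this)
  -- along the collar the logarithm is affine
  obtain ⟨k, hk⟩ : ∃ k : ℤ, l (g (1, -1)) = k * (2 * Real.pi * Complex.I) := by
    have := hlψ (g (1, -1))
    rw [hψg 1 (-1) (by norm_num)] at this
    rw [← Complex.exp_eq_one_iff, this]; simp
  have hfib : (fun p : Circle × Icc (-1 : ℝ) 1 => l (g (p.1, p.2))) = fun p =>
      Real.pi * ((p.2 : ℝ) + 1) * Complex.I + k * (2 * Real.pi * Complex.I) := by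
    have : PreconnectedSpace (Icc (-1 : ℝ) 1) := Subtype.preconnectedSpace isPreconnected_Icc
    have hgc := hg.1
    refine continuous_log_unique (a := (1, ⟨-1, by norm_num⟩)) (by fun_prop) (by fun_prop) ?_ ?_
    · rintro ⟨c, t⟩
      rw [hlψ, hψg c t t.2, Complex.exp_add, Complex.exp_int_mul_two_pi_mul_I, mul_one]
    · simp [hk]
  have hpi := Real.pi_pos
  refine ⟨fun z => (l z).im / Real.pi - 1 - 2 * k, by fun_prop, ?_, ?_⟩
  · intro c t ht
    have := congrArg Complex.im (congrFun hfib (c, ⟨t, ht⟩))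
    simp only [Complex.add_im, Complex.mul_im, Complex.mul_re, Complex.ofReal_re,
      Complex.ofReal_im, Complex.I_re, Complex.I_im, Complex.intCast_re, Complex.intCast_im,
      Complex.add_re, Complex.one_re, Complex.one_im, Complex.re_ofNat, Complex.im_ofNat] at this
    change (l (g (c, t))).im / Real.pi - 1 - 2 * k = t
    rw [this]; field_simp; ring
  · intro z hz
    have h2 := hlψ z
    rw [hψ1 z hz, Complex.exp_eq_one_iff] at h2
    obtain ⟨n, hn⟩ := h2
    have h3 : (l z).im = 2 * n * Real.pi := by rw [hn]; simp; ring
    have h4 : (l z).im / Real.pi - 1 - 2 * k = ((2 * (n - k) - 1 : ℤ) : ℝ) := by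
      rw [h3]; field_simp; push_cast; ring
    change 1 ≤ |(l z).im / Real.pi - 1 - 2 * k|
    rw [h4]
    have : (2 * (n - k) - 1 : ℤ) ≠ 0 := by omega
    exact_mod_cast Int.one_le_abs this

theorem IsCollar.flip {X : Type*} [TopologicalSpace X] {g : Circle × ℝ → X} (hg : IsCollar g) :
    IsCollar fun p => g (p.1, -p.2) := by
  refine ⟨hg.1.comp (by fun_prop), ?_⟩
  rintro ⟨a, s⟩ ⟨-, hs⟩ ⟨b, t⟩ ⟨-, ht⟩ h
  simp only [mem_Icc] at hs ht
  have := hg.eq_of_eq (s := -s) (t := -t) ⟨by linarith, by linarith⟩ ⟨by linarith, by linarith⟩ h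
  simpa using this

/-- Every collared circle in the plane is the boundary of a bounded region. -/
theorem IsCollar.exists_isDefining {g : Circle × ℝ → ℂ} (hg : IsCollar g) :
    ∃ (g' : Circle × ℝ → ℂ) (G : ℂ → ℝ), (∀ c, g' (c, 0) = g (c, 0)) ∧ IsDefining g' G := by
  obtain ⟨G, hG, hfib, hoff⟩ := hg.exists_cont_fiber
  obtain ⟨R, hR⟩ := ((isCompact_cylinder (-1) 1).image hg.1).isBounded.subset_closedBall 0
  set R' := max R 0
  have hR' : g '' (univ ×ˢ Icc (-1) 1) ⊆ Metric.closedBall 0 R' :=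
    hR.trans (Metric.closedBall_subset_closedBall (le_max_left _ _))
  have hpre := isPreconnected_compl_closedBall (le_max_right R 0)
  have hne0 : ∀ z ∈ (Metric.closedBall (0 : ℂ) R')ᶜ, G z ≠ 0 := by
    intro z hz h
    have := hoff z fun h' => hz (hR' (image_mono (prod_mono_right Ioo_subset_Icc_self) h'))
    rw [h] at this; norm_num at this
  have hsign : (∀ z ∈ (Metric.closedBall (0 : ℂ) R')ᶜ, 0 < G z) ∨
      ∀ z ∈ (Metric.closedBall (0 : ℂ) R')ᶜ, G z < 0 := by
    by_contra! h
    obtain ⟨⟨x, hx, hx0⟩, y, hy, hy0⟩ := h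
    obtain ⟨z, hz, hz0⟩ := hpre.intermediate_value hx hy hG.continuousOn ⟨hx0, hy0⟩
    exact hne0 z hz hz0
  rcases hsign with h | h
  · refine ⟨g, G, fun _ => rfl, hg, hG, hfib, hoff, ?_⟩
    refine Metric.isBounded_closedBall.subset (t := Metric.closedBall 0 R') fun z hz => ?_
    by_contra h'
    exact absurd (h z h') (not_lt.2 hz)
  · refine ⟨fun p => g (p.1, -p.2), fun z => - G z, by simp, hg.flip, hG.neg, ?_, ?_, ?_⟩
    · intro c t ht
      rw [mem_Icc] at ht
      rw [hfib c (-t) ⟨by linarith, by linarith⟩, neg_neg]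
    · intro z hz
      rw [abs_neg]
      refine hoff z ?_
      rintro ⟨⟨c, t⟩, ⟨-, ht⟩, rfl⟩
      rw [mem_Ioo] at ht
      exact hz ⟨(c, -t), ⟨mem_univ _, ⟨by linarith, by linarith⟩⟩, by simp⟩
    · refine Metric.isBounded_closedBall.subset (t := Metric.closedBall 0 R') fun z hz => ?_
      by_contra h'
      have h1 := h z h'
      have h2 : - G z ≤ 0 := hz
      linarith

namespace IsDefining

variable {g : Circle × ℝ → ℂ} {G : ℂ → ℝ}

theorem eq_zero_iff (h : IsDefining g G) {z : ℂ} : G z = 0 ↔ z ∈ g '' (univ ×ˢ {0}) := by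
  constructor
  · intro hz
    have : z ∈ g '' (univ ×ˢ Ioo (-1) 1) := by
      by_contra h'
      have := h.off z h'
      rw [hz] at this; norm_num at this
    obtain ⟨⟨c, t⟩, ⟨-, ht⟩, rfl⟩ := this
    rw [h.fiber c t (Ioo_subset_Icc_self ht)] at hz
    exact ⟨(c, t), ⟨mem_univ _, hz⟩, rfl⟩
  · rintro ⟨⟨c, t⟩, ⟨-, rfl⟩, rfl⟩
    exact h.fiber c 0 (by norm_num)

theorem isOpen_neg (h : IsDefining g G) : IsOpen {z | G z < 0} := isOpen_lt h.cont continuous_const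

theorem isCompact_nonpos (h : IsDefining g G) : IsCompact {z | G z ≤ 0} :=
  Metric.isCompact_of_isClosed_isBounded (isClosed_le h.cont continuous_const) h.bdd

theorem core_mem_closure (h : IsDefining g G) {P : Set ℂ} {s : Set ℝ}
    (hP : g '' (univ ×ˢ s) ⊆ P) (hs : (0 : ℝ) ∈ closure s) {z : ℂ} (hz : G z = 0) :
    z ∈ closure P := by
  obtain ⟨⟨c, t⟩, ⟨-, rfl⟩, rfl⟩ := h.eq_zero_iff.1 hz
  refine closure_mono hP ?_
  refine image_closure_subset_closure_image h.collar.1 ⟨_, ?_, rfl⟩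
  rw [closure_prod_eq]
  exact ⟨by simp, hs⟩

/-- Each side of a collared circle is connected. -/
theorem isPreconnected_side (h : IsDefining g G) {s : Set ℝ} (hs : s = Iio 0 ∨ s = Ioi 0) :
    IsPreconnected (G ⁻¹' s) := by
  have hso : IsOpen s := by rcases hs with rfl | rfl <;> [exact isOpen_Iio; exact isOpen_Ioi]
  have hcl : ∀ x ∈ closure s, x ∉ s → x = 0 := by
    rcases hs with rfl | rfl
    · intro x hx hx'; rw [closure_Iio, mem_Iic] at hx; rw [mem_Iio, not_lt] at hx'; linarith
    · intro x hx hx'; rw [closure_Ioi, mem_Ici] at hx; rw [mem_Ioi, not_lt] at hx'; linarith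
  have hsc : IsPreconnected (s ∩ Ioo (-1 : ℝ) 1) := by
    rcases hs with rfl | rfl
    · exact (ordConnected_Iio.inter ordConnected_Ioo).isPreconnected
    · exact (ordConnected_Ioi.inter ordConnected_Ioo).isPreconnected
  have hsne : (s ∩ Ioo (-1 : ℝ) 1).Nonempty := by
    rcases hs with rfl | rfl
    · exact ⟨-1/2, by norm_num⟩
    · exact ⟨1/2, by norm_num⟩
  set N := g '' (univ ×ˢ (s ∩ Ioo (-1) 1)) with hN
  have hNc : IsPreconnected N := (isPreconnected_circle_prod hsc).image _ h.collar.1.continuousOn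
  have hNs : N ⊆ G ⁻¹' s := by
    rintro _ ⟨⟨c, t⟩, ⟨-, ht⟩, rfl⟩
    rw [mem_preimage, h.fiber c t (Ioo_subset_Icc_self ht.2)]; exact ht.1
  have hNnhd : ∀ z, G z = 0 → ∃ W ∈ 𝓝 z, W ∩ G ⁻¹' s ⊆ N := by
    intro z hz
    refine ⟨g '' (univ ×ˢ Ioo (-1) 1), (h.collar.isOpen_image isLocallyPlanar_complex isOpen_Ioo
      Ioo_subset_Icc_self).mem_nhds ?_, ?_⟩
    · obtain ⟨⟨c, t⟩, ⟨-, rfl⟩, rfl⟩ := h.eq_zero_iff.1 hz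
      exact ⟨_, ⟨mem_univ _, by norm_num⟩, rfl⟩
    · rintro _ ⟨⟨⟨c, t⟩, ⟨-, ht⟩, rfl⟩, hG⟩
      rw [mem_preimage, h.fiber c t (Ioo_subset_Icc_self ht)] at hG
      exact ⟨_, ⟨mem_univ _, hG, ht⟩, rfl⟩
  obtain ⟨t₀, ht₀⟩ := hsne
  have hx₀ : g (1, t₀) ∈ N := ⟨_, ⟨mem_univ _, ht₀⟩, rfl⟩
  -- every open part of a separation meets the collar
  have key : ∀ u v : Set ℂ, IsOpen u → IsOpen v → G ⁻¹' s ⊆ u ∪ v →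
      (G ⁻¹' s ∩ u).Nonempty → G ⁻¹' s ∩ (u ∩ v) = ∅ → (N ∩ u).Nonempty := by
    intro u v hu hv huv hne hdis
    by_contra hemp
    rw [not_nonempty_iff_eq_empty] at hemp
    have hopen : IsOpen (G ⁻¹' s ∩ u) := (hso.preimage h.cont).inter hu
    have hclosed : IsClosed (G ⁻¹' s ∩ u) := by
      rw [← closure_subset_iff_isClosed]
      intro z hz
      have hzs : G z ∈ closure s :=
        h.cont.closure_preimage_subset _ (closure_mono inter_subset_left hz)
      by_cases hzs' : G z ∈ s
      · refine ⟨hzs', ?_⟩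
        by_contra hzu
        have hzv : z ∈ v := (huv hzs').resolve_left hzu
        obtain ⟨y, hyv, hy⟩ := mem_closure_iff.1 hz v hv hzv
        have hy' : y ∈ G ⁻¹' s ∩ (u ∩ v) := ⟨hy.1, hy.2, hyv⟩
        rw [hdis] at hy'
        exact absurd hy' (notMem_empty _)
      · obtain ⟨W, hW, hWN⟩ := hNnhd z (hcl _ hzs hzs')
        obtain ⟨y, hyW, hy⟩ := mem_closure_iff_nhds.1 hz W hW
        have hy' : y ∈ N ∩ u := ⟨hWN ⟨hyW, hy.1⟩, hy.2⟩
        rw [hemp] at hy'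
        exact absurd hy' (notMem_empty _)
    have := IsClopen.eq_univ ⟨hclosed, hopen⟩ hne
    have h0 : g (1, 0) ∈ G ⁻¹' s ∩ u := this ▸ mem_univ _
    have h1 : G (g (1, 0)) ∈ s := h0.1
    rw [h.fiber 1 0 (by norm_num)] at h1
    rcases hs with rfl | rfl <;> simp at h1
  intro u v hu hv huv hu' hv'
  by_contra hemp
  rw [not_nonempty_iff_eq_empty] at hemp
  have h1 := key u v hu hv huv hu' hemp
  have h2 := key v u hv hu (by rwa [union_comm]) hv' (by rwa [inter_comm v u])
  obtain ⟨y, hy, hyuv⟩ := hNc u v hu hv (hNs.trans huv) h1 h2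
  have hy' : y ∈ G ⁻¹' s ∩ (u ∩ v) := ⟨hNs hy, hyuv⟩
  rw [hemp] at hy'
  exact absurd hy' (notMem_empty _)

theorem isPreconnected_neg (h : IsDefining g G) : IsPreconnected {z | G z < 0} :=
  h.isPreconnected_side (Or.inl rfl)

theorem isPreconnected_pos (h : IsDefining g G) : IsPreconnected {z | 0 < G z} :=
  h.isPreconnected_side (Or.inr rfl)

theorem isPreconnected_nonneg (h : IsDefining g G) : IsPreconnected {z | 0 ≤ G z} := by
  refine h.isPreconnected_pos.subset_closure (fun z hz => le_of_lt (show 0 < G z from hz))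
    fun z hz => ?_
  rcases (show 0 ≤ G z from hz).lt_or_eq with h' | h'
  · exact subset_closure h'
  · refine h.core_mem_closure (s := Ioo 0 1) ?_ ?_ h'.symm
    · rintro _ ⟨⟨c, t⟩, ⟨-, ht⟩, rfl⟩
      rw [mem_Ioo] at ht
      rw [mem_ofPred_eq, h.fiber c t ⟨by linarith, by linarith⟩]; exact ht.1
    · rw [closure_Ioo (by norm_num)]; norm_num

theorem exists_pos_of_not_isBounded (h : IsDefining g G) {s : Set ℂ}
    (hs : ¬ Bornology.IsBounded s) : ∃ z ∈ s, 0 < G z := by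
  by_contra! h'
  exact hs (h.bdd.subset h')

theorem not_isBounded_nonneg (h : IsDefining g G) : ¬ Bornology.IsBounded {z | 0 ≤ G z} := by
  intro hb
  have : {z | 0 ≤ G z} ∪ {z | G z ≤ 0} = univ :=
    eq_univ_of_forall fun z => le_total 0 (G z)
  have h2 := hb.union h.bdd
  rw [this] at h2
  exact NoncompactSpace.noncompact_univ (Metric.isCompact_of_isClosed_isBounded isClosed_univ h2)

theorem core_nonempty (h : IsDefining g G) : ∃ z, G z = 0 := ⟨g (1, 0), h.fiber 1 0 (by norm_num)⟩

theorem isPreconnected_core (h : IsDefining g G) : IsPreconnected {z | G z = 0} := by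
  have : {z | G z = 0} = g '' (univ ×ˢ {0}) := by ext z; exact h.eq_zero_iff
  rw [this]
  exact (isPreconnected_circle_prod isPreconnected_singleton).image _ h.collar.1.continuousOn

/-- A preconnected unbounded set missing the circle lies outside. -/
theorem pos_of_isPreconnected (h : IsDefining g G) {s : Set ℂ} (hs : IsPreconnected s)
    (hb : ¬ Bornology.IsBounded s) (h0 : ∀ z ∈ s, G z ≠ 0) {z : ℂ} (hz : z ∈ s) : 0 < G z := by
  obtain ⟨y, hy, hy0⟩ := h.exists_pos_of_not_isBounded hb
  by_contra hneg
  obtain ⟨x, hx, hx0⟩ := hs.intermediate_value hz hy h.cont.continuousOn ⟨not_lt.1 hneg, hy0.le⟩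
  exact h0 x hx hx0

theorem neg_of_isPreconnected (h : IsDefining g G) {s : Set ℂ} (hs : IsPreconnected s)
    (h0 : ∀ z ∈ s, G z ≠ 0) {y : ℂ} (hy : y ∈ s) (hy0 : G y < 0) {z : ℂ} (hz : z ∈ s) :
    G z < 0 := by
  by_contra hneg
  obtain ⟨x, hx, hx0⟩ := hs.intermediate_value hy hz h.cont.continuousOn ⟨hy0.le, not_lt.1 hneg⟩
  exact h0 x hx hx0

/-- If a collared circle lies inside another one then so does the region it bounds. -/
theorem nonpos_subset_neg {g' : Circle × ℝ → ℂ} {G' : ℂ → ℝ} (h : IsDefining g G)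
    (h' : IsDefining g' G') (hsub : ∀ z, G' z = 0 → G z < 0) {z : ℂ} (hz : G' z ≤ 0) :
    G z < 0 := by
  by_contra hneg
  have := h'.pos_of_isPreconnected h.isPreconnected_nonneg h.not_isBounded_nonneg
    (fun y hy hy0 => absurd (hsub y hy0) (not_lt.2 hy)) (not_lt.1 hneg)
  linarith

end IsDefining

/-- The inside of a collared circle is not a union of pairwise disjoint collared circles. -/
theorem not_forall_inside_exists_circle {g : Circle × ℝ → ℂ} {G : ℂ → ℝ} (h : IsDefining g G)
    {𝒟 : Set (Set ℂ)} (hdis : ∀ D ∈ 𝒟, ∀ E ∈ 𝒟, D ≠ E → Disjoint D E)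
    (hdef : ∀ D ∈ 𝒟, ∃ g G, IsDefining g G ∧ D = {z | G z = 0})
    (hcov : ∀ z, G z < 0 → ∃ D ∈ 𝒟, z ∈ D ∧ ∀ y ∈ D, G y < 0) : False := by
  choose! gD GD hGD hD using hdef
  let 𝓔 : Set (Set ℂ) := {E | ∃ D ∈ 𝒟, (∀ y ∈ D, G y < 0) ∧ E = {z | GD D z ≤ 0}}
  -- a circle through a point of a disc of the family bounds a smaller disc
  have nest : ∀ D ∈ 𝒟, ∀ D' ∈ 𝒟, ∀ z ∈ D', z ∉ D → GD D z ≤ 0 →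
      {z | GD D' z ≤ 0} ⊆ {z | GD D z < 0} := by
    intro D hDm D' hD'm z hzD' hzD hz
    have hne : D' ≠ D := fun e => hzD (e ▸ hzD')
    have hd := hdis D' hD'm D hDm hne
    have h0 : ∀ y ∈ D', GD D y ≠ 0 := fun y hy hy0 =>
      disjoint_left.1 hd hy (by rw [hD D hDm]; exact hy0)
    have hc : IsPreconnected D' := by rw [hD D' hD'm]; exact (hGD D' hD'm).isPreconnected_core
    refine fun y hy => (hGD D hDm).nonpos_subset_neg (hGD D' hD'm) (fun x hx => ?_) hy
    exact (hGD D hDm).neg_of_isPreconnected hc h0 hzD' (lt_of_le_of_ne hz (h0 z hzD'))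
      (by rw [hD D' hD'm]; exact hx)
  have hin : ∀ D ∈ 𝒟, (∀ y ∈ D, G y < 0) → ∀ z, GD D z ≤ 0 → G z < 0 := fun D hDm hDin z hz =>
    h.nonpos_subset_neg (hGD D hDm) (fun x hx => hDin x (by rw [hD D hDm]; exact hx)) hz
  obtain ⟨M, hM⟩ : ∃ M, Minimal (· ∈ 𝓔) M := by
    refine zorn_superset 𝓔 fun c hc hchain => ?_
    rcases c.eq_empty_or_nonempty with rfl | hne
    · have hx₀ : G (g (1, -1)) < 0 := by rw [h.fiber 1 (-1) (by norm_num)]; norm_num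
      obtain ⟨D, hDm, -, hDin⟩ := hcov _ hx₀
      exact ⟨_, ⟨D, hDm, hDin, rfl⟩, by simp⟩
    · have hnonempty : (⋂₀ c).Nonempty := by
        have := hne.to_subtype
        refine IsCompact.nonempty_sInter_of_directed_nonempty_isCompact_isClosed ?_ ?_ ?_ ?_
        · intro x hx y hy
          rcases hchain.total hx hy with hxy | hxy
          · exact ⟨x, hx, Subset.rfl, hxy⟩
          · exact ⟨y, hy, hxy, Subset.rfl⟩
        · rintro E hE
          obtain ⟨D, hDm, -, rfl⟩ := hc hE
          obtain ⟨z, hz⟩ := (hGD D hDm).core_nonempty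
          exact ⟨z, hz.le⟩
        · rintro E hE
          obtain ⟨D, hDm, -, rfl⟩ := hc hE
          exact (hGD D hDm).isCompact_nonpos
        · rintro E hE
          obtain ⟨D, hDm, -, rfl⟩ := hc hE
          exact (hGD D hDm).isCompact_nonpos.isClosed
      obtain ⟨x, hx⟩ := hnonempty
      obtain ⟨E₀, hE₀⟩ := hne
      have hxG : G x < 0 := by
        have := hx E₀ hE₀
        obtain ⟨D, hDm, hDin, rfl⟩ := hc hE₀
        exact hin D hDm hDin x this
      obtain ⟨D', hD'm, hxD', hD'in⟩ := hcov x hxG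
      refine ⟨_, ⟨D', hD'm, hD'in, rfl⟩, fun E hE => ?_⟩
      have hxE := hx E hE
      obtain ⟨D, hDm, hDin, rfl⟩ := hc hE
      by_cases hxD : x ∈ D
      · have : D' = D := by
          by_contra hne
          exact disjoint_left.1 (hdis D' hD'm D hDm hne) hxD' hxD
        rw [this]
      · exact (nest D hDm D' hD'm x hxD' hxD hxE).trans
          fun y hy => le_of_lt (show GD D y < 0 from hy)
  obtain ⟨D, hDm, hDin, rfl⟩ := hM.1
  have hx : GD D (gD D (1, -1)) < 0 := by
    rw [(hGD D hDm).fiber 1 (-1) (by norm_num)]; norm_num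
  obtain ⟨D', hD'm, hxD', hD'in⟩ := hcov _ (hin D hDm hDin _ hx.le)
  have hxD : gD D (1, -1) ∉ D := by
    intro h0
    exact hx.ne ((Set.ext_iff.1 (hD D hDm) _).1 h0)
  have hsub := nest D hDm D' hD'm _ hxD' hxD hx.le
  obtain ⟨z, hz⟩ := (hGD D hDm).core_nonempty
  have := hM.2 ⟨D', hD'm, hD'in, rfl⟩ (hsub.trans fun y hy => le_of_lt (show GD D y < 0 from hy)) hz.le
  have := hsub this
  simp only [mem_ofPred_eq] at this
  linarith

/-! ### Logarithms inside a collared circle -/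

namespace IsDefining

variable {g : Circle × ℝ → ℂ} {G : ℂ → ℝ}

theorem exists_extension (h : IsDefining g G) {φ : ℂ → ℂ} {s : Set ℂ}
    (hφ : ContinuousOn φ ({z | G z ≤ 0} ∩ s)) (h0 : ∀ z ∈ s, G z ≤ 0 → φ z ≠ 0)
    {l : Circle → ℂ} (hl : Continuous l) (hlφ : ∀ c, φ (g (c, 0)) = Complex.exp (l c)) :
    ∃ F Λ : ℂ → ℂ, ContinuousOn F s ∧ (∀ z ∈ s, F z ≠ 0) ∧ (∀ z, G z ≤ 0 → F z = φ z) ∧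
      Continuous Λ ∧ ∀ z, 0 ≤ G z → F z = Complex.exp (Λ z) := by
  classical
  set D : Set (Circle × ℝ) := univ ×ˢ {0} with hDdef
  have hDc : IsCompact D := isCompact_univ.prod isCompact_singleton
  have hDQ : InjOn g D := h.collar.2.mono (prod_mono_right (by simp))
  let lam : ℂ → ℂ := fun z => l (Function.invFunOn g D z).1
  have hlam : ∀ c, lam (g (c, 0)) = l c := by
    intro c
    have : ((c, 0) : Circle × ℝ) ∈ D := ⟨mem_univ _, rfl⟩
    change l (Function.invFunOn g D (g (c, 0))).1 = l c
    rw [hDQ.leftInvOn_invFunOn this]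
  have hlamc : ContinuousOn lam (g '' D) := by
    refine continuousOn_image_of_comp hDc h.collar.1.continuousOn ?_
    refine ContinuousOn.congr (f := fun p : Circle × ℝ => l p.1) (by fun_prop) ?_
    rintro ⟨c, t⟩ ⟨-, rfl⟩
    exact hlam c
  obtain ⟨Λ, hΛ⟩ := ContinuousMap.exists_restrict_eq (hDc.image h.collar.1).isClosed
    ⟨_, hlamc.domRestrict⟩
  have hΛD : ∀ c, Λ (g (c, 0)) = l c := by
    intro c
    have := congrArg (fun F => F ⟨g (c, 0), ⟨(c, 0), ⟨mem_univ c, rfl⟩, rfl⟩⟩) hΛ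
    exact this.trans (hlam c)
  let F : ℂ → ℂ := fun z => if G z ≤ 0 then φ z else Complex.exp (Λ z)
  have hF1 : ∀ z, G z ≤ 0 → F z = φ z := fun z hz => if_pos hz
  have hF2 : ∀ z, 0 ≤ G z → F z = Complex.exp (Λ z) := by
    intro z hz
    rcases hz.lt_or_eq with hz | hz
    · exact if_neg (not_le.2 hz)
    · obtain ⟨⟨c, t⟩, ⟨-, rfl⟩, rfl⟩ := h.eq_zero_iff.1 hz.symm
      rw [hF1 _ hz.symm.le, hlφ, hΛD]
  refine ⟨F, Λ, ?_, ?_, hF1, Λ.continuous, hF2⟩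
  · have h1 : ContinuousOn F ({z | G z ≤ 0} ∩ s) := hφ.congr fun z hz => hF1 z hz.1
    have h2 : ContinuousOn F ({z | 0 ≤ G z} ∩ s) :=
      (Λ.continuous.cexp.continuousOn (s := {z | 0 ≤ G z} ∩ s)).congr fun z hz => hF2 z hz.1
    have hc1 : IsClosed {z | G z ≤ 0} := isClosed_le h.cont continuous_const
    have hc2 : IsClosed {z | 0 ≤ G z} := isClosed_le continuous_const h.cont
    have aux : ∀ A : Set ℂ, IsClosed A → ContinuousOn F (A ∩ s) → ∀ z ∈ s,
        ContinuousWithinAt F (A ∩ s) z := by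
      intro A hA hc z hz
      by_cases hzA : z ∈ A
      · exact hc z ⟨hzA, hz⟩
      · refine continuousWithinAt_of_notMem_closure fun h' => hzA ?_
        exact hA.closure_subset (closure_mono inter_subset_left h')
    intro z hz
    refine ((aux _ hc1 h1 z hz).union (aux _ hc2 h2 z hz)).mono fun y hy => ?_
    rcases le_total (G y) 0 with h' | h'
    · exact Or.inl ⟨h', hy⟩
    · exact Or.inr ⟨h', hy⟩
  · intro z hz
    rcases le_total (G z) 0 with h' | h'
    · rw [hF1 z h']; exact h0 z hz h'
    · rw [hF2 z h']; exact Complex.exp_ne_zero _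

theorem exists_log_nonpos (h : IsDefining g G) {f : ℂ → ℂ} (hf : ContinuousOn f {z | G z ≤ 0})
    (h0 : ∀ z, G z ≤ 0 → f z ≠ 0) :
    ∃ l : ℂ → ℂ, Continuous l ∧ ∀ z, G z ≤ 0 → Complex.exp (l z) = f z := by
  have hgc := h.collar.1
  have hcore : ∀ c, G (g (c, 0)) = 0 := fun c => h.fiber c 0 (by norm_num)
  set a := g (1, -1)
  have ha : G a < 0 := by
    change G (g (1, -1)) < 0
    rw [h.fiber 1 (-1) (by norm_num)]; norm_num
  have hγa : ∀ c, g (c, 0) - a ≠ 0 := by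
    intro c hc
    have := hcore c
    rw [sub_eq_zero.1 hc] at this
    exact ha.ne this
  have hfγ : Continuous fun c : Circle => f (g (c, 0)) :=
    hf.comp_continuous (by fun_prop) fun c => (hcore c).le
  obtain ⟨n, l₁, hl₁, hn⟩ := exists_zpow_mul_exp hfγ fun c => h0 _ (hcore c).le
  obtain ⟨m, l₂, hl₂, hm⟩ := exists_zpow_mul_exp (f := fun c : Circle => g (c, 0) - a)
    (by fun_prop) hγa
  have hn0 : n = 0 := by
    let φ : ℂ → ℂ := fun z => f z ^ m * (z - a) ^ (-n)
    obtain ⟨F, Λ, hF, hF0, hFφ, hΛ, hFΛ⟩ := h.exists_extension (φ := φ) (s := {a}ᶜ)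
      (l := fun c => m * l₁ c - n * l₂ c) (by
        refine ContinuousOn.mul ?_ ?_
        · exact (hf.mono inter_subset_left).zpow₀ _ fun z hz => Or.inl (h0 z hz.1)
        · exact (by fun_prop : ContinuousOn (fun z : ℂ => z - a) _).zpow₀ _
            fun z hz => Or.inl (sub_ne_zero.2 hz.2))
      (fun z hz hz' => mul_ne_zero (zpow_ne_zero _ (h0 z hz'))
        (zpow_ne_zero _ (sub_ne_zero.2 hz))) (by fun_prop) (by
        intro c
        simp only [φ]
        rw [hn c, hm c, mul_zpow, mul_zpow, ← zpow_mul, ← zpow_mul, ← Complex.exp_int_mul,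
          ← Complex.exp_int_mul, sub_eq_add_neg, Complex.exp_add]
        have hc : (c : ℂ) ≠ 0 := Circle.coe_ne_zero c
        have : (c : ℂ) ^ (n * m) * (c : ℂ) ^ (m * -n) = 1 := by
          rw [← zpow_add₀ hc]; convert zpow_zero _; ring
        push_cast
        rw [← neg_mul]
        linear_combination (Complex.exp (m * l₁ c) * Complex.exp (-n * l₂ c)) * this)
    obtain ⟨r, hr, hrK⟩ := Metric.nhds_basis_closedBall.mem_iff.1 (h.isOpen_neg.mem_nhds ha)
    obtain ⟨R, hR⟩ := h.bdd.subset_ball a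
    have hrK' : Metric.closedBall a r ⊆ {z | G z ≤ 0} := fun z hz =>
      le_of_lt (show G z < 0 from hrK hz)
    have hrR : r < R := by
      have := hR (hrK' (show a + r ∈ _ by simp [abs_of_pos hr]))
      simpa [abs_of_pos hr] using this
    obtain ⟨L, hL, hLf⟩ := exists_log_on_closedBall hr (hf.mono hrK') fun z hz => h0 z (hrK' hz)
    let ρ : unitInterval → ℝ := fun t => R + t * (r - R)
    have hρ : ∀ t, 0 < ρ t := fun t => by
      have := t.2.1; have := t.2.2
      simp only [ρ]; nlinarith
    have hρc : Continuous ρ := by fun_prop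
    let P : unitInterval × Circle → ℂ := fun p => a + ρ p.1 * p.2
    have hP : ∀ p, P p ∈ ({a}ᶜ : Set ℂ) := fun p => by
      simp [P, (hρ p.1).ne']
    have hPn : ∀ p, dist (P p) a = ρ p.1 := fun p => by
      simp [P, abs_of_pos (hρ p.1), Circle.norm_coe]
    obtain ⟨μ, hμ, hμF⟩ := exists_continuous_log_of_homotopy (H := fun p => F (P p))
      (hF.comp_continuous (by fun_prop) hP) (fun p => hF0 _ (hP p))
      (l := fun c => Λ (P (0, c))) (by fun_prop) (fun c => by
        refine (hFΛ _ ?_).symm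
        by_contra hlt
        have := hR (show G (P (0, c)) ≤ 0 from (not_le.1 hlt).le)
        rw [Metric.mem_ball, hPn] at this
        simp [ρ] at this)
    have hP1 : ∀ c : Circle, P (1, c) = a + r * c := fun c => by simp [P, ρ]
    have hP1B : ∀ c : Circle, a + r * c ∈ Metric.closedBall a r := fun c => by
      simp [abs_of_pos hr, Circle.norm_coe]
    have hr0 : (r : ℂ) ≠ 0 := by exact_mod_cast hr.ne'
    have key : ∀ c : Circle, Complex.exp (μ c - m * L (a + r * c) + n * Complex.log r) =
        (c : ℂ) ^ (-n) := by
      intro c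
      have hc : (c : ℂ) ≠ 0 := Circle.coe_ne_zero c
      rw [Complex.exp_add, Complex.exp_sub, hμF c, hP1, hFφ _ (hrK' (hP1B c)),
        Complex.exp_int_mul, Complex.exp_int_mul, hLf _ (hP1B c), Complex.exp_log hr0]
      have hfm : f (a + r * c) ^ m ≠ 0 := zpow_ne_zero _ (h0 _ (hrK' (hP1B c)))
      have hrn : (r : ℂ) ^ n ≠ 0 := zpow_ne_zero _ hr0
      simp only [φ, add_sub_cancel_left, mul_zpow, zpow_neg]
      field_simp
    have := zpow_eq_zero_of_log (by fun_prop) key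
    simpa using this
  subst hn0
  obtain ⟨F, -, hF, hF0, hFφ, -, -⟩ := h.exists_extension (φ := f) (s := univ)
    (hf.mono inter_subset_left) (fun z _ hz => h0 z hz) hl₁ (fun c => by simpa using hn c)
  obtain ⟨l, hl, hlF⟩ := exists_continuous_log (continuousOn_univ.1 hF) fun z => hF0 z trivial
  exact ⟨l, hl, fun z hz => (hlF z).trans (hFφ z hz)⟩

/-- The interior level curves of a defining function. -/
theorem level (h : IsDefining g G) {t : ℝ} (ht : t ∈ Ioo (0 : ℝ) 1) :
    ∃ g' G', IsDefining g' G' ∧ ∀ z, (G' z ≤ 0 ↔ G z ≤ -t) ∧ (G' z < 0 ↔ G z < -t) := by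
  obtain ⟨ht0, ht1⟩ := ht
  set r := min t (1 - t)
  have hr : 0 < r := lt_min ht0 (by linarith)
  have hrt : r ≤ t := min_le_left _ _
  have hrt' : r ≤ 1 - t := min_le_right _ _
  have hmem : ∀ s ∈ Icc (-1 : ℝ) 1, r * s - t ∈ Icc (-1 : ℝ) 1 := by
    rintro s ⟨hs, hs'⟩
    constructor <;> nlinarith
  have hgc := h.collar.1
  have hGc := h.cont
  refine ⟨fun p => g (p.1, r * p.2 - t), fun z => (G z + t) / r,
    ⟨⟨by fun_prop, ?_⟩, by fun_prop, ?_, ?_, ?_⟩, ?_⟩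
  · rintro ⟨a, s⟩ ⟨-, hs⟩ ⟨b, u⟩ ⟨-, hu⟩ hE
    obtain ⟨rfl, h2⟩ := h.collar.eq_of_eq (hmem s hs) (hmem u hu) hE
    have : s = u := by
      have : r * s = r * u := by linarith
      exact mul_left_cancel₀ hr.ne' this
    rw [this]
  · intro c s hs
    rw [h.fiber c _ (hmem s hs)]
    field_simp; ring
  · intro z hz
    by_contra! hlt
    rw [abs_div, abs_of_pos hr, div_lt_one hr, abs_lt] at hlt
    have hz' : z ∈ g '' (univ ×ˢ Ioo (-1) 1) := by
      by_contra hz'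
      have := h.off z hz'
      have := abs_lt.2 (show -1 < G z ∧ G z < 1 by constructor <;> linarith)
      linarith
    obtain ⟨⟨c, u⟩, ⟨-, hu⟩, rfl⟩ := hz'
    rw [h.fiber c u (Ioo_subset_Icc_self hu)] at hlt
    refine hz ⟨(c, (u + t) / r), ⟨mem_univ _, ?_, ?_⟩, ?_⟩
    · rw [lt_div_iff₀ hr]; linarith
    · rw [div_lt_one hr]; linarith
    · simp only; congr 2; field_simp; ring
  · refine h.bdd.subset fun z hz => ?_
    have hz : (G z + t) / r ≤ 0 := hz
    rw [div_le_iff₀ hr] at hz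
    change G z ≤ 0
    linarith
  · intro z
    rw [div_le_iff₀ hr, div_lt_iff₀ hr, zero_mul]
    constructor <;> constructor <;> intro _ <;> linarith

theorem exists_log_neg (h : IsDefining g G) {f : ℂ → ℂ} (hf : ContinuousOn f {z | G z < 0})
    (h0 : ∀ z, G z < 0 → f z ≠ 0) :
    ∃ l : ℂ → ℂ, ContinuousOn l {z | G z < 0} ∧ ∀ z, G z < 0 → Complex.exp (l z) = f z := by
  set p := g (1, -1)
  have hp : G p = -1 := h.fiber 1 (-1) (by norm_num)
  have hex : ∀ t : ℝ, ∃ l : ℂ → ℂ, t ∈ Ioo (0 : ℝ) 1 → Continuous l ∧ l p = Complex.log (f p) ∧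
      ∀ z, G z ≤ -t → Complex.exp (l z) = f z := by
    intro t
    by_cases ht : t ∈ Ioo (0 : ℝ) 1
    · obtain ⟨g', G', h', hG'⟩ := h.level ht
      have hsub : ∀ z, G' z ≤ 0 → G z < 0 := fun z hz => by
        have := (hG' z).1.1 hz; have := ht.1; linarith
      obtain ⟨l, hl, hlf⟩ := h'.exists_log_nonpos (hf.mono hsub) fun z hz => h0 z (hsub z hz)
      refine ⟨fun z => l z - l p + Complex.log (f p), fun _ => ⟨by fun_prop, by simp, ?_⟩⟩
      intro z hz
      have hfp := h0 p (by rw [hp]; norm_num)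
      rw [Complex.exp_add, Complex.exp_sub, Complex.exp_log hfp, hlf z ((hG' z).1.2 hz),
        hlf p ((hG' p).1.2 (by rw [hp]; linarith [ht.2])), div_mul_cancel₀ _ hfp]
    · exact ⟨0, fun h => absurd h ht⟩
  choose L hL using hex
  have huniq : ∀ s ∈ Ioo (0 : ℝ) 1, ∀ t ∈ Ioo (0 : ℝ) 1, s ≤ t → ∀ z, G z < -t →
      L s z = L t z := by
    intro s hs t ht hst z hz
    obtain ⟨g', G', h', hG'⟩ := h.level ht
    have hpre : IsPreconnected {z | G z < -t} := by
      have : {z | G z < -t} = {z | G' z < 0} := by ext z; exact (hG' z).2.symm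
      rw [this]; exact h'.isPreconnected_neg
    have := Subtype.preconnectedSpace hpre
    have hpt : G p < -t := by rw [hp]; linarith [ht.2]
    have hc1 := (hL s hs).1
    have hc2 := (hL t ht).1
    have := continuous_log_unique (A := {z | G z < -t}) (f := fun z => L s z)
      (g := fun z => L t z) (by fun_prop) (by fun_prop) (fun x => by
        have hx : G x < -t := x.2
        rw [(hL s hs).2.2 x (by linarith), (hL t ht).2.2 x hx.le]) (a := ⟨p, hpt⟩)
      (by change L s p = L t p; rw [(hL s hs).2.1, (hL t ht).2.1])
    exact congrFun this ⟨z, hz⟩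
  let τ : ℂ → ℝ := fun z => min (-G z) 1 / 2
  have hτc : Continuous τ := by have := h.cont; fun_prop
  have hτ : ∀ z, G z < 0 → τ z ∈ Ioo (0 : ℝ) 1 ∧ G z < -τ z := by
    intro z hz
    have h1 := min_le_left (-G z) 1
    have h2 := min_le_right (-G z) 1
    have h3 : 0 < min (-G z) 1 := lt_min (by linarith) one_pos
    refine ⟨⟨?_, ?_⟩, ?_⟩ <;> simp only [τ] <;> linarith
  refine ⟨fun z => L (τ z) z, ?_, fun z hz => (hL _ (hτ z hz).1).2.2 z (hτ z hz).2.le⟩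
  intro z hz
  refine ContinuousAt.continuousWithinAt ?_
  have hs : τ z / 2 ∈ Ioo (0 : ℝ) 1 := by
    have := (hτ z hz).1; constructor <;> linarith [this.1, this.2]
  refine (hL _ hs).1.continuousAt.congr ?_
  filter_upwards [h.isOpen_neg.mem_nhds hz,
    hτc.continuousAt.eventually (lt_mem_nhds (show τ z / 2 < τ z by linarith [(hτ z hz).1.1]))]
    with y hy hy'
  exact huniq _ hs _ (hτ y hy).1 hy'.le y (hτ y hy).2

/-- A nonvanishing holomorphic function inside a collared circle has a holomorphic square root. -/
theorem exists_sqrt (h : IsDefining g G) {f : ℂ → ℂ} (hf : DifferentiableOn ℂ f {z | G z < 0})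
    (h0 : ∀ z, G z < 0 → f z ≠ 0) :
    ∃ q : ℂ → ℂ, DifferentiableOn ℂ q {z | G z < 0} ∧ ∀ z, G z < 0 → q z ^ 2 = f z := by
  obtain ⟨l, hl, hlf⟩ := h.exists_log_neg hf.continuousOn h0
  refine ⟨fun z => Complex.exp (l z / 2), ?_, fun z hz => ?_⟩
  · intro z hz
    refine DifferentiableAt.differentiableWithinAt ?_
    have hUz := h.isOpen_neg.mem_nhds hz
    have hlz : ContinuousAt l z := hl.continuousAt hUz
    have hfz : DifferentiableAt ℂ f z := hf.differentiableAt hUz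
    suffices DifferentiableAt ℂ l z by fun_prop
    have : DifferentiableAt ℂ (fun y => Complex.log (f y / f z) + l z) z := by
      refine (DifferentiableAt.clog (hfz.div_const _) ?_).add_const _
      rw [div_self (h0 z hz)]; exact Complex.one_mem_slitPlane
    refine this.congr_of_eventuallyEq ?_
    have him : ContinuousAt (fun y => (l y - l z).im) z := by fun_prop
    filter_upwards [hUz, him.eventually (lt_mem_nhds (show -Real.pi < (l z - l z).im by
      simp [Real.pi_pos])), him.eventually (gt_mem_nhds (show (l z - l z).im < Real.pi by
      simp [Real.pi_pos]))] with y hy h1 h2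
    rw [← hlf y hy, ← hlf z hz, ← Complex.exp_sub, Complex.log_exp h1 h2.le, sub_add_cancel]
  · rw [← Complex.exp_nat_mul, ← hlf z hz]; congr 1; push_cast; ring

end IsDefining

/-! ### The Riemann mapping theorem for bounded domains with square roots -/

/-- The disc automorphism taking `a` to `0`. -/
noncomputable def mobius (a w : ℂ) : ℂ := (w - a) / (1 - (starRingEnd ℂ) a * w)

theorem one_sub_conj_mul_ne_zero {a w : ℂ} (ha : ‖a‖ < 1) (hw : ‖w‖ < 1) :
    1 - (starRingEnd ℂ) a * w ≠ 0 := by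
  intro h
  have h1 : ‖(starRingEnd ℂ) a * w‖ < 1 := by
    rw [norm_mul, RCLike.norm_conj]
    nlinarith [norm_nonneg a, norm_nonneg w]
  rw [← sub_eq_zero.1 h] at h1
  simp at h1

theorem norm_mobius_lt_one {a w : ℂ} (ha : ‖a‖ < 1) (hw : ‖w‖ < 1) : ‖mobius a w‖ < 1 := by
  have h0 := one_sub_conj_mul_ne_zero ha hw
  rw [mobius, norm_div, div_lt_one (norm_pos_iff.2 h0)]
  refine lt_of_pow_lt_pow_left₀ 2 (norm_nonneg _) ?_
  have ha2 : ‖a‖ ^ 2 < 1 := by nlinarith [norm_nonneg a]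
  have hw2 : ‖w‖ ^ 2 < 1 := by nlinarith [norm_nonneg w]
  rw [← Complex.normSq_eq_norm_sq, Complex.normSq_apply] at *
  rw [← Complex.normSq_eq_norm_sq, Complex.normSq_apply] at *
  simp only [Complex.sub_re, Complex.sub_im, Complex.one_re, Complex.one_im, Complex.mul_re,
    Complex.mul_im, Complex.conj_re, Complex.conj_im]
  nlinarith [mul_pos (sub_pos.2 ha2) (sub_pos.2 hw2)]

theorem mobius_neg_mobius {a w : ℂ} (ha : ‖a‖ < 1) (hw : ‖w‖ < 1) :
    mobius (-a) (mobius a w) = w := by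
  have h0 := one_sub_conj_mul_ne_zero ha hw
  have h1 := one_sub_conj_mul_ne_zero (a := -a) (by simpa) (norm_mobius_lt_one ha hw)
  have h2 := one_sub_conj_mul_ne_zero ha ha
  rw [mobius, div_eq_iff h1]
  simp only [mobius, map_neg]
  generalize (starRingEnd ℂ) a = b at h0
  have h0' : 1 - w * b ≠ 0 := by rwa [mul_comm]
  field_simp
  ring

theorem differentiableOn_mobius {a : ℂ} (ha : ‖a‖ < 1) :
    DifferentiableOn ℂ (mobius a) (Metric.ball 0 1) := by
  intro w hw
  refine DifferentiableAt.differentiableWithinAt ?_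
  unfold mobius
  refine DifferentiableAt.div (by fun_prop) (by fun_prop) ?_
  exact one_sub_conj_mul_ne_zero ha (by simpa using hw)

theorem mapsTo_mobius {a : ℂ} (ha : ‖a‖ < 1) :
    MapsTo (mobius a) (Metric.ball 0 1) (Metric.ball 0 1) := fun w hw => by
  simpa using norm_mobius_lt_one ha (by simpa using hw)

/-- The strict Schwarz lemma for a map which is not injective. -/
theorem norm_lt_norm_of_not_injOn {ψ : ℂ → ℂ} (hd : DifferentiableOn ℂ ψ (Metric.ball 0 1))
    (hm : MapsTo ψ (Metric.ball 0 1) (Metric.ball 0 1)) (h0 : ψ 0 = 0)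
    (hinj : ¬ InjOn ψ (Metric.ball 0 1)) {w : ℂ} (hw : w ∈ Metric.ball (0 : ℂ) 1) (hw0 : w ≠ 0) :
    ‖ψ w‖ < ‖w‖ := by
  have hm' : MapsTo ψ (Metric.ball 0 1) (Metric.closedBall (ψ 0) 1) := by
    rw [h0]; exact hm.mono_right Metric.ball_subset_closedBall
  by_contra! hle
  refine hinj ?_
  have hnorm : ‖ψ w‖ = ‖w‖ :=
    le_antisymm (Complex.norm_le_norm_of_mapsTo_ball hd
      (hm.mono_right Metric.ball_subset_closedBall) h0 (by simpa using hw)) hle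
  obtain ⟨C, hC, hE⟩ := Complex.affine_of_mapsTo_ball_of_exists_norm_dslope_eq_div' hd hm' ⟨w, hw, by
    rw [dslope_of_ne _ hw0, slope_def_field, h0, sub_zero, sub_zero, norm_div, hnorm, div_self
      (norm_ne_zero_iff.2 hw0), div_one]⟩
  have hC0 : C ≠ 0 := by rintro rfl; simp at hC
  intro x hx y hy hxy
  rw [hE hx, hE hy] at hxy
  simpa [h0, hC0] using hxy

/-- Hurwitz's theorem, local form. -/
theorem eventually_eq_zero_of_tendsto {ι : Type*} {φ : Filter ι} [φ.NeBot] {F : ι → ℂ → ℂ}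
    {f : ℂ → ℂ} {V : Set ℂ} (hV : IsOpen V) (h : TendstoLocallyUniformlyOn F f φ V)
    (hF : ∀ n, DifferentiableOn ℂ (F n) V) (h0 : ∀ n, ∀ z ∈ V, F n z ≠ 0) {z₀ : ℂ}
    (hz₀ : z₀ ∈ V) (hf0 : f z₀ = 0) : ∀ᶠ z in 𝓝 z₀, f z = 0 := by
  have hf := h.differentiableOn (Filter.Eventually.of_forall hF) hV
  by_contra hne
  have hpunct := ((hf.analyticAt (hV.mem_nhds hz₀)).eventually_eq_zero_or_eventually_ne_zero).resolve_left hne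
  rw [eventually_nhdsWithin_iff] at hpunct
  obtain ⟨r, hr, hrV⟩ := Metric.nhds_basis_closedBall.mem_iff.1
    (Filter.inter_mem (hV.mem_nhds hz₀) hpunct)
  have hsph : (Metric.sphere z₀ r).Nonempty := (NormedSpace.sphere_nonempty).2 hr.le
  have hBV : Metric.closedBall z₀ r ⊆ V := fun z hz => (hrV hz).1
  obtain ⟨y, hy, hmin⟩ := (isCompact_sphere z₀ r).exists_isMinOn hsph
    ((hf.continuousOn.mono (Metric.sphere_subset_closedBall.trans hBV)).norm)
  set m := ‖f y‖
  have hm : 0 < m := by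
    refine norm_pos_iff.2 ((hrV (Metric.sphere_subset_closedBall hy)).2 ?_)
    rintro rfl
    simp at hy; exact hr.ne hy
  have hunif := (tendstoLocallyUniformlyOn_iff_forall_isCompact hV).1 h _ hBV
    (isCompact_closedBall z₀ r)
  obtain ⟨n, hn⟩ := (Metric.tendstoUniformlyOn_iff.1 hunif (m / 4) (by positivity)).exists
  have hn' : ∀ z ∈ Metric.closedBall z₀ r, ‖f z - F n z‖ < m / 4 := fun z hz => by
    have := hn z hz; rwa [dist_eq_norm] at this
  have hz₀n : ‖F n z₀‖ < m / 4 := by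
    have := hn' z₀ (Metric.mem_closedBall_self hr.le)
    rwa [hf0, zero_sub, norm_neg] at this
  have hd : DiffContOnCl ℂ (fun z => (F n z)⁻¹) (Metric.ball z₀ r) := by
    refine DifferentiableOn.diffContOnCl ?_
    rw [closure_ball _ hr.ne']
    exact ((hF n).mono hBV).inv fun z hz => h0 n z (hBV hz)
  have hle := Complex.norm_le_of_forall_mem_frontier_norm_le Metric.isBounded_ball hd
    (C := (3 * m / 4)⁻¹) (fun z hz => by
      rw [frontier_ball _ hr.ne'] at hz
      have h1 := hn' z (Metric.sphere_subset_closedBall hz)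
      have h2 : m ≤ ‖f z‖ := hmin hz
      have h3 := norm_sub_norm_le (f z) (F n z)
      rw [norm_inv]
      exact inv_anti₀ (by positivity) (by linarith)) (subset_closure (Metric.mem_ball_self hr))
  rw [norm_inv, inv_le_inv₀ (norm_pos_iff.2 (h0 n z₀ hz₀)) (by positivity)] at hle
  linarith

/-- A weak form of Montel's theorem: pointwise convergence along a filter of holomorphic maps
into the disc is locally uniform. -/
theorem tendstoLocallyUniformlyOn_of_mapsTo_ball {ι : Type*} {φ : Filter ι} [φ.NeBot]
    {F : ι → ℂ → ℂ} {f : ℂ → ℂ} {U : Set ℂ} (hU : IsOpen U)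
    (hF : ∀ n, DifferentiableOn ℂ (F n) U) (hm : ∀ n, MapsTo (F n) U (Metric.ball 0 1))
    (hlim : ∀ z ∈ U, Filter.Tendsto (fun n => F n z) φ (𝓝 (f z))) :
    TendstoLocallyUniformlyOn F f φ U := by
  rw [Metric.tendstoLocallyUniformlyOn_iff]
  intro ε hε x hx
  obtain ⟨r, hr, hrU⟩ := Metric.isOpen_iff.1 hU x hx
  have hlip : ∀ n, ∀ y ∈ Metric.ball x r, dist (F n y) (F n x) ≤ 2 / r * dist y x := by
    intro n y hy
    refine Complex.dist_le_div_mul_dist_of_mapsTo_ball ((hF n).mono hrU) (fun z hz => ?_) hy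
    have h1 := hm n (hrU hz)
    have h2 := hm n hx
    rw [mem_ball_zero_iff] at h1 h2
    rw [Metric.mem_closedBall, dist_eq_norm]
    linarith [norm_sub_le (F n z) (F n x)]
  have hlipf : ∀ y ∈ Metric.ball x r, dist (f y) (f x) ≤ 2 / r * dist y x := fun y hy =>
    le_of_tendsto ((hlim y (hrU hy)).dist (hlim x hx))
      (Filter.Eventually.of_forall fun n => hlip n y hy)
  refine ⟨Metric.ball x (min r (ε * r / 8)),
    mem_nhdsWithin_of_mem_nhds (Metric.ball_mem_nhds x (by positivity)), ?_⟩
  filter_upwards [(Metric.tendsto_nhds.1 (hlim x hx)) (ε / 2) (by positivity)] with n hn y hy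
  rw [Metric.mem_ball, lt_min_iff] at hy
  have h1 := hlip n y hy.1
  have h2 := hlipf y hy.1
  have h3 : 2 / r * dist y x < ε / 4 := by
    rw [div_mul_eq_mul_div, div_lt_iff₀ hr]; linarith [hy.2]
  have h4 := dist_triangle4 (f y) (f x) (F n x) (F n y)
  rw [dist_comm (f x), dist_comm (F n x) (F n y)] at h4
  linarith

/-- A bounded domain in which nonvanishing holomorphic functions have square roots is conformally
a disc. -/
theorem exists_riemann_map {U : Set ℂ} (hU : IsOpen U) (hUb : Bornology.IsBounded U)
    (hUc : IsPreconnected U) (h0U : (0 : ℂ) ∈ U)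
    (hsqrt : ∀ f : ℂ → ℂ, DifferentiableOn ℂ f U → (∀ z ∈ U, f z ≠ 0) →
      ∃ q : ℂ → ℂ, DifferentiableOn ℂ q U ∧ ∀ z ∈ U, q z ^ 2 = f z) :
    ∃ F : ℂ → ℂ, DifferentiableOn ℂ F U ∧ BijOn F U (Metric.ball 0 1) ∧
      (∀ z ∈ U, deriv F z ≠ 0) ∧ F 0 = 0 := by
  classical
  let 𝓕 : Set (ℂ → ℂ) := {f | DifferentiableOn ℂ f U ∧ InjOn f U ∧ MapsTo f U (Metric.ball 0 1) ∧
    (∀ z ∈ U, deriv f z ≠ 0) ∧ f 0 = 0}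
  obtain ⟨b, hbU, hb0⟩ : ∃ b ∈ U, b ≠ 0 := by
    obtain ⟨r, hr, hrU⟩ := Metric.isOpen_iff.1 hU 0 h0U
    refine ⟨(r / 2 : ℝ), hrU ?_, ?_⟩
    · simp [abs_of_pos hr]; linarith
    · exact_mod_cast (half_pos hr).ne'
  obtain ⟨R, hR0, hR⟩ := hUb.subset_ball_lt 0 0
  have hRne : (R : ℂ) ≠ 0 := by exact_mod_cast hR0.ne'
  have hne : (fun z : ℂ => z / R) ∈ 𝓕 := by
    refine ⟨by fun_prop, fun x _ y _ hxy => ?_, fun z hz => ?_, fun z _ => ?_, by simp⟩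
    · simpa [hRne] using hxy
    · have := hR hz
      rw [mem_ball_zero_iff] at this ⊢
      rwa [norm_div, Complex.norm_real, Real.norm_of_nonneg hR0.le, div_lt_one hR0]
    · rw [deriv_div_const, deriv_id'']; simp [hRne]
  set M := sSup ((fun f : ℂ → ℂ => ‖f b‖) '' 𝓕) with hM
  have hbdd : BddAbove ((fun f : ℂ → ℂ => ‖f b‖) '' 𝓕) := by
    refine ⟨1, ?_⟩
    rintro _ ⟨f, hf, rfl⟩
    have := hf.2.2.1 hbU
    rw [mem_ball_zero_iff] at this
    exact this.le
  have hMle : ∀ f ∈ 𝓕, ‖f b‖ ≤ M := fun f hf => le_csSup hbdd ⟨f, hf, rfl⟩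
  have hMpos : 0 < M := by
    refine lt_of_lt_of_le ?_ (hMle _ hne)
    simp [hb0, hR0.ne']
  obtain ⟨u, -, hu, huM⟩ := exists_seq_tendsto_sSup (Set.Nonempty.image _ ⟨_, hne⟩) hbdd
  choose f hf hfu using huM
  -- a limit along an ultrafilter
  let φ : Ultrafilter ℕ := Filter.hyperfilter ℕ
  have hφ : (φ : Filter ℕ) ≤ Filter.atTop := Nat.hyperfilter_le_atTop
  have hlim : ∀ z, ∃ l, z ∈ U → Filter.Tendsto (fun n => f n z) φ (𝓝 l) := by
    intro z
    by_cases hz : z ∈ U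
    · obtain ⟨l, -, hl⟩ := (isCompact_closedBall (0 : ℂ) 1).ultrafilter_le_nhds
        (φ.map fun n => f n z) (by
          rw [Filter.le_principal_iff]
          change ∀ᶠ n in (φ : Filter ℕ), f n z ∈ Metric.closedBall 0 1
          exact Filter.Eventually.of_forall fun n =>
            Metric.ball_subset_closedBall ((hf n).2.2.1 hz))
      exact ⟨l, fun _ => hl⟩
    · exact ⟨0, fun h => absurd h hz⟩
  choose F hF using hlim
  have hTLU : TendstoLocallyUniformlyOn f F φ U :=
    tendstoLocallyUniformlyOn_of_mapsTo_ball hU (fun n => (hf n).1) (fun n => (hf n).2.2.1) hF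
  have hFd : DifferentiableOn ℂ F U :=
    hTLU.differentiableOn (Filter.Eventually.of_forall fun n => (hf n).1) hU
  have hF0 : F 0 = 0 := tendsto_nhds_unique (hF 0 h0U) (by simp [(hf _).2.2.2.2])
  have hFb : ‖F b‖ = M := by
    refine tendsto_nhds_unique (hF b hbU).norm ?_
    simp only [hfu]
    exact hu.mono_left hφ
  have hFan : AnalyticOnNhd ℂ F U := hFd.analyticOnNhd hU
  have hnc : ∀ c, ¬ EqOn F (fun _ => c) U := by
    intro c hc
    have h1 := hc h0U
    have h2 := hc hbU
    simp only at h1 h2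
    rw [h2, ← h1, hF0, norm_zero] at hFb
    exact hMpos.ne hFb
  have hFinj : InjOn F U := by
    intro z₁ hz₁ z₂ hz₂ heq
    by_contra hne
    refine hnc (F z₁) (hFan.eqOn_of_preconnected_of_eventuallyEq analyticOnNhd_const hUc hz₂ ?_)
    have hVo : IsOpen (U ∩ {z₁}ᶜ) := hU.inter isOpen_compl_singleton
    have hT : TendstoLocallyUniformlyOn (fun n z => f n z - f n z₁) (fun z => F z - F z₁) φ
        (U ∩ {z₁}ᶜ) :=
      (hTLU.mono inter_subset_left).sub
        ((hF z₁ hz₁).tendstoUniformlyOn_const _).tendstoLocallyUniformlyOn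
    have := eventually_eq_zero_of_tendsto hVo hT
      (fun n => ((hf n).1.mono inter_subset_left).sub_const _)
      (fun n z hz h => hz.2 ((hf n).2.1 hz.1 hz₁ (sub_eq_zero.1 h))) (z₀ := z₂)
      ⟨hz₂, fun h => hne h.symm⟩ (by rw [heq, sub_self])
    filter_upwards [this] with z hz using sub_eq_zero.1 hz
  have hFder : ∀ z ∈ U, deriv F z ≠ 0 := by
    intro z hz h
    have := eventually_eq_zero_of_tendsto hU
      (hTLU.deriv (Filter.Eventually.of_forall fun n => (hf n).1) hU)
      (fun n => (hf n).1.deriv hU) (fun n => (hf n).2.2.2.1) hz h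
    have hd0 : EqOn (deriv F) 0 U :=
      (hFd.deriv hU).analyticOnNhd hU |>.eqOn_of_preconnected_of_eventuallyEq analyticOnNhd_const
        hUc hz this
    refine hnc (F 0) fun x hx => ?_
    exact hU.is_const_of_deriv_eq_zero hUc hFd hd0 hx h0U
  have hFmaps : MapsTo F U (Metric.ball 0 1) := by
    have hle : ∀ z ∈ U, ‖F z‖ ≤ 1 := fun z hz =>
      le_of_tendsto (hF z hz).norm (Filter.Eventually.of_forall fun n => by
        have := (hf n).2.2.1 hz
        rw [mem_ball_zero_iff] at this
        exact this.le)
    intro z hz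
    rw [mem_ball_zero_iff]
    refine lt_of_le_of_ne (hle z hz) fun h1 => ?_
    have := Complex.norm_eqOn_of_isPreconnected_of_isMaxOn hUc hU hFd hz
      (fun y hy => by simpa [h1] using hle y hy) h0U
    simp [hF0, h1] at this
  refine ⟨F, hFd, ⟨hFmaps, hFinj, ?_⟩, hFder, hF0⟩
  intro a ha
  by_contra hna
  have ha1 : ‖a‖ < 1 := by simpa using ha
  have hna1 : ‖-a‖ < 1 := by simpa using ha1
  obtain ⟨q, hqd, hq⟩ := hsqrt (fun z => mobius a (F z))
    ((differentiableOn_mobius ha1).comp hFd hFmaps) (fun z hz h => hna ⟨z, hz, by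
      have := mobius_neg_mobius ha1 (w := F z) (by simpa using hFmaps hz)
      rw [h] at this
      simpa [mobius] using this.symm⟩)
  have hq1 : ∀ z ∈ U, ‖q z‖ < 1 := fun z hz => by
    have : ‖q z‖ ^ 2 < 1 := by
      rw [← norm_pow, hq z hz]; exact norm_mobius_lt_one ha1 (by simpa using hFmaps hz)
    nlinarith [norm_nonneg (q z)]
  set c := q 0
  have hc1 : ‖c‖ < 1 := hq1 0 h0U
  have hnc1 : ‖-c‖ < 1 := by simpa using hc1
  let h : ℂ → ℂ := fun z => mobius c (q z)
  let ψ : ℂ → ℂ := fun w => mobius (-a) (mobius (-c) w ^ 2)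
  have hsq : MapsTo (fun w : ℂ => mobius (-c) w ^ 2) (Metric.ball 0 1) (Metric.ball 0 1) := by
    intro w hw
    have := mapsTo_mobius hnc1 hw
    rw [mem_ball_zero_iff] at this ⊢
    rw [norm_pow]
    exact pow_lt_one₀ (norm_nonneg _) this two_ne_zero
  have hψd : DifferentiableOn ℂ ψ (Metric.ball 0 1) :=
    (differentiableOn_mobius hna1).comp ((differentiableOn_mobius hnc1).pow 2) hsq
  have hψm : MapsTo ψ (Metric.ball 0 1) (Metric.ball 0 1) := (mapsTo_mobius hna1).comp hsq
  have hFh : ∀ z ∈ U, F z = ψ (h z) := fun z hz => by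
    simp only [ψ, h]
    rw [mobius_neg_mobius hc1 (hq1 z hz), hq z hz,
      mobius_neg_mobius ha1 (by simpa using hFmaps hz)]
  have hhd : DifferentiableOn ℂ h U :=
    (differentiableOn_mobius hc1).comp hqd fun z hz => by simpa using hq1 z hz
  have hhm : MapsTo h U (Metric.ball 0 1) := fun z hz =>
    mapsTo_mobius hc1 (by simpa using hq1 z hz)
  have hh0 : h 0 = 0 := by simp [h, mobius, c]
  have hh : h ∈ 𝓕 := by
    refine ⟨hhd, fun x hx y hy hxy => hFinj hx hy ?_, hhm, fun z hz hz0 => hFder z hz ?_, hh0⟩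
    · rw [hFh x hx, hFh y hy, hxy]
    · have hev : F =ᶠ[𝓝 z] ψ ∘ h := by
        filter_upwards [hU.mem_nhds hz] with y hy using hFh y hy
      rw [hev.deriv_eq, deriv_comp _ (hψd.differentiableAt (Metric.isOpen_ball.mem_nhds (hhm hz)))
        (hhd.differentiableAt (hU.mem_nhds hz)), hz0, mul_zero]
  have hψ0 : ψ 0 = 0 := by
    have := hFh 0 h0U
    rw [hh0, hF0] at this
    exact this.symm
  have hlt := norm_lt_norm_of_not_injOn hψd hψm hψ0 (fun hinj => by
    have hx : ‖(1 / 2 : ℂ)‖ < 1 := by norm_num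
    have hy : ‖(-(1 / 2) : ℂ)‖ < 1 := by norm_num
    have := hinj (mapsTo_mobius hc1 (mem_ball_zero_iff.2 hx)) (mapsTo_mobius hc1 (mem_ball_zero_iff.2 hy))
      (by simp only [ψ]; rw [mobius_neg_mobius hc1 hx, mobius_neg_mobius hc1 hy, neg_sq])
    have := congrArg (mobius (-c)) this
    rw [mobius_neg_mobius hc1 hx, mobius_neg_mobius hc1 hy] at this
    norm_num at this) (hhm hbU) (fun h' => hb0 (hh.2.1 hbU h0U (by rw [h', hh0])))
  rw [← hFh b hbU, hFb] at hlt
  exact absurd (hMle h hh) (not_le.2 hlt)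

theorem lintegral_norm_deriv_sq_lt_top {f : ℂ → ℂ} {U : Set ℂ} (hU : IsOpen U)
    (hf : DifferentiableOn ℂ f U) (hinj : InjOn f U) (hb : Bornology.IsBounded (f '' U)) :
    ∫⁻ w in U, ENNReal.ofReal (‖deriv f w‖ ^ 2) < ⊤ := by
  have hd : ∀ x ∈ U, HasFDerivWithinAt f
      ((ContinuousLinearMap.toSpanSingleton ℂ (deriv f x)).restrictScalars ℝ) U x := fun x hx =>
    ((hf.differentiableAt (hU.mem_nhds hx)).hasDerivAt.hasFDerivAt.restrictScalars ℝ).hasFDerivWithinAt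
  have hdet : ∀ c : ℂ, |((ContinuousLinearMap.toSpanSingleton ℂ c).restrictScalars ℝ).det| =
      ‖c‖ ^ 2 := fun c => by
    simp [ContinuousLinearMap.det, LinearMap.det_restrictScalars,
      Algebra.norm_complex_eq, Complex.normSq_eq_norm_sq]
  have := MeasureTheory.lintegral_abs_det_fderiv_eq_addHaar_image MeasureTheory.volume
    hU.measurableSet hd hinj
  simp only [hdet] at this
  rw [this]
  exact hb.measure_lt_top

theorem lintegral_eq_lintegral_polar {Q : ℂ → ENNReal} (hQ : Measurable Q) :
    (∫⁻ w, Q w = ∫⁻ r in Ioi (0 : ℝ), ∫⁻ φ in Ioo (-Real.pi) Real.pi,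
      ENNReal.ofReal r * Q (r * Complex.exp (φ * Complex.I))) ∧
    ∫⁻ w, Q w = ∫⁻ φ in Ioo (-Real.pi) Real.pi, ∫⁻ r in Ioi (0 : ℝ),
      ENNReal.ofReal r * Q (r * Complex.exp (φ * Complex.I)) := by
  have hm : Measurable fun p : ℝ × ℝ =>
      ENNReal.ofReal p.1 * Q (p.1 * Complex.exp (p.2 * Complex.I)) := by
    refine Measurable.mul (by fun_prop) (hQ.comp (Continuous.measurable (by fun_prop)))
  have h : ∫⁻ w, Q w = ∫⁻ p in Ioi (0 : ℝ) ×ˢ Ioo (-Real.pi) Real.pi,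
      ENNReal.ofReal p.1 * Q (p.1 * Complex.exp (p.2 * Complex.I)) := by
    rw [← Complex.lintegral_comp_polarCoord_symm]
    simp [Complex.exp_mul_I, polarCoord_target]
  rw [h, MeasureTheory.Measure.volume_eq_prod, ← MeasureTheory.Measure.prod_restrict]
  exact ⟨MeasureTheory.lintegral_prod _ hm.aemeasurable,
    MeasureTheory.lintegral_prod_symm _ hm.aemeasurable⟩

theorem ae_exists_radial_limit {f : ℂ → ℂ}
    (hf : DifferentiableOn ℂ f (Metric.ball 0 1)) (hinj : InjOn f (Metric.ball 0 1))
    (hb : Bornology.IsBounded (f '' Metric.ball 0 1)) :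
    ∀ᵐ φ : ℝ, φ ∈ Ioo (-Real.pi) Real.pi →
      ∃ l, Filter.Tendsto (fun r : ℝ => f (r * Complex.exp (φ * Complex.I))) (𝓝[<] 1) (𝓝 l) := by
  have hU : IsOpen (Metric.ball (0 : ℂ) 1) := Metric.isOpen_ball
  have hE := lintegral_norm_deriv_sq_lt_top hU hf hinj hb
  have hQ : Measurable ((Metric.ball (0 : ℂ) 1).indicator
      fun w => ENNReal.ofReal (‖deriv f w‖ ^ 2)) :=
    ((measurable_deriv f).norm.pow_const 2).ennreal_ofReal.indicator hU.measurableSet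
  rw [← MeasureTheory.lintegral_indicator hU.measurableSet,
    (lintegral_eq_lintegral_polar hQ).2] at hE
  rw [← MeasureTheory.ae_restrict_iff' measurableSet_Ioo]
  have hae := MeasureTheory.ae_lt_top' (by
    refine (Measurable.lintegral_prod_right' (f := fun p : ℝ × ℝ => ENNReal.ofReal p.2 *
      (Metric.ball (0 : ℂ) 1).indicator (fun w => ENNReal.ofReal (‖deriv f w‖ ^ 2))
        (p.2 * Complex.exp (p.1 * Complex.I))) ?_).aemeasurable
    exact Measurable.mul (by fun_prop) (hQ.comp (Continuous.measurable (by fun_prop)))) hE.ne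
  filter_upwards [hae] with φ hφ
  set e := Complex.exp (φ * Complex.I)
  have he : ‖e‖ = 1 := Complex.norm_exp_ofReal_mul_I φ
  have hmem : ∀ r ∈ Ico (1 / 2 : ℝ) 1, (r * e : ℂ) ∈ Metric.ball (0 : ℂ) 1 := fun r hr => by
    rw [mem_ball_zero_iff, norm_mul, he, mul_one, Complex.norm_real, Real.norm_eq_abs,
      abs_of_nonneg (by linarith [hr.1])]
    exact hr.2
  have hder : ∀ r ∈ Ico (1 / 2 : ℝ) 1,
      HasDerivAt (fun r : ℝ => f (r * e)) (deriv f (r * e) * e) r := fun r hr => by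
    have h1 := (hf.differentiableAt (hU.mem_nhds (hmem r hr))).hasDerivAt
    have h2 : HasDerivAt (fun r : ℝ => (r * e : ℂ)) e r := by
      simpa using (Complex.ofRealCLM.hasDerivAt (x := r)).mul_const e
    exact h1.comp r h2
  have hint : MeasureTheory.IntegrableOn (fun r : ℝ => deriv f (r * e) * e) (Ico (1 / 2) 1) := by
    refine ⟨((measurable_deriv f).comp (Continuous.measurable (by fun_prop))
      |>.mul_const e).aestronglyMeasurable, ?_⟩
    rw [MeasureTheory.hasFiniteIntegral_iff_enorm]
    have hle : ∀ r ∈ Ico (1 / 2 : ℝ) 1, ‖deriv f (r * e) * e‖ₑ ≤ 1 + 2 * (ENNReal.ofReal r *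
        (Metric.ball (0 : ℂ) 1).indicator (fun w => ENNReal.ofReal (‖deriv f w‖ ^ 2)) (r * e)) := by
      intro r hr
      rw [indicator_of_mem (hmem r hr), ← ENNReal.ofReal_mul (by linarith [hr.1]),
        ← ofReal_norm, norm_mul, he, mul_one, ← ENNReal.ofReal_one, ← ENNReal.ofReal_ofNat,
        ← ENNReal.ofReal_mul (by norm_num), ← ENNReal.ofReal_add (by norm_num)]
      · refine ENNReal.ofReal_le_ofReal ?_
        nlinarith [sq_nonneg (‖deriv f (r * e)‖ - 1), sq_nonneg ‖deriv f (r * e)‖, hr.1]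
      · have := hr.1
        positivity
    refine (MeasureTheory.setLIntegral_mono' measurableSet_Ico hle).trans_lt ?_
    rw [MeasureTheory.lintegral_add_left measurable_const, MeasureTheory.lintegral_const_mul' _ _
      (by simp)]
    refine ENNReal.add_lt_top.2 ⟨by simp, ENNReal.mul_lt_top (by simp) (lt_of_le_of_lt
      (MeasureTheory.lintegral_mono_set fun r hr => ?_) hφ)⟩
    exact lt_of_lt_of_le (by norm_num) hr.1
  have hint' : MeasureTheory.IntegrableOn (fun r : ℝ => deriv f (r * e) * e)
      (uIcc (1 / 2) 1) := by
    rw [uIcc_of_le (by norm_num), integrableOn_Icc_iff_integrableOn_Ico]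
    exact hint
  have hcont := intervalIntegral.continuousOn_primitive_interval hint'
  rw [uIcc_of_le (by norm_num)] at hcont
  refine ⟨f ((1 / 2 : ℝ) * e) + ∫ t in (1 / 2 : ℝ)..1, deriv f (t * e) * e, ?_⟩
  have ht := ((hcont 1 (by norm_num)).mono_left
    (nhdsWithin_mono 1 (Ico_subset_Icc_self (b := (1 / 2 : ℝ)) (a := 1)))).const_add
      (f ((1 / 2 : ℝ) * e))
  rw [nhdsWithin_Ico_eq_nhdsLT (by norm_num)] at ht
  refine ht.congr' ?_
  filter_upwards [Ico_mem_nhdsLT (a := (1 / 2 : ℝ)) (b := 1) (by norm_num)] with r hr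
  rw [intervalIntegral.integral_eq_sub_of_hasDerivAt (f := fun r : ℝ => f (r * e))]
  · ring
  · intro x hx
    rw [uIcc_of_le hr.1] at hx
    exact hder x ⟨hx.1, hx.2.trans_lt hr.2⟩
  · rw [intervalIntegrable_iff_integrableOn_Icc_of_le hr.1]
    exact hint.mono_set (Icc_subset_Ico_right hr.2)

theorem eq_of_radial_cluster {f : ℂ → ℂ} {p : ℂ} {a b : ℝ}
    (hf : DifferentiableOn ℂ f (Metric.ball 0 1)) (hinj : InjOn f (Metric.ball 0 1))
    (hb : Bornology.IsBounded (f '' Metric.ball 0 1)) (hab : a < b)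
    (h : ∀ ξ ∈ Ioo a b, ∀ ε > 0, ∃ r ∈ Ioo (1 - ε) 1,
      ‖f ((r : ℝ) * Complex.exp (ξ * Complex.I)) - p‖ < ε) : f 0 = p := by
  obtain ⟨N, hN⟩ := exists_nat_gt (2 * Real.pi / (b - a))
  have hN0 : (0 : ℝ) < N := lt_of_le_of_lt (div_nonneg Real.two_pi_pos.le (by linarith)) hN
  have hNn : 0 < N := by exact_mod_cast hN0
  rw [div_lt_iff₀ (by linarith)] at hN
  set η : ℝ := 2 * Real.pi / N with hη
  have hη0 : 0 < η := div_pos Real.two_pi_pos hN0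
  have hηab : η < b - a := by rw [hη, div_lt_iff₀ hN0]; linarith
  let ω : ℕ → ℂ := fun j => Complex.exp ((j * η : ℝ) * Complex.I)
  have hω : ∀ j, ‖ω j‖ = 1 := fun j => Complex.norm_exp_ofReal_mul_I _
  have hmaps : ∀ j, MapsTo (fun w => w * ω j) (Metric.ball 0 1) (Metric.ball 0 1) := by
    intro j w hw
    rw [mem_ball_zero_iff] at hw ⊢
    rwa [norm_mul, hω, mul_one]
  let H : ℂ → ℂ := fun w => ∏ j ∈ Finset.range N, (f (w * ω j) - p)
  have hHd : DifferentiableOn ℂ H (Metric.ball 0 1) :=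
    DifferentiableOn.fun_finsetProd fun j _ =>
      (hf.comp (by fun_prop) (hmaps j)).sub_const p
  have hlim : ∀ᵐ φ : ℝ, φ ∈ Ioo (-Real.pi) Real.pi →
      Filter.Tendsto (fun r : ℝ => H (r * Complex.exp (φ * Complex.I))) (𝓝[<] 1) (𝓝 0) := by
    have hall := MeasureTheory.ae_all_iff.2 fun j => ae_exists_radial_limit
      (f := fun w => f (w * ω j)) (hf.comp (by fun_prop) (hmaps j))
      (fun x hx y hy hxy => mul_right_cancel₀ (by rw [← norm_ne_zero_iff, hω]; exact one_ne_zero)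
        (hinj (hmaps j hx) (hmaps j hy) hxy))
      (hb.subset (by rintro _ ⟨x, hx, rfl⟩; exact ⟨_, hmaps j hx, rfl⟩))
    filter_upwards [hall] with φ hφ hφπ
    choose l hl using fun j => hφ j hφπ
    obtain ⟨n, hn, -⟩ := existsUnique_add_zsmul_mem_Ioc hη0 φ a
    set j := (n % N).toNat with hj
    have hjN : j ∈ Finset.range N := by
      rw [Finset.mem_range]
      have := Int.emod_lt_of_pos n (Int.natCast_pos.2 hNn)
      have := Int.emod_nonneg n (Int.natCast_pos.2 hNn).ne'
      omega
    have hjn : Complex.exp (φ * Complex.I) * ω j =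
        Complex.exp ((φ + n • η : ℝ) * Complex.I) := by
      have h1 : (n : ℤ) = j + N * (n / N) := by
        have h2 := Int.emod_add_mul_ediv n N
        have := Int.emod_nonneg n (Int.natCast_pos.2 hNn).ne'
        rw [hj, Int.toNat_of_nonneg this, h2]
      have h3 : (n : ℝ) * η = j * η + (n / N : ℤ) * (2 * Real.pi) := by
        have : (n : ℝ) = j + N * (n / N : ℤ) := by exact_mod_cast h1
        rw [this, hη]
        field_simp
      simp only [ω]
      rw [zsmul_eq_mul, h3, ← Complex.exp_add, Complex.exp_eq_exp_iff_exists_int]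
      refine ⟨-(n / N), ?_⟩
      push_cast
      ring
    have hlj : l j = p := by
      refine eq_of_forall_dist_le fun ε hε => ?_
      obtain ⟨l₀, hl₀, hsub⟩ := mem_nhdsLT_iff_exists_Ioo_subset.1
        ((hl j).eventually (Metric.ball_mem_nhds _ (half_pos hε)))
      obtain ⟨r, hr, hrp⟩ := h (φ + n • η) ⟨hn.1, hn.2.trans_lt (by linarith)⟩
        (min (ε / 2) (1 - l₀)) (lt_min (half_pos hε) (sub_pos.2 hl₀))
      have h1 := hsub (show r ∈ Ioo l₀ 1 from
        ⟨by linarith [hr.1, min_le_right (ε / 2) (1 - l₀)], hr.2⟩)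
      have h2 := hrp.trans_le (min_le_left _ _)
      rw [← hjn, ← mul_assoc, ← dist_eq_norm] at h2
      have h3 := dist_triangle_left (l j) p (f (r * Complex.exp (φ * Complex.I) * ω j))
      rw [mem_ofPred_eq] at h1
      linarith
    have := tendsto_finsetProd (Finset.range N) fun j _ => (hl j).sub_const p
    rwa [Finset.prod_eq_zero hjN (by rw [hlj, sub_self])] at this
  obtain ⟨R, hR⟩ := hb.exists_norm_le
  have hbd : ∀ w ∈ Metric.ball (0 : ℂ) 1, ‖H w‖ ≤ (R + ‖p‖) ^ N := fun w hw => by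
    simp only [H, norm_prod]
    refine (Finset.prod_le_prod (fun j _ => norm_nonneg _) (g := fun _ => R + ‖p‖)
      fun j _ => ?_).trans (by simp)
    exact (norm_sub_le _ _).trans (by gcongr; exact hR _ ⟨_, hmaps j hw, rfl⟩)
  have hmem : ∀ r ∈ Ioo (0 : ℝ) 1, ∀ θ : ℝ,
      (r * Complex.exp (θ * Complex.I) : ℂ) ∈ Metric.ball (0 : ℂ) 1 := fun r hr θ => by
    rw [mem_ball_zero_iff, norm_mul, Complex.norm_exp_ofReal_mul_I, mul_one, Complex.norm_real,
      Real.norm_eq_abs, abs_of_pos hr.1]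
    exact hr.2
  have hmean : ∀ r ∈ Ioo (0 : ℝ) 1, H 0 =
      (2 * Real.pi)⁻¹ • ∫ θ in (-Real.pi)..Real.pi, H (r * Complex.exp (θ * Complex.I)) := by
    intro r hr
    have h1 : Real.circleAverage H 0 r = H 0 := by
      refine DiffContOnCl.circleAverage (hHd.diffContOnCl_ball (U := Metric.ball 0 1)
        (Metric.closedBall_subset_ball ?_))
      rw [abs_of_pos hr.1]
      exact hr.2
    have hper : (fun θ => H (circleMap 0 r θ)).Periodic (2 * Real.pi) :=
      fun x => by simp [periodic_circleMap 0 r x]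
    have := hper.intervalIntegral_add_eq 0 (-Real.pi)
    rw [show -Real.pi + 2 * Real.pi = Real.pi by ring, zero_add] at this
    rw [← h1, Real.circleAverage, this]
    simp [circleMap]
  have htend : Filter.Tendsto (fun r : ℝ => ∫ θ in (-Real.pi)..Real.pi,
      H (r * Complex.exp (θ * Complex.I))) (𝓝[<] 1)
      (𝓝 (∫ _ in (-Real.pi)..Real.pi, (0 : ℂ))) := by
    have hev : ∀ᶠ r : ℝ in 𝓝[<] 1, r ∈ Ioo (0 : ℝ) 1 := Ioo_mem_nhdsLT one_pos
    refine intervalIntegral.tendsto_integral_filter_of_dominated_convergence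
      (fun _ => (R + ‖p‖) ^ N) ?_ ?_ intervalIntegrable_const ?_
    · filter_upwards [hev] with r hr
      exact (hHd.continuousOn.comp_continuous (by fun_prop) (hmem r hr)).aestronglyMeasurable
    · filter_upwards [hev] with r hr
      exact Filter.Eventually.of_forall fun θ _ => hbd _ (hmem r hr θ)
    · have hne : ∀ᵐ θ : ℝ, θ ≠ Real.pi := MeasureTheory.Measure.ae_ne _ _
      filter_upwards [hlim, hne] with θ hθ hθ' hm
      rw [uIoc_of_le (by linarith [Real.pi_pos])] at hm
      exact hθ ⟨hm.1, lt_of_le_of_ne hm.2 hθ'⟩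
  have h0 : H 0 = 0 := by
    have h1 : Filter.Tendsto (fun _ : ℝ => H 0) (𝓝[<] 1) (𝓝 0) := by
      have := htend.const_smul (2 * Real.pi)⁻¹
      rw [intervalIntegral.integral_zero, smul_zero] at this
      refine this.congr' ?_
      filter_upwards [Ioo_mem_nhdsLT (zero_lt_one (α := ℝ))] with r hr using (hmean r hr).symm
    exact tendsto_nhds_unique tendsto_const_nhds h1
  simp only [H, zero_mul, Finset.prod_const, Finset.card_range] at h0
  exact sub_eq_zero.1 (pow_eq_zero_iff hNn.ne' |>.1 h0)

theorem eq_of_connected_cluster {f : ℂ → ℂ} {p ζ ζ' : ℂ}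
    (hf : DifferentiableOn ℂ f (Metric.ball 0 1)) (hinj : InjOn f (Metric.ball 0 1))
    (hb : Bornology.IsBounded (f '' Metric.ball 0 1)) (hζ : ‖ζ‖ = 1) (hζ' : ‖ζ'‖ = 1)
    (hne : ζ ≠ ζ')
    (h : ∀ ε > 0, ∃ Γ : Set ℂ, IsPreconnected Γ ∧
      (∀ w ∈ Γ, 1 - ε < ‖w‖ ∧ ‖w‖ < 1 ∧ ‖f w - p‖ < ε) ∧
      (∃ w ∈ Γ, ‖w - ζ‖ < ε) ∧ ∃ w ∈ Γ, ‖w - ζ'‖ < ε) : f 0 = p := by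
  by_contra hp
  have hray : ∀ m : ℂ, ‖m‖ = 1 → ∀ a b : ℝ, a < b → ∃ ξ ∈ Ioo a b, ∃ ε > 0,
      ∀ r ∈ Ioo (1 - ε) 1, ε ≤ ‖f (m * ((r : ℝ) * Complex.exp (ξ * Complex.I))) - p‖ := by
    intro m hm a b hab
    by_contra! hcon
    have hmaps : MapsTo (fun w => m * w) (Metric.ball 0 1) (Metric.ball 0 1) := by
      intro w hw
      rw [mem_ball_zero_iff] at hw ⊢
      rwa [norm_mul, hm, one_mul]
    refine hp ?_
    simpa using eq_of_radial_cluster (f := fun w => f (m * w)) (hf.comp (by fun_prop) hmaps)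
      (fun x hx y hy hxy => mul_left_cancel₀ (by rw [← norm_ne_zero_iff, hm]; exact one_ne_zero)
        (hinj (hmaps hx) (hmaps hy) hxy))
      (hb.subset (by rintro _ ⟨x, hx, rfl⟩; exact ⟨_, hmaps hx, rfl⟩)) hab hcon
  have hζ0 : ζ ≠ 0 := by rw [← norm_ne_zero_iff, hζ]; exact one_ne_zero
  obtain ⟨τ, hτ, hζτ⟩ : ∃ τ ∈ Ioo 0 (2 * Real.pi), ζ' = ζ * Complex.exp (τ * Complex.I) := by
    have h1 : ζ' = ζ * Complex.exp ((ζ' / ζ).arg * Complex.I) := by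
      have := Complex.norm_mul_exp_arg_mul_I (ζ' / ζ)
      rw [norm_div, hζ, hζ', div_one, Complex.ofReal_one, one_mul] at this
      rw [this, mul_div_cancel₀ _ hζ0]
    have h2 : (ζ' / ζ).arg ≠ 0 := fun h0 => hne (by rw [h1, h0]; simp)
    have h3 := Complex.neg_pi_lt_arg (ζ' / ζ)
    have h4 := Complex.arg_le_pi (ζ' / ζ)
    have := Real.pi_pos
    rcases h2.lt_or_gt with h5 | h5
    · refine ⟨(ζ' / ζ).arg + 2 * Real.pi, ⟨by linarith, by linarith⟩, ?_⟩
      rw [Complex.ofReal_add, add_mul]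
      push_cast
      rwa [Complex.exp_add, Complex.exp_two_pi_mul_I, mul_one]
    · exact ⟨(ζ' / ζ).arg, ⟨h5, by linarith⟩, h1⟩
  obtain ⟨α, rfl⟩ : ∃ α, τ = 2 * α := ⟨τ / 2, by ring⟩
  have hα : 0 < α ∧ α < Real.pi := ⟨by linarith [hτ.1], by linarith [hτ.2]⟩
  set m := ζ * Complex.exp (α * Complex.I) with hm
  have hm1 : ‖m‖ = 1 := by rw [hm, norm_mul, hζ, Complex.norm_exp_ofReal_mul_I, one_mul]
  obtain ⟨β, hβ, ε₀, hε₀, h₀⟩ := hray m hm1 (-α) α (by linarith)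
  obtain ⟨γ, hγ, ε₁, hε₁, h₁⟩ := hray (-m) (by rw [norm_neg, hm1])
    (-(Real.pi - α)) (Real.pi - α) (by linarith)
  set c := m * Complex.exp (γ * Complex.I) with hc
  have hc1 : ‖c‖ = 1 := by rw [hc, norm_mul, hm1, Complex.norm_exp_ofReal_mul_I, one_mul]
  have hc0 : c ≠ 0 := by rw [← norm_ne_zero_iff, hc1]; exact one_ne_zero
  have hargexp : ∀ t ∈ Ioo (-Real.pi) Real.pi, (Complex.exp (t * Complex.I)).arg = t ∧
      Complex.exp (t * Complex.I) ∈ Complex.slitPlane := fun t ht => by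
    have : (Complex.exp (t * Complex.I)).arg = t := by
      rw [Complex.exp_mul_I, Complex.arg_cos_add_sin_mul_I ⟨ht.1, ht.2.le⟩]
    exact ⟨this, Complex.mem_slitPlane_iff_arg.2 ⟨by rw [this]; exact ht.2.ne,
      Complex.exp_ne_zero _⟩⟩
  have hζc : ζ / c = Complex.exp ((-α - γ : ℝ) * Complex.I) := by
    rw [div_eq_iff hc0, hc, hm, show -α - γ = -(α + γ) by ring, Complex.ofReal_neg, neg_mul,
      Complex.exp_neg, Complex.ofReal_add, add_mul, Complex.exp_add]
    field_simp [Complex.exp_ne_zero]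
  have hζ'c : ζ' / c = Complex.exp ((α - γ : ℝ) * Complex.I) := by
    rw [div_eq_iff hc0, hc, hm, hζτ, show 2 * α = α + ((α - γ) + γ) by ring, Complex.ofReal_add α,
      add_mul, Complex.exp_add, Complex.ofReal_add _ γ, add_mul, Complex.exp_add]
    ring
  have hnear : ∀ z t, z / c = Complex.exp ((t : ℝ) * Complex.I) → t ∈ Ioo (-Real.pi) Real.pi →
      ∀ δ > 0, ∃ ε > 0, ∀ w, ‖w - z‖ < ε → |(w / c).arg - t| < δ := by
    intro z t hz ht δ hδ
    have hcont : ContinuousAt (fun w => (w / c).arg) z :=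
      (Complex.continuousAt_arg (by rw [hz]; exact (hargexp t ht).2)).comp
        (continuousAt_id.div_const c)
    obtain ⟨ε, hε, hε'⟩ := Metric.continuousAt_iff.1 hcont δ hδ
    refine ⟨ε, hε, fun w hw => ?_⟩
    have := hε' (by rwa [dist_eq_norm])
    rwa [hz, (hargexp t ht).1, Real.dist_eq] at this
  obtain ⟨δ, hδ, hδζ⟩ := hnear ζ _ hζc ⟨by linarith [hγ.2], by linarith [hγ.1]⟩ (β + α)
    (by linarith [hβ.1])
  obtain ⟨δ', hδ', hδζ'⟩ := hnear ζ' _ hζ'c ⟨by linarith [hγ.2], by linarith [hγ.1]⟩ (α - β)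
    (by linarith [hβ.2])
  obtain ⟨ε, hε, hle⟩ : ∃ ε > 0, ε ≤ ε₀ ∧ ε ≤ ε₁ ∧ ε ≤ δ ∧ ε ≤ δ' ∧ ε ≤ 1 :=
    ⟨min ε₀ (min ε₁ (min δ (min δ' 1))), by positivity, by simp⟩
  obtain ⟨Γ, hΓ, hΓf, ⟨w, hw, hwζ⟩, w', hw', hwζ'⟩ := h ε hε
  have hpolar : ∀ z, z = m * (‖z‖ * Complex.exp (((z / c).arg + γ : ℝ) * Complex.I)) := fun z => by
    have := Complex.norm_mul_exp_arg_mul_I (z / c)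
    rw [norm_div, hc1, div_one, eq_div_iff hc0, hc] at this
    rw [Complex.ofReal_add, add_mul, Complex.exp_add]
    linear_combination -this
  have hslit : ∀ z ∈ Γ, z / c ∈ Complex.slitPlane := fun z hz => by
    obtain ⟨hz1, hz2, hz3⟩ := hΓf z hz
    have hz0 : z ≠ 0 := norm_pos_iff.1 (by linarith [hle.2.2.2.2])
    refine Complex.mem_slitPlane_iff_arg.2 ⟨fun harg => ?_, div_ne_zero hz0 hc0⟩
    have h2 := hpolar z
    rw [harg, Complex.ofReal_add, add_mul, Complex.exp_add, Complex.exp_pi_mul_I] at h2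
    have h3 := h₁ ‖z‖ ⟨by linarith [hle.2.1], hz2⟩
    rw [show -m * ((‖z‖ : ℝ) * Complex.exp (γ * Complex.I)) = z by
      rw [h2.trans (by ring : _ = -m * (‖z‖ * Complex.exp (γ * Complex.I)))]; simp [hm1, Complex.norm_exp_ofReal_mul_I]] at h3
    linarith [hle.2.1]
  have hcont : ContinuousOn (fun z => (z / c).arg) Γ := fun z hz =>
    (ContinuousAt.comp (f := fun w => w / c) (Complex.continuousAt_arg (hslit z hz))
      (continuousAt_id.div_const c)).continuousWithinAt
  have h1 := abs_lt.1 (hδζ w (by linarith [hle.2.2.1]))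
  have h2 := abs_lt.1 (hδζ' w' (by linarith [hle.2.2.2.1]))
  obtain ⟨z, hz, hzβ⟩ := hΓ.intermediate_value hw hw' hcont
    (show β - γ ∈ Icc _ _ from ⟨by linarith, by linarith⟩)
  obtain ⟨hz1, hz2, hz3⟩ := hΓf z hz
  have h3 := h₀ ‖z‖ ⟨by linarith [hle.1], hz2⟩
  have h4 := hpolar z
  rw [show (z / c).arg = β - γ from hzβ, sub_add_cancel] at h4
  rw [← h4] at h3
  linarith [hle.1]

theorem not_forall_le_norm_sub_of_norm_sub_eq {f : ℂ → ℂ} {ζ : ℂ} {ρ₀ d : ℝ}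
    (hf : DifferentiableOn ℂ f (Metric.ball 0 1)) (hinj : InjOn f (Metric.ball 0 1))
    (hb : Bornology.IsBounded (f '' Metric.ball 0 1)) (hζ : ‖ζ‖ = 1) (hρ₀ : 0 < ρ₀) (hd : 0 < d)
    (h : ∀ ρ ∈ Ioo 0 ρ₀, ∃ w₁ w₂, ‖w₁‖ < 1 ∧ ‖w₂‖ < 1 ∧ ‖w₁ - ζ‖ = ρ ∧ ‖w₂ - ζ‖ = ρ ∧
      d ≤ ‖f w₁ - f w₂‖) : False := by
  have hπ := Real.pi_pos
  have hζ0 : ζ ≠ 0 := by rw [← norm_ne_zero_iff, hζ]; exact one_ne_zero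
  have hU : IsOpen (Metric.ball (1 : ℂ) 1) := Metric.isOpen_ball
  let F : ℂ → ℂ := fun u => f (ζ * (1 - u))
  have hmaps : MapsTo (fun u => ζ * (1 - u)) (Metric.ball 1 1) (Metric.ball 0 1) := by
    intro u hu
    rw [mem_ball_iff_norm'] at hu
    rw [mem_ball_zero_iff]
    rwa [norm_mul, hζ, one_mul]
  have hFd : DifferentiableOn ℂ F (Metric.ball 1 1) := hf.comp (by fun_prop) hmaps
  have hE := lintegral_norm_deriv_sq_lt_top hU hFd
    (fun x hx y hy hxy => sub_right_injective (mul_left_cancel₀ hζ0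
      (hinj (hmaps hx) (hmaps hy) hxy)))
    (hb.subset (by rintro _ ⟨x, hx, rfl⟩; exact ⟨_, hmaps hx, rfl⟩))
  have hQ : Measurable ((Metric.ball (1 : ℂ) 1).indicator
      fun w => ENNReal.ofReal (‖deriv F w‖ ^ 2)) :=
    ((measurable_deriv F).norm.pow_const 2).ennreal_ofReal.indicator hU.measurableSet
  rw [← MeasureTheory.lintegral_indicator hU.measurableSet,
    (lintegral_eq_lintegral_polar hQ).1] at hE
  have hmemiff : ∀ r : ℝ, 0 < r → ∀ φ : ℝ,
      (r * Complex.exp (φ * Complex.I) : ℂ) ∈ Metric.ball (1 : ℂ) 1 ↔ r < 2 * Real.cos φ := by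
    intro r hr φ
    rw [mem_ball_iff_norm, ← sq_lt_one_iff₀ (norm_nonneg _), Complex.exp_mul_I, ← Complex.ofReal_cos,
      ← Complex.ofReal_sin, ← Complex.normSq_eq_norm_sq, Complex.normSq_apply]
    have := Real.sin_sq_add_cos_sq φ
    generalize Real.sin φ = y, Real.cos φ = x at this
    have hexp : (r * x - 1) * (r * x - 1) + r * y * (r * y) = 1 + r * (r - 2 * x) := by
      linear_combination r ^ 2 * this
    simp only [Complex.sub_re, Complex.sub_im, Complex.mul_re, Complex.mul_im, Complex.add_re,
      Complex.add_im, Complex.ofReal_re, Complex.ofReal_im, Complex.I_re, Complex.I_im,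
      Complex.one_re, Complex.one_im, mul_zero, mul_one, zero_mul, sub_zero, add_zero, zero_add]
    rw [hexp, add_lt_iff_neg_left, mul_neg_iff]
    constructor
    · rintro (h | h) <;> linarith
    · exact fun h => Or.inl ⟨hr, by linarith⟩
  have hkey : ∀ r ∈ Ioo 0 ρ₀, ENNReal.ofReal (d ^ 2 / (2 * Real.pi) * r⁻¹) ≤
      ∫⁻ φ in Ioo (-Real.pi) Real.pi, ENNReal.ofReal r * (Metric.ball (1 : ℂ) 1).indicator
        (fun w => ENNReal.ofReal (‖deriv F w‖ ^ 2)) (r * Complex.exp (φ * Complex.I)) := by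
    intro r hr
    have hr0 := hr.1
    obtain ⟨φ₁, φ₂, hle, h1, h2, hc1, hc2, hdF⟩ : ∃ φ₁ φ₂ : ℝ, φ₁ ≤ φ₂ ∧ -Real.pi < φ₁ ∧ φ₂ < Real.pi ∧
        r < 2 * Real.cos φ₁ ∧ r < 2 * Real.cos φ₂ ∧ d ≤ ‖F (r * Complex.exp (φ₂ * Complex.I)) -
          F (r * Complex.exp (φ₁ * Complex.I))‖ := by
      have hang : ∀ w, ‖w‖ < 1 → ‖w - ζ‖ = r → ∃ φ : ℝ, -Real.pi < φ ∧ φ < Real.pi ∧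
          r < 2 * Real.cos φ ∧ F (r * Complex.exp (φ * Complex.I)) = f w := by
        intro w hw hwr
        have hn : ‖1 - w / ζ‖ = r := by
          rw [← hwr, norm_sub_rev w, ← mul_one ‖1 - w / ζ‖, ← hζ, ← norm_mul, sub_mul, one_mul,
            div_mul_cancel₀ _ hζ0]
        have hp := Complex.norm_mul_exp_arg_mul_I (1 - w / ζ)
        rw [hn] at hp
        have hc : r < 2 * Real.cos (1 - w / ζ).arg := by
          rw [← hmemiff r hr0, hp, mem_ball_iff_norm]
          simpa [hζ] using hw
        refine ⟨_, Complex.neg_pi_lt_arg _, lt_of_le_of_ne (Complex.arg_le_pi _) fun he => ?_, hc, ?_⟩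
        · rw [he, Real.cos_pi] at hc
          linarith
        · simp only [F]
          rw [hp, sub_sub_cancel, mul_div_cancel₀ _ hζ0]
      obtain ⟨w₁, w₂, hw₁, hw₂, hr₁, hr₂, hd'⟩ := h r hr
      obtain ⟨φ₁, ha1, hb1, hc1, he1⟩ := hang w₁ hw₁ hr₁
      obtain ⟨φ₂, ha2, hb2, hc2, he2⟩ := hang w₂ hw₂ hr₂
      rcases le_total φ₁ φ₂ with hl | hl
      · exact ⟨φ₁, φ₂, hl, ha1, hb2, hc1, hc2, by rwa [he1, he2, norm_sub_rev]⟩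
      · exact ⟨φ₂, φ₁, hl, ha2, hb1, hc2, hc1, by rwa [he1, he2]⟩
    have hmem : ∀ φ ∈ Icc φ₁ φ₂, (r * Complex.exp (φ * Complex.I) : ℂ) ∈ Metric.ball (1 : ℂ) 1 := by
      intro φ hφ
      rw [hmemiff r hr0]
      rcases le_max_iff.1 (abs_le_max_abs_abs hφ.1 hφ.2) with h3 | h3
      · have := Real.cos_le_cos_of_nonneg_of_le_pi (abs_nonneg φ)
          (abs_le.2 ⟨h1.le, by linarith⟩) h3
        rw [Real.cos_abs, Real.cos_abs] at this
        linarith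
      · have := Real.cos_le_cos_of_nonneg_of_le_pi (abs_nonneg φ)
          (abs_le.2 ⟨by linarith, h2.le⟩) h3
        rw [Real.cos_abs, Real.cos_abs] at this
        linarith
    have hcd : ContinuousOn (fun φ : ℝ => deriv F (r * Complex.exp (φ * Complex.I))) (Icc φ₁ φ₂) :=
      (hFd.deriv hU).continuousOn.comp (by fun_prop) hmem
    have hder : ∀ φ ∈ uIcc φ₁ φ₂, HasDerivAt (fun φ : ℝ => F (r * Complex.exp (φ * Complex.I)))
        (deriv F (r * Complex.exp (φ * Complex.I)) *
          (r * (Complex.exp (φ * Complex.I) * Complex.I))) φ := by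
      intro φ hφ
      rw [uIcc_of_le hle] at hφ
      have e1 := (hFd.differentiableAt (hU.mem_nhds (hmem φ hφ))).hasDerivAt
      have e2 : HasDerivAt (fun φ : ℝ => (r * Complex.exp (φ * Complex.I) : ℂ))
          (r * (Complex.exp (φ * Complex.I) * Complex.I)) φ := by
        have : HasDerivAt (fun φ : ℝ => (φ * Complex.I : ℂ)) Complex.I φ := by
          simpa using (Complex.ofRealCLM.hasDerivAt (x := φ)).mul_const Complex.I
        exact this.cexp.const_mul _
      exact HasDerivAt.comp (h₂ := F) φ e1 e2
    have hmain : d ≤ ∫ φ in φ₁..φ₂, r * ‖deriv F (r * Complex.exp (φ * Complex.I))‖ := by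
      have hi := intervalIntegral.integral_eq_sub_of_hasDerivAt hder
        (ContinuousOn.intervalIntegrable (by
          rw [uIcc_of_le hle]; exact hcd.mul (by fun_prop)))
      rw [← hi] at hdF
      refine hdF.trans ((intervalIntegral.norm_integral_le_integral_norm hle).trans_eq ?_)
      refine intervalIntegral.integral_congr fun φ _ => ?_
      simp [Complex.norm_exp_ofReal_mul_I, abs_of_pos hr0]
      ring
    have hcn : ContinuousOn (fun φ : ℝ => r * ‖deriv F (r * Complex.exp (φ * Complex.I))‖ ^ 2)
        (Icc φ₁ φ₂) := continuousOn_const.mul (hcd.norm.pow 2)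
    have hci : IntervalIntegrable (fun φ : ℝ => r * ‖deriv F (r * Complex.exp (φ * Complex.I))‖ ^ 2)
        MeasureTheory.volume φ₁ φ₂ := ContinuousOn.intervalIntegrable (by rwa [uIcc_of_le hle])
    have hsq : d ^ 2 / (2 * Real.pi) * r⁻¹ ≤
        ∫ φ in φ₁..φ₂, r * ‖deriv F (r * Complex.exp (φ * Complex.I))‖ ^ 2 := by
      have h3 : ∫ φ in φ₁..φ₂, r * ‖deriv F (r * Complex.exp (φ * Complex.I))‖ ≤
          ∫ φ in φ₁..φ₂, (r * Real.pi / d * (r * ‖deriv F (r * Complex.exp (φ * Complex.I))‖ ^ 2) +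
            d / (4 * Real.pi)) := by
        refine intervalIntegral.integral_mono_on hle
          (ContinuousOn.intervalIntegrable (by rw [uIcc_of_le hle]; exact continuousOn_const.mul hcd.norm))
          ((hci.const_mul _).add intervalIntegrable_const) fun φ hφ => ?_
        set x := ‖deriv F (r * Complex.exp (φ * Complex.I))‖
        have : r * Real.pi / d * (r * x ^ 2) + d / (4 * Real.pi) - r * x =
            (2 * Real.pi * (r * x) - d) ^ 2 / (4 * Real.pi * d) := by
          field_simp
          ring
        have : 0 ≤ (2 * Real.pi * (r * x) - d) ^ 2 / (4 * Real.pi * d) := by positivity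
        linarith
      rw [intervalIntegral.integral_add (hci.const_mul _) intervalIntegrable_const,
        intervalIntegral.integral_const_mul (r * Real.pi / d), intervalIntegral.integral_const, smul_eq_mul] at h3
      set J := ∫ φ in φ₁..φ₂, r * ‖deriv F (r * Complex.exp (φ * Complex.I))‖ ^ 2
      have h4 : (φ₂ - φ₁) * (d / (4 * Real.pi)) ≤ 2 * Real.pi * (d / (4 * Real.pi)) :=
        mul_le_mul_of_nonneg_right (by linarith) (by positivity)
      have h5 : 2 * Real.pi * (d / (4 * Real.pi)) = d / 2 := by field_simp; norm_num
      have h6 : d / 2 ≤ r * Real.pi / d * J := by linarith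
      have h7 : d ^ 2 / (2 * Real.pi) * r⁻¹ = d / 2 * (d / (r * Real.pi)) := by field_simp
      have h8 : J = r * Real.pi / d * J * (d / (r * Real.pi)) := by field_simp
      rw [h7, h8]
      exact mul_le_mul_of_nonneg_right h6 (by positivity)
    refine (ENNReal.ofReal_le_ofReal hsq).trans ?_
    rw [intervalIntegral.integral_of_le hle, MeasureTheory.ofReal_integral_eq_lintegral_ofReal
      ((intervalIntegrable_iff_integrableOn_Ioc_of_le hle).1 hci)
      (Filter.Eventually.of_forall fun φ => by positivity)]
    refine le_trans (le_of_eq (MeasureTheory.setLIntegral_congr_fun measurableSet_Ioc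
      fun φ hφ => ?_)) (MeasureTheory.lintegral_mono_set (t := Ioo (-Real.pi) Real.pi)
        fun φ hφ => ⟨h1.trans hφ.1, hφ.2.trans_lt h2⟩)
    rw [indicator_of_mem (hmem φ ⟨hφ.1.le, hφ.2⟩), ENNReal.ofReal_mul hr0.le]
  have hlt : ∫⁻ r in Ioo 0 ρ₀, ENNReal.ofReal (d ^ 2 / (2 * Real.pi) * r⁻¹) < ⊤ :=
    ((MeasureTheory.setLIntegral_mono' measurableSet_Ioo hkey).trans
      (MeasureTheory.lintegral_mono_set fun r hr => hr.1)).trans_lt hE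
  have hint : MeasureTheory.IntegrableOn (fun r : ℝ => d ^ 2 / (2 * Real.pi) * r⁻¹) (Ioo 0 ρ₀) := by
    refine ⟨by fun_prop, ?_⟩
    rw [MeasureTheory.hasFiniteIntegral_iff_ofReal]
    · exact hlt
    · filter_upwards [MeasureTheory.ae_restrict_mem measurableSet_Ioo] with r hr
      have := hr.1
      simp only [Pi.zero_apply]
      positivity
  have hint' : MeasureTheory.IntegrableOn (fun r : ℝ => r⁻¹) (Ioo 0 ρ₀) := by
    refine (hint.const_mul (d ^ 2 / (2 * Real.pi))⁻¹).congr (Filter.Eventually.of_forall fun r => ?_)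
    exact inv_mul_cancel_left₀ (by positivity) _
  rw [← intervalIntegrable_iff_integrableOn_Ioo_of_le hρ₀.le, intervalIntegrable_inv_iff] at hint'
  simp [hρ₀.ne, hρ₀.le] at hint'

theorem exists_inverse_of_deriv_ne_zero {F : ℂ → ℂ} {U V : Set ℂ} (hU : IsOpen U) (hV : IsOpen V)
    (hF : DifferentiableOn ℂ F U) (hbij : BijOn F U V) (hder : ∀ z ∈ U, deriv F z ≠ 0) :
    ∃ f : ℂ → ℂ, MapsTo f V U ∧ (∀ w ∈ V, F (f w) = w) ∧ (∀ z ∈ U, f (F z) = z) ∧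
      ∀ w ∈ V, HasDerivAt f (deriv F (f w))⁻¹ w := by
  let f := Function.invFunOn F U
  have hmaps : MapsTo f V U := fun w hw => Function.invFunOn_mem (hbij.2.2 hw)
  have hFf : ∀ w ∈ V, F (f w) = w := fun w hw => Function.invFunOn_eq (hbij.2.2 hw)
  have hfF : ∀ z ∈ U, f (F z) = z := fun z hz =>
    hbij.2.1 (hmaps (hbij.1 hz)) hz (hFf _ (hbij.1 hz))
  refine ⟨f, hmaps, hFf, hfF, fun w hw => ?_⟩
  refine HasDerivAt.of_local_left_inverse ?_
    (hF.differentiableAt (hU.mem_nhds (hmaps hw))).hasDerivAt (hder _ (hmaps hw))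
    (Filter.eventually_of_mem (hV.mem_nhds hw) hFf)
  rw [continuousAt_def]
  intro A hA
  obtain ⟨B, hBA, hB, hwB⟩ := mem_nhds_iff.1 hA
  have hopen := isLocallyPlanar_complex.isOpen_image (hB.inter hU)
    (hF.continuousOn.mono inter_subset_right) (hbij.2.1.mono inter_subset_right)
  refine Filter.mem_of_superset (hopen.mem_nhds ⟨f w, ⟨hwB, hmaps hw⟩, hFf w hw⟩) ?_
  rintro _ ⟨z, hz, rfl⟩
  rw [mem_preimage, hfF z hz.2]
  exact hBA hz.1

namespace IsDefining

variable {g : Circle × ℝ → ℂ} {G : ℂ → ℝ}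

/-- Points of the core have arbitrarily small connected neighbourhoods in the inner side. -/
theorem exists_isPreconnected_mem_nhdsWithin (h : IsDefining g G) {p : ℂ} (hp : G p = 0) {A : Set ℂ}
    (hA : A ∈ 𝓝 p) : ∃ N ⊆ A, N ⊆ {z | G z < 0} ∧ IsPreconnected N ∧ N ∈ 𝓝[{z | G z < 0}] p := by
  obtain ⟨⟨c, t⟩, ⟨-, rfl⟩, rfl⟩ := h.eq_zero_iff.1 hp
  obtain ⟨a, rfl⟩ : ∃ a, Circle.exp a = c := ⟨_, Circle.exp_arg c⟩
  have hcont : Continuous fun q : ℝ × ℝ => g (Circle.exp q.1, q.2) :=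
    h.collar.1.comp (by fun_prop)
  have hA' : (fun q : ℝ × ℝ => g (Circle.exp q.1, q.2)) ⁻¹' A ∈ 𝓝 ((a, 0) : ℝ × ℝ) :=
    hcont.continuousAt hA
  obtain ⟨ε, hε, hεA⟩ := Metric.mem_nhds_iff.1 hA'
  obtain ⟨δ, hδ, hδε, hδ1⟩ : ∃ δ > 0, δ ≤ ε ∧ δ ≤ 1 := ⟨min ε 1, by positivity, by simp⟩
  have hsub : ∀ s t : ℝ, |s - a| < δ → |t| < δ → g (Circle.exp s, t) ∈ A := fun s t hs ht =>
    hεA (show ((s, t) : ℝ × ℝ) ∈ _ by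
      rw [Metric.mem_ball, Prod.dist_eq, Real.dist_eq, Real.dist_eq, sub_zero]
      exact max_lt (hs.trans_le hδε) (ht.trans_le hδε))
  refine ⟨(fun q : ℝ × ℝ => g (Circle.exp q.1, q.2)) '' (Ioo (a - δ) (a + δ) ×ˢ Ioo (-δ) 0),
    ?_, ?_, (isPreconnected_Ioo.prod isPreconnected_Ioo).image _ hcont.continuousOn, ?_⟩
  · rintro _ ⟨⟨s, t⟩, ⟨hs, ht⟩, rfl⟩
    exact hsub s t (abs_lt.2 ⟨by linarith [hs.1], by linarith [hs.2]⟩)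
      (abs_lt.2 ⟨ht.1, by linarith [ht.2]⟩)
  · rintro _ ⟨⟨s, t⟩, ⟨hs, ht⟩, rfl⟩
    rw [mem_ofPred_eq, h.fiber _ _ ⟨by linarith [ht.1], by linarith [ht.2]⟩]
    exact ht.2
  · have hopen : IsOpen (g '' ((Circle.exp '' Ioo (a - δ) (a + δ)) ×ˢ Ioo (-δ) δ)) :=
      isLocallyPlanar_complex.isOpen_image_cylinder
        ((isLocalHomeomorph_circleExp.isOpenMap _ isOpen_Ioo).prod isOpen_Ioo)
        h.collar.1.continuousOn (h.collar.2.mono (prod_mono (subset_univ _)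
          (Ioo_subset_Icc_self.trans (Icc_subset_Icc (by linarith) hδ1))))
    have hmem : g (Circle.exp a, 0) ∈ g '' ((Circle.exp '' Ioo (a - δ) (a + δ)) ×ˢ Ioo (-δ) δ) :=
      mem_image_of_mem g ⟨⟨a, ⟨by linarith, by linarith⟩, rfl⟩, by linarith, hδ⟩
    refine mem_nhdsWithin.2 ⟨_, hopen, hmem, ?_⟩
    rintro _ ⟨⟨⟨_, t⟩, ⟨⟨s, hs, rfl⟩, ht⟩, rfl⟩, hneg⟩
    rw [mem_ofPred_eq, h.fiber _ _ ⟨by linarith [ht.1], by linarith [ht.2]⟩] at hneg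
    exact ⟨(s, t), ⟨hs, ht.1, hneg⟩, rfl⟩

theorem nonpos_subset_closure_neg (h : IsDefining g G) : {z | G z ≤ 0} ⊆ closure {z | G z < 0} := by
  intro z hz
  rcases (show G z ≤ 0 from hz).lt_or_eq with h1 | h1
  · exact subset_closure h1
  · refine h.core_mem_closure (s := Ioo (-1) 0) ?_ ?_ h1
    · rintro _ ⟨⟨c, t⟩, ⟨-, ht⟩, rfl⟩
      rw [mem_ofPred_eq, h.fiber _ _ ⟨ht.1.le, by linarith [ht.2]⟩]
      exact ht.2
    · rw [closure_Ioo (by norm_num)]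
      norm_num

/-- Boundary behaviour of a Riemann map of the inner side. -/
theorem exists_tendsto_of_inverse (h : IsDefining g G) {F f : ℂ → ℂ}
    (hF : ContinuousOn F {z | G z < 0}) (hFm : MapsTo F {z | G z < 0} (Metric.ball 0 1))
    (hfm : MapsTo f (Metric.ball 0 1) {z | G z < 0}) (hf : DifferentiableOn ℂ f (Metric.ball 0 1))
    (hFf : ∀ w ∈ Metric.ball 0 1, F (f w) = w) (hfF : ∀ z ∈ {z | G z < 0}, f (F z) = z)
    {p : ℂ} (hp : G p = 0) : ∃ ζ, ‖ζ‖ = 1 ∧ Filter.Tendsto F (𝓝[{z | G z < 0}] p) (𝓝 ζ) := by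
  have hne : (𝓝[{z | G z < 0}] p).NeBot :=
    mem_closure_iff_nhdsWithin_neBot.1 (h.nonpos_subset_closure_neg hp.le)
  have hmem : ∀ᶠ z in 𝓝[{z | G z < 0}] p, F z ∈ Metric.ball (0 : ℂ) 1 :=
    Filter.mem_of_superset self_mem_nhdsWithin hFm
  have hnorm : ∀ ε > 0, ∀ᶠ z in 𝓝[{z | G z < 0}] p, 1 - ε < ‖F z‖ := by
    intro ε hε
    have hsub : Metric.closedBall (0 : ℂ) (1 - ε) ⊆ Metric.ball 0 1 :=
      Metric.closedBall_subset_ball (by linarith)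
    have hK : IsCompact (f '' Metric.closedBall 0 (1 - ε)) :=
      (isCompact_closedBall _ _).image_of_continuousOn (hf.continuousOn.mono hsub)
    have hpK : p ∉ f '' Metric.closedBall 0 (1 - ε) := by
      rintro ⟨w, hw, rfl⟩
      exact (hfm (hsub hw)).ne hp
    filter_upwards [self_mem_nhdsWithin, mem_nhdsWithin_of_mem_nhds
      (hK.isClosed.isOpen_compl.mem_nhds hpK)] with z hz hzK
    by_contra hle
    exact hzK ⟨F z, by simpa using hle, hfF z hz⟩
  have hcl : ∀ ζ, ClusterPt ζ (Filter.map F (𝓝[{z | G z < 0}] p)) → ∀ ε > 0,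
      ∃ᶠ z in 𝓝[{z | G z < 0}] p, ‖F z - ζ‖ < ε := fun ζ hζ ε hε => by
    simpa [dist_eq_norm] using mapClusterPt_iff_frequently.1 hζ _ (Metric.ball_mem_nhds ζ hε)
  have hcl1 : ∀ ζ, ClusterPt ζ (Filter.map F (𝓝[{z | G z < 0}] p)) → ‖ζ‖ = 1 := by
    intro ζ hζ
    refine eq_of_forall_dist_le fun ε hε => ?_
    obtain ⟨z, ⟨hz1, hz2⟩, hz3⟩ := (((hcl ζ hζ (ε / 2) (half_pos hε)).and_eventually
      (hnorm _ (half_pos hε))).and_eventually hmem).exists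
    rw [mem_ball_zero_iff] at hz3
    have := abs_le.1 (abs_norm_sub_norm_le (F z) ζ)
    rw [Real.dist_eq, abs_le]
    constructor <;> linarith
  have hfinj : InjOn f (Metric.ball 0 1) := fun x hx y hy hxy => by rw [← hFf x hx, hxy, hFf y hy]
  have huniq : ∀ ζ ζ', ClusterPt ζ (Filter.map F (𝓝[{z | G z < 0}] p)) →
      ClusterPt ζ' (Filter.map F (𝓝[{z | G z < 0}] p)) → ζ = ζ' := by
    intro ζ ζ' hζ hζ'
    by_contra hne
    refine (hfm (Metric.mem_ball_self one_pos)).ne (?_ : G (f 0) = 0)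
    rw [eq_of_connected_cluster (p := p) hf hfinj (h.bdd.subset ?_) (hcl1 ζ hζ) (hcl1 ζ' hζ') hne ?_]
    · exact hp
    · rintro _ ⟨w, hw, rfl⟩
      exact (show G (f w) < 0 from hfm hw).le
    intro ε hε
    obtain ⟨A, hA, hAsub⟩ := mem_nhdsWithin_iff_exists_mem_nhds_inter.1 (hnorm ε hε)
    obtain ⟨N, hNA, hN, hNc, hNn⟩ := h.exists_isPreconnected_mem_nhdsWithin hp
      (Filter.inter_mem hA (Metric.ball_mem_nhds p hε))
    refine ⟨F '' N, hNc.image _ (hF.mono hN), ?_, ?_, ?_⟩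
    · rintro _ ⟨z, hz, rfl⟩
      refine ⟨hAsub ⟨(hNA hz).1, hN hz⟩, by simpa using hFm (hN hz), ?_⟩
      rw [hfF z (hN hz)]
      exact mem_ball_iff_norm.1 (hNA hz).2
    · obtain ⟨z, hz, hzN⟩ := ((hcl ζ hζ ε hε).and_eventually hNn).exists
      exact ⟨_, ⟨z, hzN, rfl⟩, hz⟩
    · obtain ⟨z, hz, hzN⟩ := ((hcl ζ' hζ' ε hε).and_eventually hNn).exists
      exact ⟨_, ⟨z, hzN, rfl⟩, hz⟩
  have hball : Metric.closedBall (0 : ℂ) 1 ∈ Filter.map F (𝓝[{z | G z < 0}] p) :=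
    Filter.mem_of_superset hmem (preimage_mono Metric.ball_subset_closedBall)
  obtain ⟨ζ, -, hζ⟩ := (isCompact_closedBall (0 : ℂ) 1) (Filter.le_principal_iff.2 hball)
  exact ⟨ζ, hcl1 ζ hζ, (isCompact_closedBall (0 : ℂ) 1).le_nhds_of_unique_clusterPt hball
    fun x _ hx => huniq x ζ hx hζ⟩

theorem exists_closedBall_param (h : IsDefining g G) (h0 : G 0 < 0) :
    ∃ Φ : ℂ → ℂ, ContinuousOn Φ (Metric.closedBall 0 1) ∧ InjOn Φ (Metric.closedBall 0 1) ∧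
      Φ '' Metric.ball 0 1 = {z | G z < 0} ∧ Φ '' Metric.sphere 0 1 = {z | G z = 0} ∧ Φ 0 = 0 ∧
      ∃ c ≠ 0, HasStrictDerivAt Φ c 0 := by
  obtain ⟨F, hFd, hFb, hFder, hF0⟩ := exists_riemann_map h.isOpen_neg
    (h.bdd.subset fun z hz => (show G z < 0 from hz).le) h.isPreconnected_neg h0
    fun f hf hf0 => h.exists_sqrt hf hf0
  obtain ⟨f, hfm, hFf, hfF, hfder⟩ := exists_inverse_of_deriv_ne_zero h.isOpen_neg
    Metric.isOpen_ball hFd hFb hFder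
  have hfd : DifferentiableOn ℂ f (Metric.ball 0 1) := fun w hw =>
    (hfder w hw).differentiableAt.differentiableWithinAt
  have hfinj : InjOn f (Metric.ball 0 1) := fun x hx y hy hxy => by rw [← hFf x hx, hxy, hFf y hy]
  have hlim : ∀ p, G p = 0 → ∃ ζ, ‖ζ‖ = 1 ∧ Filter.Tendsto F (𝓝[{z | G z < 0}] p) (𝓝 ζ) :=
    fun p hp => h.exists_tendsto_of_inverse hFd.continuousOn hFb.1 hfm hfd hFf hfF hp
  set Fe := extendFrom {z | G z < 0} F
  have hFe : ∀ z, G z < 0 → Fe z = F z := fun z hz =>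
    extendFrom_eq (subset_closure hz) (hFd.continuousOn z hz)
  have hFe1 : ∀ z, G z = 0 → ‖Fe z‖ = 1 := fun z hz => by
    obtain ⟨ζ, hζ, hζ'⟩ := hlim z hz
    rw [← hζ]
    exact congrArg _ (extendFrom_eq (h.nonpos_subset_closure_neg hz.le) hζ')
  have hFelt : ∀ z, G z < 0 → ‖Fe z‖ < 1 := fun z hz => by
    rw [hFe z hz]
    simpa using hFb.1 hz
  have hFec : ContinuousOn Fe {z | G z ≤ 0} := by
    refine continuousOn_extendFrom h.nonpos_subset_closure_neg fun z hz => ?_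
    rcases (show G z ≤ 0 from hz).lt_or_eq with h1 | h1
    · exact ⟨_, hFd.continuousOn z h1⟩
    · obtain ⟨ζ, -, hζ⟩ := hlim z h1
      exact ⟨ζ, hζ⟩
  have hcross : ∀ p, G p = 0 → ∀ η > 0, ∃ ρ₁ > 0, ∀ ρ ∈ Ioo 0 ρ₁,
      ∃ z, G z < 0 ∧ ‖z - p‖ < η ∧ ‖F z - Fe p‖ = ρ := by
    intro p hp η hη
    obtain ⟨⟨c, t⟩, ⟨-, rfl⟩, rfl⟩ := h.eq_zero_iff.1 hp
    have hcont : Continuous fun t : ℝ => g (c, -t) := h.collar.1.comp (by fun_prop)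
    have hnear : ∀ᶠ t : ℝ in 𝓝 0, ‖g (c, -t) - g (c, 0)‖ < η := by
      have : Filter.Tendsto (fun t : ℝ => ‖g (c, -t) - g (c, 0)‖) (𝓝 0) (𝓝 0) := by
        simpa using ((hcont.sub continuous_const).norm.tendsto (x := (0 : ℝ)) (f := fun t : ℝ =>
          ‖g (c, -t) - g (c, 0)‖))
      exact this.eventually_lt_const hη
    obtain ⟨ε, hε, hε'⟩ := Metric.eventually_nhds_iff.1 hnear
    obtain ⟨t₀, ht₀, ht₀ε, ht₀1⟩ : ∃ t₀ > 0, t₀ < ε ∧ t₀ ≤ 1 :=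
      ⟨min (ε / 2) 1, by positivity, (min_le_left _ _).trans_lt (by linarith), min_le_right _ _⟩
    have hG : ∀ t ∈ Icc 0 t₀, G (g (c, -t)) = -t := fun t ht =>
      h.fiber _ _ ⟨by linarith [ht.2], by linarith [ht.1]⟩
    have hψ : ContinuousOn (fun t => ‖Fe (g (c, -t)) - Fe (g (c, 0))‖) (Icc 0 t₀) :=
      ((hFec.comp hcont.continuousOn fun t ht => by
        rw [mem_ofPred_eq, hG t ht]; linarith [ht.1]).sub continuousOn_const).norm
    refine ⟨‖Fe (g (c, -t₀)) - Fe (g (c, 0))‖, ?_, fun ρ hρ => ?_⟩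
    · rw [gt_iff_lt, norm_pos_iff, sub_ne_zero]
      intro he
      have h1 := hFelt (g (c, -t₀)) (by rw [hG t₀ ⟨ht₀.le, le_rfl⟩]; linarith)
      rw [he, hFe1 _ hp] at h1
      exact h1.false
    · obtain ⟨t, ht, hρt⟩ := intermediate_value_Icc ht₀.le hψ
        (show ρ ∈ Icc _ _ from ⟨by simpa using hρ.1.le, hρ.2.le⟩)
      have ht0 : 0 < t := lt_of_le_of_ne ht.1 fun he => by
        have := hρ.1
        simp [← hρt, ← he] at this
      have hneg : G (g (c, -t)) < 0 := by rw [hG t ht]; linarith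
      refine ⟨g (c, -t), hneg, hε' ?_, ?_⟩
      · rw [Real.dist_eq, sub_zero, abs_of_pos ht0]
        exact ht.2.trans_lt ht₀ε
      · rw [← hFe _ hneg]
        exact hρt
  have hFei : InjOn Fe {z | G z ≤ 0} := by
    intro p hp q hq hpq
    rcases (show G p ≤ 0 from hp).lt_or_eq with hp1 | hp1 <;>
      rcases (show G q ≤ 0 from hq).lt_or_eq with hq1 | hq1
    · rw [hFe p hp1, hFe q hq1] at hpq
      exact hFb.2.1 hp1 hq1 hpq
    · have := hFelt p hp1
      rw [hpq, hFe1 q hq1] at this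
      exact absurd this (lt_irrefl _)
    · have := hFelt q hq1
      rw [← hpq, hFe1 p hp1] at this
      exact absurd this (lt_irrefl _)
    · by_contra hne
      have hd : 0 < ‖p - q‖ / 3 := by
        have := norm_pos_iff.2 (sub_ne_zero.2 hne)
        positivity
      obtain ⟨ρ₁, hρ₁, hc1⟩ := hcross p hp1 _ hd
      obtain ⟨ρ₂, hρ₂, hc2⟩ := hcross q hq1 _ hd
      refine not_forall_le_norm_sub_of_norm_sub_eq (ζ := Fe p) (ρ₀ := min ρ₁ ρ₂) hfd hfinj
        (h.bdd.subset ?_) (hFe1 p hp1) (lt_min hρ₁ hρ₂) hd ?_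
      · rintro _ ⟨w, hw, rfl⟩
        exact (show G (f w) < 0 from hfm hw).le
      · intro ρ hρ
        obtain ⟨z, hz, hzp, hzρ⟩ := hc1 ρ ⟨hρ.1, hρ.2.trans_le (min_le_left _ _)⟩
        obtain ⟨z', hz', hzq, hzρ'⟩ := hc2 ρ ⟨hρ.1, hρ.2.trans_le (min_le_right _ _)⟩
        refine ⟨F z, F z', by simpa using hFb.1 hz, by simpa using hFb.1 hz', hzρ,
          by rw [hpq]; exact hzρ', ?_⟩
        rw [hfF z hz, hfF z' hz']
        have h1 : ‖p - q‖ ≤ ‖z - p‖ + ‖z - z'‖ + ‖z' - q‖ := by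
          rw [norm_sub_rev z p, show p - q = (p - z) + (z - z') + (z' - q) by ring]
          exact norm_add₃_le
        linarith
  have himg : Fe '' {z | G z ≤ 0} = Metric.closedBall 0 1 := by
    refine Subset.antisymm ?_ ?_
    · rintro _ ⟨z, hz, rfl⟩
      rw [mem_closedBall_zero_iff]
      rcases (show G z ≤ 0 from hz).lt_or_eq with h1 | h1
      · exact (hFelt z h1).le
      · exact (hFe1 z h1).le
    · rw [← closure_ball (0 : ℂ) one_ne_zero]
      refine closure_minimal (fun w hw => ⟨f w, (show G (f w) < 0 from hfm hw).le, ?_⟩)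
        (h.isCompact_nonpos.image_of_continuousOn hFec).isClosed
      rw [hFe _ (hfm hw), hFf w hw]
  set Φ := Function.invFunOn Fe {z | G z ≤ 0}
  have hΦF : ∀ z ∈ {z | G z ≤ 0}, Φ (Fe z) = z := fun z hz => hFei.leftInvOn_invFunOn hz
  have hΦc : ContinuousOn Φ (Metric.closedBall 0 1) := by
    rw [← himg]
    exact continuousOn_image_of_comp h.isCompact_nonpos hFec (continuousOn_id.congr hΦF)
  have hΦf : EqOn Φ f (Metric.ball 0 1) := fun w hw => by
    conv_lhs => rw [← hFf w hw, ← hFe _ (hfm hw)]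
    exact hΦF _ (show G (f w) < 0 from hfm hw).le
  refine ⟨Φ, hΦc, ?_, ?_, ?_, ?_, ?_⟩
  · rw [← himg]
    rintro _ ⟨z, hz, rfl⟩ _ ⟨z', hz', rfl⟩ he
    rw [hΦF z hz, hΦF z' hz'] at he
    rw [he]
  · rw [hΦf.image_eq]
    exact Subset.antisymm hfm.image_subset fun z hz => ⟨F z, hFb.1 hz, hfF z hz⟩
  · refine Subset.antisymm ?_ fun z hz => ⟨Fe z, by simpa using hFe1 z hz, hΦF z (le_of_eq hz)⟩
    rintro _ ⟨w, hw, rfl⟩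
    obtain ⟨z, hz, rfl⟩ : w ∈ Fe '' {z | G z ≤ 0} := by
      rw [himg]; exact Metric.sphere_subset_closedBall hw
    rw [hΦF z hz]
    by_contra hz0
    have := hFelt z (lt_of_le_of_ne hz hz0)
    rw [mem_sphere_zero_iff_norm.1 hw] at this
    exact this.false
  · have := hΦF 0 h0.le
    rwa [hFe 0 h0, hF0] at this
  · have h1 := hfder 0 (Metric.mem_ball_self one_pos)
    have hev : Φ =ᶠ[𝓝 0] f :=
      Filter.eventually_of_mem (Metric.isOpen_ball.mem_nhds (Metric.mem_ball_self one_pos)) hΦf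
    have h2 := ((hfd.analyticAt (Metric.isOpen_ball.mem_nhds
      (Metric.mem_ball_self one_pos))).congr hev.symm).hasStrictDerivAt
    rw [(h1.congr_of_eventuallyEq hev).deriv] at h2
    exact ⟨_, inv_ne_zero (hFder _ (hfm (Metric.mem_ball_self one_pos))), h2⟩

end IsDefining

theorem eq_and_eq_of_polar_eq {a b : ℂ} (ha : ‖a‖ = 1) (hb : ‖b‖ = 1) {p q : ℝ} (hp : 0 < p)
    (hq : 0 < q) (h : (p : ℂ) * a = q * b) : p = q ∧ a = b := by
  have hpq : p = q := by
    have := congrArg norm h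
    simpa [ha, hb, abs_of_pos hp, abs_of_pos hq] using this
  subst hpq
  exact ⟨rfl, mul_left_cancel₀ (Complex.ofReal_ne_zero.2 hp.ne') h⟩

theorem exists_eq_norm_mul {z : ℂ} (hz : z ≠ 0) : ∃ e : ℂ, ‖e‖ = 1 ∧ z = (‖z‖ : ℂ) * e := by
  have h : (‖z‖ : ℂ) ≠ 0 := by simpa using hz
  exact ⟨z / ‖z‖, by simp [hz], by field_simp⟩

theorem exists_norm_lt_norm_on_rays {Φ : ℂ → ℂ} {c : ℂ} (hc : c ≠ 0) (h : HasStrictDerivAt Φ c 0)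
    (h0 : Φ 0 = 0) : ∃ r₀ > 0, ∀ e : ℂ, ‖e‖ = 1 → ∀ s t : ℝ, 0 ≤ t → t < s → s < r₀ →
      ‖Φ (t * e)‖ < ‖Φ (s * e)‖ := by
  have hc' : 0 < ‖c‖ := norm_pos_iff.2 hc
  have h1 := h.hasStrictFDerivAt.isLittleO.def (show 0 < ‖c‖ / 4 by positivity)
  obtain ⟨r₀, hr₀, hr⟩ := Metric.eventually_nhds_iff.1 h1
  have key : ∀ x y : ℂ, ‖x‖ < r₀ → ‖y‖ < r₀ → ‖Φ x - Φ y - (x - y) * c‖ ≤ ‖c‖ / 4 * ‖x - y‖ := by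
    intro x y hx hy
    have := @hr (x, y) (by rw [Prod.dist_eq]; simpa using ⟨hx, hy⟩)
    simpa using this
  refine ⟨r₀, hr₀, fun e he s t ht hts hs => ?_⟩
  have hns : ‖(s : ℂ) * e‖ = s := by simp [he, abs_of_pos (ht.trans_lt hts)]
  have hnt : ‖(t : ℂ) * e‖ = t := by simp [he, abs_of_nonneg ht]
  have hnst : ‖(s : ℂ) * e - t * e‖ = s - t := by
    rw [← sub_mul, ← Complex.ofReal_sub, norm_mul, he, mul_one, Complex.norm_real,
      Real.norm_of_nonneg (sub_pos.2 hts).le]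
  have k1 := key (s * e) (t * e) (by rwa [hns]) (by rw [hnt]; exact hts.trans hs)
  have k2 := key (t * e) 0 (by rw [hnt]; exact hts.trans hs) (by simpa using hr₀)
  rw [hnst] at k1
  rw [h0, sub_zero, sub_zero, hnt] at k2
  have hct : ‖(t : ℂ) * e * c‖ = t * ‖c‖ := by rw [norm_mul, hnt]
  have k3 : t * ‖c‖ - ‖c‖ / 4 * t ≤ ‖Φ (t * e)‖ := by
    have := norm_sub_norm_le ((t : ℂ) * e * c) (Φ (t * e))
    rw [norm_sub_rev, hct] at this
    linarith
  rcases ht.eq_or_lt with rfl | ht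
  · simp only [Complex.ofReal_zero, zero_mul, h0, norm_zero, sub_zero] at k1 ⊢
    have := norm_sub_norm_le ((s : ℂ) * e * c) (Φ (s * e))
    rw [norm_sub_rev, norm_mul _ c, hns] at this
    have : 0 < s * ‖c‖ := by positivity
    linarith
  have k4 : s * ‖Φ (t * e)‖ ≤ t * ‖Φ (s * e)‖ + 2 * (‖c‖ / 4 * (s - t)) * t := by
    have e1 : (s : ℂ) * Φ (t * e) = t * Φ (s * e) - t * (Φ (s * e) - Φ (t * e) -
        ((s : ℂ) * e - t * e) * c) + (s - t : ℝ) * (Φ (t * e) - t * e * c) := by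
      push_cast; ring
    have e2 := congrArg norm e1
    rw [norm_mul, Complex.norm_real, Real.norm_of_nonneg (ht.trans hts).le] at e2
    rw [e2]
    refine (norm_add_le _ _).trans ?_
    have e3 := norm_sub_le ((t : ℂ) * Φ (s * e)) (t * (Φ (s * e) - Φ (t * e) -
        ((s : ℂ) * e - t * e) * c))
    simp only [norm_mul, Complex.norm_real, Real.norm_of_nonneg ht.le,
      Real.norm_of_nonneg (sub_pos.2 hts).le] at e3 ⊢
    have := mul_le_mul_of_nonneg_left k1 ht.le
    have := mul_le_mul_of_nonneg_left k2 (sub_pos.2 hts).le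
    linarith
  have hst := sub_pos.2 hts
  have : 0 < t * (‖Φ (s * e)‖ - ‖Φ (t * e)‖) := by
    have h5 := mul_le_mul_of_nonneg_left k3 hst.le
    have h6 : 0 < ‖c‖ * ((s - t) * t) := by positivity
    nlinarith
  exact sub_pos.1 (pos_of_mul_pos_right this ht.le)

theorem exists_radial_rescaling {ρ δ : ℝ} (hρ : ρ < 1) (hδ : 0 < δ) :
    ∃ χ : ℝ → ℝ, Continuous χ ∧ StrictMono χ ∧ χ ρ = 1 ∧ (∀ r, r ≤ 1 + δ → χ r ≤ 1 + δ) ∧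
      ∀ r, 1 + δ ≤ r → χ r = r := by
  have hd : 0 < 1 + δ - ρ := by linarith
  refine ⟨fun r => max r (1 + δ * (r - ρ) / (1 + δ - ρ)), by fun_prop, fun r s hrs => ?_, ?_,
    fun r hr => ?_, fun r hr => ?_⟩
  · refine max_lt_max hrs ?_
    gcongr
  · simp [hρ.le]
  · refine max_le hr ?_
    have : δ * (r - ρ) / (1 + δ - ρ) ≤ δ := by
      rw [div_le_iff₀ hd]
      exact mul_le_mul_of_nonneg_left (by linarith) hδ.le
    linarith
  · refine max_eq_left ?_
    rw [← le_sub_iff_add_le', div_le_iff₀ hd]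
    nlinarith

namespace IsDefining

variable {g : Circle × ℝ → ℂ} {G : ℂ → ℝ}

theorem exists_annulus_of_small_circle (h : IsDefining g G)
    (h0 : Metric.closedBall 0 1 ⊆ {z | G z < 0}) :
    ∃ ρ : ℝ, 0 < ρ ∧ ρ < 1 ∧ ∃ k : Circle × ℝ → ℂ, ContinuousOn k (univ ×ˢ Icc 0 1) ∧
      InjOn k (univ ×ˢ Icc 0 1) ∧ (∀ c, k (c, 0) = ρ * c) ∧ (∀ c, ∀ t ∈ Ioc (0 : ℝ) 1,
        ρ < ‖k (c, t)‖) ∧ (∀ c, ∀ t ∈ Icc (0 : ℝ) 1, G (k (c, t)) ≤ 0) ∧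
      k '' (univ ×ˢ {1}) = {z | G z = 0} := by
  obtain ⟨Φ, hΦc, hΦi, hΦb, hΦs, hΦ0, c₀, hc₀, hΦd⟩ :=
    h.exists_closedBall_param (h0 (by simp))
  obtain ⟨r₁, hr₁, hr⟩ := exists_norm_lt_norm_on_rays hc₀ hΦd hΦ0
  obtain ⟨r₀, hr₀, hr₀₁, hr₀1⟩ : ∃ r > 0, r < r₁ ∧ r < 1 :=
    ⟨min r₁ 1 / 2, by positivity, by linarith [min_le_left r₁ 1, lt_min hr₁ one_pos],
      by linarith [min_le_right r₁ 1]⟩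
  obtain ⟨ρ, hρ, hρ1, hρm⟩ : ∃ ρ > 0, ρ < 1 ∧ ∀ w : ℂ, r₀ ≤ ‖w‖ → ‖w‖ ≤ 1 → ρ < ‖Φ w‖ := by
    have hK : IsCompact (Metric.closedBall (0 : ℂ) 1 ∩ {w | r₀ ≤ ‖w‖}) :=
      (isCompact_closedBall _ _).inter_right (isClosed_le continuous_const continuous_norm)
    obtain ⟨w, ⟨hw, hw'⟩, hmin⟩ := hK.exists_isMinOn
      ⟨1, by simp, by simpa using hr₀1.le⟩ (hΦc.norm.mono inter_subset_left)
    have hpos : 0 < ‖Φ w‖ := by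
      rw [norm_pos_iff]
      intro he
      have := hΦi hw (by simp) (he.trans hΦ0.symm)
      rw [this, mem_ofPred_eq, norm_zero] at hw'
      linarith
    refine ⟨min ‖Φ w‖ 1 / 2, by positivity, by linarith [min_le_right ‖Φ w‖ 1], fun v hv hv1 => ?_⟩
    have := isMinOn_iff.1 hmin v ⟨by simpa using hv1, hv⟩
    linarith [min_le_left ‖Φ w‖ 1]
  have hray : ∀ e : ℂ, ‖e‖ = 1 → ∀ s t : ℝ, 0 ≤ t → t < s → s ≤ 1 → ‖Φ (t * e)‖ = ρ →
      ρ < ‖Φ (s * e)‖ := by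
    intro e he s t ht hts hs hte
    rcases lt_or_ge s r₀ with h1 | h1
    · rw [← hte]
      exact hr e he s t ht hts (h1.trans hr₀₁)
    · refine hρm _ ?_ ?_ <;> simpa [he, abs_of_pos (ht.trans_lt hts)]
  have himg : Φ '' Metric.closedBall 0 1 = {z | G z ≤ 0} := by
    rw [← Metric.ball_union_sphere, image_union, hΦb, hΦs]
    ext z
    exact (le_iff_lt_or_eq (a := G z) (b := 0)).symm
  set F := Function.invFunOn Φ (Metric.closedBall 0 1)
  have hFΦ : ∀ w ∈ Metric.closedBall 0 1, F (Φ w) = w := fun w hw => hΦi.leftInvOn_invFunOn hw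
  have hFc : ContinuousOn F {z | G z ≤ 0} := by
    rw [← himg]
    exact continuousOn_image_of_comp (isCompact_closedBall _ _) hΦc (continuousOn_id.congr hFΦ)
  have hmemG : ∀ c : Circle, (ρ : ℂ) * c ∈ {z | G z ≤ 0} := fun c =>
    (show G (ρ * c) < 0 from h0 (by simp [abs_of_pos hρ, Circle.norm_coe, hρ1.le])).le
  set W : Circle → ℂ := fun c => F (ρ * c)
  have hWc : Continuous W := hFc.comp_continuous (by fun_prop) hmemG
  have hWb : ∀ c, W c ∈ Metric.closedBall 0 1 := fun c =>
    Function.invFunOn_mem (show (ρ : ℂ) * c ∈ Φ '' _ by rw [himg]; exact hmemG c)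
  have hΦW : ∀ c, Φ (W c) = ρ * c := fun c =>
    Function.invFunOn_eq (show (ρ : ℂ) * c ∈ Φ '' _ by rw [himg]; exact hmemG c)
  have hnW : ∀ c, ‖Φ (W c)‖ = ρ := fun c => by rw [hΦW]; simp [abs_of_pos hρ, Circle.norm_coe]
  have hW0 : ∀ c, W c ≠ 0 := fun c he => by
    have := hnW c
    rw [he, hΦ0, norm_zero] at this
    exact hρ.ne this
  have hW1 : ∀ c, ‖W c‖ < 1 := fun c => by
    by_contra hge
    have := hρm (W c) (hr₀1.le.trans (not_lt.1 hge)) (by simpa using hWb c)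
    exact this.ne' (hnW c)
  choose e he hWe using fun c => exists_eq_norm_mul (hW0 c)
  let L : Circle × ℝ → ℝ := fun p => ‖W p.1‖ * (1 - p.2) + p.2
  have hLc : Continuous L := by fun_prop
  have hec : Continuous e := by
    have : e = fun c => W c / ‖W c‖ := by
      ext c
      have h1 : (‖W c‖ : ℂ) ≠ 0 := by simpa using hW0 c
      rw [eq_div_iff h1, mul_comm]
      exact (hWe c).symm
    rw [this]
    exact hWc.div (by fun_prop) fun c => by simpa using hW0 c
  have hLpos : ∀ c, ∀ t ∈ Icc (0 : ℝ) 1, ‖W c‖ ≤ L (c, t) ∧ L (c, t) ≤ 1 := fun c t ht => by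
    have := hW1 c
    simp only [L]
    constructor <;> nlinarith [ht.1, ht.2]
  have hLpos' : ∀ c, ∀ t ∈ Icc (0 : ℝ) 1, 0 < L (c, t) := fun c t ht =>
    (norm_pos_iff.2 (hW0 c)).trans_le (hLpos c t ht).1
  have hmem : ∀ c, ∀ t ∈ Icc (0 : ℝ) 1, (L (c, t) : ℂ) * e c ∈ Metric.closedBall 0 1 :=
    fun c t ht => by
      rw [mem_closedBall_zero_iff, norm_mul, he, mul_one, Complex.norm_real,
        Real.norm_of_nonneg (hLpos' c t ht).le]
      exact (hLpos c t ht).2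
  have hsame : ∀ c c', e c = e c' → ‖W c‖ ≤ ‖W c'‖ := by
    intro c c' hcc
    by_contra hlt
    have h1 := hray (e c') (he c') ‖W c‖ ‖W c'‖ (norm_nonneg _) (not_le.1 hlt) (hW1 c).le
      (by rw [← hWe c', hnW])
    rw [← hcc, ← hWe c, hnW] at h1
    exact h1.false
  refine ⟨ρ, hρ, hρ1, fun p => Φ (L p * e p.1), ?_, ?_, ?_, ?_, ?_, ?_⟩
  · refine hΦc.comp (Continuous.continuousOn (by fun_prop)) ?_
    rintro ⟨c, t⟩ ⟨-, ht⟩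
    exact hmem c t ht
  · rintro ⟨c, t⟩ ⟨-, ht⟩ ⟨c', t'⟩ ⟨-, ht'⟩ heq
    obtain ⟨hL, hee⟩ := eq_and_eq_of_polar_eq (he c) (he c') (hLpos' c t ht) (hLpos' c' t' ht')
      (hΦi (hmem c t ht) (hmem c' t' ht') heq)
    have hWn : ‖W c‖ = ‖W c'‖ := (hsame c c' hee).antisymm (hsame c' c hee.symm)
    have hWW : W c = W c' := by rw [hWe c, hWe c', hWn, hee]
    have hcc : c = c' := by
      have h1 := hΦW c
      rw [hWW, hΦW c'] at h1
      exact Circle.ext (mul_left_cancel₀ (Complex.ofReal_ne_zero.2 hρ.ne') h1).symm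
    subst hcc
    have h1 := sub_pos.2 (hW1 c)
    have : (1 - ‖W c‖) * (t - t') = 0 := by
      simp only [L] at hL
      linarith
    rcases mul_eq_zero.1 this with h2 | h2
    · exact absurd h2 h1.ne'
    · rw [sub_eq_zero.1 h2]
  · intro c
    simp only [L, sub_zero, mul_one, add_zero]
    rw [← hWe c, hΦW]
  · intro c t ht
    refine hray (e c) (he c) _ ‖W c‖ (norm_nonneg _) ?_ (hLpos c t ⟨ht.1.le, ht.2⟩).2
      (by rw [← hWe c, hnW])
    have := hW1 c
    simp only [L]
    nlinarith [ht.1]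
  · intro c t ht
    have : Φ (L (c, t) * e c) ∈ {z | G z ≤ 0} := by
      rw [← himg]
      exact mem_image_of_mem _ (hmem c t ht)
    exact this
  · rw [← hΦs]
    refine Subset.antisymm ?_ ?_
    · rintro _ ⟨⟨c, t⟩, ⟨-, rfl⟩, rfl⟩
      exact mem_image_of_mem _ (by simp [L, he])
    · rintro _ ⟨v, hv, rfl⟩
      have hv1 : ‖v‖ = 1 := by simpa using hv
      have hcont : ContinuousOn (fun t : ℝ => ‖Φ (t * v)‖) (Icc 0 1) := by
        refine (hΦc.comp (Continuous.continuousOn (by fun_prop)) fun t ht => ?_).norm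
        simpa [hv1, abs_of_nonneg ht.1] using ht.2
      obtain ⟨t, ht, htρ⟩ := intermediate_value_Icc zero_le_one hcont
        (show ρ ∈ Icc _ _ from ⟨by simpa [hΦ0] using hρ.le,
          by simpa using (hρm v (by rw [hv1]; exact hr₀1.le) hv1.le).le⟩)
      have htb : (t : ℂ) * v ∈ Metric.closedBall 0 1 := by
        simpa [hv1, abs_of_nonneg ht.1] using ht.2
      have ht0 : 0 < t := lt_of_le_of_ne ht.1 fun h2 => by
        simp only [← h2, Complex.ofReal_zero, zero_mul, hΦ0, norm_zero] at htρ
        exact hρ.ne htρ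
      obtain ⟨u, hu, hΦu⟩ := exists_eq_norm_mul (z := Φ (t * v))
        (norm_pos_iff.1 (by simp only [] at htρ; rw [htρ]; exact hρ))
      simp only [] at htρ
      rw [htρ] at hΦu
      let c : Circle := ⟨u, mem_sphere_zero_iff_norm.2 hu⟩
      have hWc' : W c = t * v := hΦi (hWb c) htb (by rw [hΦW, hΦu])
      have hev := (eq_and_eq_of_polar_eq (he c) hv1 (norm_pos_iff.2 (hW0 c)) ht0
        ((hWe c).symm.trans hWc')).2
      exact ⟨(c, 1), ⟨mem_univ _, rfl⟩, by simp [L, hev]⟩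

/-- The planar annulus theorem for the unit circle and a bicollared circle around it. -/
theorem exists_annulus (h : IsDefining g G) (h0 : Metric.closedBall 0 1 ⊆ {z | G z < 0}) :
    ∃ k : Circle × ℝ → ℂ, ContinuousOn k (univ ×ˢ Icc 0 1) ∧ InjOn k (univ ×ˢ Icc 0 1) ∧
      (∀ c, k (c, 0) = c) ∧ (∀ c, ∀ t ∈ Ioc (0 : ℝ) 1, 1 < ‖k (c, t)‖) ∧
      (∀ c, ∀ t ∈ Icc (0 : ℝ) 1, G (k (c, t)) ≤ 0) ∧ k '' (univ ×ˢ {1}) = {z | G z = 0} := by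
  obtain ⟨ρ, hρ, hρ1, k, hkc, hki, hk0, hk1, hkG, hkimg⟩ := h.exists_annulus_of_small_circle h0
  obtain ⟨δ, hδ, hδG⟩ := (isCompact_closedBall (0 : ℂ) 1).exists_cthickening_subset_open
    h.isOpen_neg h0
  rw [cthickening_closedBall hδ.le zero_le_one, add_comm] at hδG
  obtain ⟨χ, hχc, hχm, hχρ, hχle, hχid⟩ := exists_radial_rescaling hρ1 hδ
  have hkn : ∀ c, ∀ t ∈ Icc (0 : ℝ) 1, ρ ≤ ‖k (c, t)‖ := fun c t ht => by
    rcases ht.1.eq_or_lt with rfl | ht0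
    · rw [hk0]; simp [abs_of_pos hρ, Circle.norm_coe]
    · exact (hk1 c t ⟨ht0, ht.2⟩).le
  have hχ1 : ∀ z : ℂ, ρ ≤ ‖z‖ → 1 ≤ χ ‖z‖ := fun z hz => hχρ ▸ hχm.monotone hz
  let R : ℂ → ℂ := fun z => (χ ‖z‖ : ℂ) * (z / ‖z‖)
  have hRu : ∀ z : ℂ, ρ ≤ ‖z‖ → ‖z / (‖z‖ : ℂ)‖ = 1 := fun z hz => by
    rw [norm_div, Complex.norm_real, norm_norm, div_self (hρ.trans_le hz).ne']
  have hRn : ∀ z : ℂ, ρ ≤ ‖z‖ → ‖R z‖ = χ ‖z‖ := fun z hz => by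
    rw [norm_mul, hRu z hz, mul_one, Complex.norm_real,
      Real.norm_of_nonneg (zero_le_one.trans (hχ1 z hz))]
  have hRi : ∀ z w : ℂ, ρ ≤ ‖z‖ → ρ ≤ ‖w‖ → R z = R w → z = w := fun z w hz hw heq => by
    obtain ⟨h1, h2⟩ := eq_and_eq_of_polar_eq (hRu z hz) (hRu w hw)
      (zero_lt_one.trans_le (hχ1 z hz)) (zero_lt_one.trans_le (hχ1 w hw)) heq
    rw [hχm.injective h1] at h2
    exact (div_left_inj' (Complex.ofReal_ne_zero.2 (hρ.trans_le hw).ne')).1 h2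
  have hRid : ∀ z : ℂ, ¬ G z < 0 → R z = z := fun z hz => by
    have hz1 : 1 + δ ≤ ‖z‖ := by
      by_contra hlt
      exact hz (hδG (by simpa using (not_le.1 hlt).le))
    have hz0 : (‖z‖ : ℂ) ≠ 0 := Complex.ofReal_ne_zero.2 (by linarith)
    simp only [R]
    rw [hχid _ hz1]
    field_simp
  refine ⟨R ∘ k, ?_, ?_, ?_, ?_, ?_, ?_⟩
  · have hR : ContinuousOn R {z | ρ ≤ ‖z‖} := by
      refine ContinuousOn.mul (by fun_prop) (continuousOn_id.div (by fun_prop) fun z hz => ?_)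
      exact Complex.ofReal_ne_zero.2 (hρ.trans_le hz).ne'
    exact hR.comp hkc fun p hp => hkn p.1 p.2 hp.2
  · rintro ⟨c, t⟩ hp ⟨c', t'⟩ hp' heq
    exact hki hp hp' (hRi _ _ (hkn c t hp.2) (hkn c' t' hp'.2) heq)
  · intro c
    have : ‖(ρ : ℂ) * c‖ = ρ := by simp [abs_of_pos hρ, Circle.norm_coe]
    simp only [Function.comp, R, hk0, this, hχρ]
    have : (ρ : ℂ) ≠ 0 := Complex.ofReal_ne_zero.2 hρ.ne'
    field_simp
    simp
  · intro c t ht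
    rw [Function.comp, hRn _ (hkn c t ⟨ht.1.le, ht.2⟩), ← hχρ]
    exact hχm (hk1 c t ht)
  · intro c t ht
    by_cases hG : G (k (c, t)) < 0
    · rcases le_total ‖k (c, t)‖ (1 + δ) with h1 | h1
      · have : R (k (c, t)) ∈ {z | G z < 0} := hδG (by
          rw [mem_closedBall_zero_iff, hRn _ (hkn c t ht)]
          exact hχle _ h1)
        exact this.le
      · have h2 : (‖k (c, t)‖ : ℂ) ≠ 0 := Complex.ofReal_ne_zero.2 (by linarith)
        have : R (k (c, t)) = k (c, t) := by
          simp only [R]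
          rw [hχid _ h1]
          field_simp
        simpa [this] using hG.le
    · rw [Function.comp, hRid _ hG]
      exact hkG c t ht
  · rw [image_comp, hkimg]
    have : EqOn R id {z | G z = 0} := fun z hz => hRid z (not_lt.2 (le_of_eq hz.symm))
    rw [this.image_eq, image_id]

end IsDefining

theorem IsTwoSided.exists_isCollar {S : Type*} [TopologicalSpace S] {C : Set S}
    (hC : IsTwoSided C) : ∃ H : Circle × ℝ → S, IsCollar H ∧ H '' (univ ×ˢ {0}) = C := by
  obtain ⟨h, hh, rfl⟩ := hC
  have h1 : (-1 : ℝ) ≤ 1 := by norm_num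
  refine ⟨fun p => h (p.1, projIcc (-1) 1 h1 p.2), ⟨hh.continuous.comp
    (continuous_fst.prodMk ((continuous_projIcc (h := h1)).comp continuous_snd)), ?_⟩, ?_⟩
  · rintro ⟨c, t⟩ ⟨-, ht⟩ ⟨c', t'⟩ ⟨-, ht'⟩ heq
    have := hh.injective heq
    rw [projIcc_of_mem _ ht, projIcc_of_mem _ ht'] at this
    simpa using this
  · ext x
    constructor
    · rintro ⟨⟨c, t⟩, ⟨-, rfl⟩, rfl⟩
      exact ⟨_, by simp [projIcc_of_mem h1 (show (0 : ℝ) ∈ Icc (-1) 1 by norm_num)], rfl⟩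
    · rintro ⟨⟨c, t⟩, ht, rfl⟩
      refine ⟨(c, t), ⟨mem_univ _, ht⟩, ?_⟩
      simp

/-- A collar is parametrized by a planar annulus, through polar coordinates. -/
theorem IsCollar.exists_planar_coordinates {S : Type*} [TopologicalSpace S] [T2Space S]
    {H : Circle × ℝ → S} (hH : IsCollar H) : ∃ (E : S → ℂ) (J : ℂ → S),
      (∀ c, ∀ t ∈ Icc (-1 : ℝ) 1, E (H (c, t)) = Real.exp t * c) ∧
      (∀ c : Circle, ∀ t ∈ Icc (-1 : ℝ) 1, J (Real.exp t * c) = H (c, t)) ∧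
      ContinuousOn E (H '' (univ ×ˢ Icc (-1) 1)) ∧
      ContinuousOn J {z | Real.exp (-1) ≤ ‖z‖ ∧ ‖z‖ ≤ Real.exp 1} := by
  let P : Circle × ℝ → ℂ := fun p => Real.exp p.2 * p.1
  have hP : Continuous P := by fun_prop
  have hPi : Function.Injective P := by
    rintro ⟨c, t⟩ ⟨c', t'⟩ heq
    obtain ⟨h1, h2⟩ := eq_and_eq_of_polar_eq (Circle.norm_coe c) (Circle.norm_coe c')
      (Real.exp_pos t) (Real.exp_pos t') heq
    exact Prod.ext (Circle.ext h2) (Real.exp_injective h1)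
  have hE : ∀ c, ∀ t ∈ Icc (-1 : ℝ) 1,
      P (Function.invFunOn H (univ ×ˢ Icc (-1) 1) (H (c, t))) = P (c, t) := fun c t ht =>
    congrArg P (hH.2.leftInvOn_invFunOn ⟨mem_univ _, ht⟩)
  have hJ : ∀ c t, H (Function.invFun P (P (c, t))) = H (c, t) := fun c t =>
    congrArg H (Function.leftInverse_invFun hPi _)
  refine ⟨fun x => P (Function.invFunOn H (univ ×ˢ Icc (-1) 1) x), H ∘ Function.invFun P,
    hE, fun c t _ => hJ c t, ?_, ?_⟩
  · refine continuousOn_image_of_comp (isCompact_cylinder (-1) 1) hH.1.continuousOn ?_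
    exact hP.continuousOn.congr fun p hp => hE p.1 p.2 hp.2
  · have hset : {z : ℂ | Real.exp (-1) ≤ ‖z‖ ∧ ‖z‖ ≤ Real.exp 1} ⊆ P '' (univ ×ˢ Icc (-1) 1) := by
      rintro z ⟨hz, hz'⟩
      have hz0 : 0 < ‖z‖ := (Real.exp_pos _).trans_le hz
      obtain ⟨e, he, hze⟩ := exists_eq_norm_mul (norm_pos_iff.1 hz0)
      refine ⟨(⟨e, mem_sphere_zero_iff_norm.2 he⟩, Real.log ‖z‖), ⟨mem_univ _,
        (Real.le_log_iff_exp_le hz0).2 hz, (Real.log_le_iff_le_exp hz0).2 hz'⟩, ?_⟩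
      simp only [P, Real.exp_log hz0]
      exact hze.symm
    refine (continuousOn_image_of_comp (isCompact_cylinder (-1) 1) hP.continuousOn ?_).mono hset
    exact hH.1.continuousOn.congr fun p _ => hJ p.1 p.2

/-- A two-sided circle inside the domain of an injective planar chart is bicollared in the plane. -/
theorem IsTwoSided.exists_isDefining {S : Type*} [TopologicalSpace S] {D A : Set S}
    (hD : IsTwoSided D) (hA : IsOpen A) (hDA : D ⊆ A) {E : S → ℂ} (hE : ContinuousOn E A)
    (hEi : InjOn E A) : ∃ (g : Circle × ℝ → ℂ) (G : ℂ → ℝ), IsDefining g G ∧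
      E '' D = {z | G z = 0} := by
  obtain ⟨K, hK, rfl⟩ := hD.exists_isCollar
  obtain ⟨u, v, -, hv, hu, hv0, huv⟩ := generalized_tube_lemma isCompact_univ
    isCompact_singleton (hA.preimage hK.1) (image_subset_iff.1 hDA)
  obtain ⟨ε, hε, hεv⟩ := Metric.isOpen_iff.1 hv 0 (hv0 rfl)
  obtain ⟨η, hη, hηε, hη1⟩ : ∃ η > 0, η < ε ∧ η ≤ 1 :=
    ⟨min (ε / 2) 1, by positivity, (min_le_left _ _).trans_lt (by linarith), min_le_right _ _⟩
  let q : ℝ → ℝ := fun t => η * projIcc (-1 : ℝ) 1 (by norm_num) t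
  have hqc : Continuous q := by fun_prop
  have hqη : ∀ t, |q t| ≤ η := fun t => by
    have h1 := (projIcc (-1 : ℝ) 1 (by norm_num) t).2
    rw [abs_mul, abs_of_pos hη]
    exact mul_le_of_le_one_right hη.le (abs_le.2 h1)
  have hqA : ∀ c t, K (c, q t) ∈ A := fun c t => huv (show (c, q t) ∈ u ×ˢ v from
    ⟨hu (mem_univ c), hεv (by simpa using (hqη t).trans_lt hηε)⟩)
  have hq1 : ∀ t, q t ∈ Icc (-1 : ℝ) 1 := fun t => abs_le.1 ((hqη t).trans hη1)
  have hg : IsCollar fun p : Circle × ℝ => E (K (p.1, q p.2)) := by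
    refine ⟨hE.comp_continuous (hK.1.comp (by fun_prop)) fun p => hqA _ _, ?_⟩
    rintro ⟨c, t⟩ ⟨-, ht⟩ ⟨c', t'⟩ ⟨-, ht'⟩ heq
    obtain ⟨h1, h2⟩ := hK.eq_of_eq (hq1 t) (hq1 t') (hEi (hqA c t) (hqA c' t') heq)
    have h3 := mul_left_cancel₀ hη.ne' h2
    rw [projIcc_of_mem _ ht, projIcc_of_mem _ ht'] at h3
    exact Prod.ext h1 h3
  obtain ⟨g, G, hgg, hG⟩ := hg.exists_isDefining
  have hq0 : q 0 = 0 := by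
    simp [q, projIcc_of_mem (by norm_num : (-1 : ℝ) ≤ 1) (show (0 : ℝ) ∈ Icc (-1) 1 by norm_num)]
  refine ⟨g, G, hG, ?_⟩
  ext z
  rw [mem_ofPred_eq, hG.eq_zero_iff]
  simp [hgg, hq0]

theorem exists_one_sided_annulus {S : Type*} [TopologicalSpace S] [T2Space S]
    [ChartedSpace (EuclideanSpace ℝ (Fin 2)) S] {𝒞 : Set (Set S)} (h𝒞 : IsCircleDecomposition 𝒞)
    (hts : ∀ C ∈ 𝒞, IsTwoSided C) (husc : IsUpperSemicontinuousDecomposition 𝒞)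
    {H : Circle × ℝ → S} (hH : IsCollar H) (hC : H '' (univ ×ˢ {0}) ∈ 𝒞) :
    ∃ k : Circle × ℝ → S, ContinuousOn k (univ ×ˢ Icc 0 1) ∧ InjOn k (univ ×ˢ Icc 0 1) ∧
      (∀ c, k (c, 0) = H (c, 0)) ∧ (∀ c, ∀ t ∈ Ioc (0 : ℝ) 1, k (c, t) ∈ H '' (univ ×ˢ Ioo 0 1)) ∧
      k '' (univ ×ˢ {1}) ∈ 𝒞 := by
  obtain ⟨hcirc, hdisj, hcover⟩ := h𝒞
  have hconn : ∀ D ∈ 𝒞, IsPreconnected D := fun D hD => by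
    obtain ⟨e⟩ := hcirc D hD
    have : PreconnectedSpace D := e.symm.surjective.denseRange.preconnectedSpace e.symm.continuous
    exact isPreconnected_iff_preconnectedSpace.2 this
  have hthrough : ∀ x, ∃ D ∈ 𝒞, x ∈ D := fun x => by
    simpa using hcover.symm.subset (mem_univ x)
  have hexp : Real.exp (-1) < 1 := Real.exp_lt_one_iff.2 (by norm_num)
  have hmid : ∀ {s : Set ℝ}, s ⊆ Icc (-1) 1 → ∀ {c t}, t ∈ Icc (-1 : ℝ) 1 →
      (H (c, t) ∈ H '' (univ ×ˢ s) ↔ t ∈ s) := by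
    intro s hs c t ht
    refine ⟨?_, fun h => ⟨_, ⟨mem_univ c, h⟩, rfl⟩⟩
    rintro ⟨⟨c', t'⟩, ⟨-, ht'⟩, heq⟩
    rwa [← (hH.eq_of_eq (hs ht') ht heq).2]
  set A := H '' (univ ×ˢ Ioo (-1) 1) with hAdef
  have hplanar : IsLocallyPlanar S := isLocallyPlanar_of_chartedSpace S
  have hA : IsOpen A := hH.isOpen_image hplanar isOpen_Ioo Ioo_subset_Icc_self
  obtain ⟨V, hV, hCV, hVA⟩ := husc _ hC A hA (image_mono (prod_mono_right (by norm_num)))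
  obtain ⟨t₀, ht₀, ht₀1, ht₀V⟩ : ∃ t > 0, t < 1 ∧ H (1, t) ∈ V := by
    have hc : Continuous fun t : ℝ => H (1, t) := hH.1.comp (by fun_prop)
    obtain ⟨ε, hε, hεV⟩ := Metric.isOpen_iff.1 (hV.preimage hc) 0
      (hCV ⟨(1, 0), ⟨mem_univ _, rfl⟩, rfl⟩)
    have hm : 0 < min ε 1 := by positivity
    refine ⟨min ε 1 / 2, by positivity, by linarith [min_le_right ε 1], hεV ?_⟩
    rw [Metric.mem_ball, dist_zero_right, Real.norm_of_nonneg (by positivity)]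
    linarith [min_le_left ε 1]
  obtain ⟨D, hD, hxD⟩ := hthrough (H (1, t₀))
  have hDA : D ⊆ A := hVA D hD (nonempty_iff_ne_empty.1 ⟨_, hxD, ht₀V⟩)
  have hDC : Disjoint D (H '' (univ ×ˢ {0})) := by
    refine hdisj D hD _ hC ?_
    rintro rfl
    have := (hmid (by norm_num) ⟨by linarith, ht₀1.le⟩).1 hxD
    exact ht₀.ne' this
  have hDpos : D ⊆ H '' (univ ×ˢ Ioo 0 1) := by
    refine (hconn D hD).subset_left_of_subset_union
      (hH.isOpen_image hplanar isOpen_Ioo (Ioo_subset_Icc_self.trans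
        (Icc_subset_Icc (by norm_num) le_rfl)))
      (hH.isOpen_image (s := Ioo (-1) 0) hplanar isOpen_Ioo (Ioo_subset_Icc_self.trans
        (Icc_subset_Icc le_rfl (by norm_num)))) ?_ ?_ ⟨_, hxD, _, ⟨mem_univ _, ht₀, ht₀1⟩, rfl⟩
    · rw [disjoint_left]
      rintro _ ⟨⟨c, t⟩, ⟨-, ht⟩, rfl⟩ h2
      have := (hmid (Ioo_subset_Icc_self.trans (Icc_subset_Icc le_rfl (by norm_num)))
        ⟨by linarith [ht.1], ht.2.le⟩).1 h2
      exact lt_asymm ht.1 this.2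
    · intro x hx
      obtain ⟨⟨c, t⟩, ⟨-, ht⟩, rfl⟩ := hDA hx
      rcases lt_trichotomy t 0 with h0 | rfl | h0
      · exact Or.inr ⟨_, ⟨mem_univ _, ht.1, h0⟩, rfl⟩
      · exact absurd ⟨(c, 0), ⟨mem_univ _, rfl⟩, rfl⟩ (disjoint_left.1 hDC hx)
      · exact Or.inl ⟨_, ⟨mem_univ _, h0, ht.2⟩, rfl⟩
  obtain ⟨E, J, hE, hJ, hEc, hJc⟩ := hH.exists_planar_coordinates
  have hAc : A ⊆ H '' (univ ×ˢ Icc (-1) 1) := image_mono (prod_mono_right Ioo_subset_Icc_self)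
  have hJE : ∀ x ∈ A, J (E x) = x := by
    rintro _ ⟨⟨c, t⟩, ⟨-, ht⟩, rfl⟩
    have ht' := Ioo_subset_Icc_self ht
    rw [hE c t ht', hJ c t ht']
  have hpolar : ∀ z : ℂ, Real.exp (-1) ≤ ‖z‖ → ‖z‖ ≤ Real.exp 1 → ∃ c, ∃ t ∈ Icc (-1 : ℝ) 1,
      t = Real.log ‖z‖ ∧ z = Real.exp t * (c : Circle) := by
    intro z hz hz'
    have hz0 : 0 < ‖z‖ := (Real.exp_pos _).trans_le hz
    obtain ⟨e, he, hze⟩ := exists_eq_norm_mul (norm_pos_iff.1 hz0)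
    refine ⟨⟨e, mem_sphere_zero_iff_norm.2 he⟩, Real.log ‖z‖,
      ⟨(Real.le_log_iff_exp_le hz0).2 hz, (Real.log_le_iff_le_exp hz0).2 hz'⟩, rfl, ?_⟩
    rw [Real.exp_log hz0]
    exact hze
  have hEJ : ∀ z : ℂ, Real.exp (-1) ≤ ‖z‖ → ‖z‖ ≤ Real.exp 1 → E (J z) = z := by
    intro z hz hz'
    obtain ⟨c, t, ht, -, rfl⟩ := hpolar z hz hz'
    rw [hJ c t ht, hE c t ht]
  have hJpos : ∀ z : ℂ, 1 < ‖z‖ → ‖z‖ < Real.exp 1 → J z ∈ H '' (univ ×ˢ Ioo 0 1) := by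
    intro z hz hz'
    obtain ⟨c, t, ht, hlog, hzt⟩ := hpolar z (by linarith)
      hz'.le
    rw [hzt, hJ c t ht]
    refine ⟨_, ⟨mem_univ _, ?_, ?_⟩, rfl⟩
    · rw [hlog]; exact Real.log_pos hz
    · rw [hlog]; exact (Real.log_lt_iff_lt_exp (by linarith)).2 hz'
  have hposA : H '' (univ ×ˢ Ioo 0 1) ⊆ A := image_mono (prod_mono_right
    (Ioo_subset_Ioo (by norm_num) le_rfl))
  have hEi : InjOn E A := fun x hx y hy hxy => by rw [← hJE x hx, hxy, hJE y hy]
  obtain ⟨g, G, hG, hEG⟩ := (hts D hD).exists_isDefining hA hDA (hEc.mono hAc) hEi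
  have hGz : ∀ z, G z = 0 → 1 < ‖z‖ ∧ ‖z‖ < Real.exp 1 := by
    intro z hz
    obtain ⟨x, hx, rfl⟩ := hEG.symm.subset hz
    obtain ⟨⟨c, t⟩, ⟨-, ht⟩, rfl⟩ := hDpos hx
    rw [hE c t ⟨by linarith [ht.1], ht.2.le⟩]
    simpa [Circle.norm_coe] using ht
  have hout : ∀ z : ℂ, Real.exp 1 ≤ ‖z‖ → 0 < G z := by
    intro z hz
    have hz1 : 1 ≤ ‖z‖ := (Real.one_le_exp zero_le_one).trans hz
    have hnorm : ∀ r ∈ Ici (1 : ℝ), ‖(r : ℂ) * z‖ = r * ‖z‖ := fun r hr => by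
      rw [norm_mul, Complex.norm_real, Real.norm_of_nonneg (zero_le_one.trans hr)]
    refine hG.pos_of_isPreconnected (s := (fun r : ℝ => (r : ℂ) * z) '' Ici 1)
      (isPreconnected_Ici.image _ (by fun_prop)) (fun hb => ?_) ?_ ⟨1, self_mem_Ici, by simp⟩
    · obtain ⟨R, hR⟩ := hb.exists_norm_le
      have hr : |R| + 1 ∈ Ici (1 : ℝ) := by simp
      have h1 := hR _ (mem_image_of_mem _ hr)
      rw [hnorm _ hr] at h1
      have h2 := le_mul_of_one_le_right (zero_le_one.trans hr) hz1
      linarith [le_abs_self R]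
    · rintro _ ⟨r, hr, rfl⟩ h0
      have h1 := (hGz _ h0).2
      rw [hnorm r hr] at h1
      exact h1.not_ge (hz.trans (le_mul_of_one_le_left (norm_nonneg z) hr))
  have hin : Metric.closedBall 0 1 ⊆ {z | G z < 0} := by
    by_contra hnot
    obtain ⟨w, hw, hwG⟩ := not_subset.1 hnot
    have hball : ∀ z ∈ Metric.closedBall (0 : ℂ) 1, G z ≠ 0 := fun z hz h0 =>
      (hGz z h0).1.not_ge (by simpa using hz)
    have hbpos : ∀ z ∈ Metric.closedBall (0 : ℂ) 1, ¬ G z < 0 := fun z hz hz0 =>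
      hwG (hG.neg_of_isPreconnected (convex_closedBall _ _).isPreconnected hball hz hz0 hw)
    have hann : ∀ z, G z ≤ 0 → 1 < ‖z‖ ∧ ‖z‖ < Real.exp 1 := by
      intro z hz
      refine ⟨?_, not_le.1 fun h => (hout z h).not_ge hz⟩
      rcases hz.lt_or_eq with h | h
      · exact not_le.1 fun h' => hbpos z (by simpa using h') h
      · exact (hGz z h).1
    have hann' : ∀ z, G z ≤ 0 → Real.exp (-1) ≤ ‖z‖ ∧ ‖z‖ ≤ Real.exp 1 := fun z hz =>
      ⟨by linarith [(hann z hz).1], (hann z hz).2.le⟩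
    have hJA : ∀ z, G z ≤ 0 → J z ∈ A := fun z hz =>
      hposA (hJpos z (hann z hz).1 (hann z hz).2)
    have hopen : IsOpen (J '' {z | G z < 0}) := by
      refine hplanar.isOpen_image hG.isOpen_neg (hJc.mono fun z hz => ?_) fun z hz w hw hzw => ?_
      · exact hann' z (show G z < 0 from hz).le
      · have hz' := hann' z (show G z < 0 from hz).le
        have hw' := hann' w (show G w < 0 from hw).le
        rw [← hEJ z hz'.1 hz'.2, hzw, hEJ w hw'.1 hw'.2]
    have hclosed : IsClosed (J '' {z | G z ≤ 0}) :=
      (hG.isCompact_nonpos.image_of_continuousOn (hJc.mono hann')).isClosed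
    refine not_forall_inside_exists_circle hG (𝒟 := {B | ∃ D' ∈ 𝒞, D' ⊆ A ∧ B = E '' D'}) ?_ ?_ ?_
    · rintro _ ⟨D₁, hD₁, hD₁A, rfl⟩ _ ⟨D₂, hD₂, hD₂A, rfl⟩ hne
      exact (hdisj D₁ hD₁ D₂ hD₂ fun h => hne (congrArg _ h)).image hEi hD₁A hD₂A
    · rintro _ ⟨D', hD', hD'A, rfl⟩
      exact (hts D' hD').exists_isDefining hA hD'A (hEc.mono hAc) hEi
    · intro z hz
      obtain ⟨D', hD', hzD'⟩ := hthrough (J z)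
      have hz' := hann' z hz.le
      have hDD : Disjoint D' D := by
        refine hdisj D' hD' D hD ?_
        rintro rfl
        have : E (J z) ∈ {z | G z = 0} := hEG.subset (mem_image_of_mem E hzD')
        rw [hEJ z hz'.1 hz'.2] at this
        exact hz.ne this
      have hsub : D' ⊆ J '' {z | G z < 0} := by
        refine (hconn D' hD').subset_left_of_subset_union hopen hclosed.isOpen_compl ?_ ?_
          ⟨_, hzD', mem_image_of_mem J hz⟩
        · rw [disjoint_compl_right_iff_subset]
          exact image_mono fun z hz => (show G z < 0 from hz).le
        · intro x hx
          by_cases hxc : x ∈ J '' {z | G z ≤ 0}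
          · obtain ⟨w, hw, rfl⟩ := hxc
            rcases (show G w ≤ 0 from hw).lt_or_eq with h | h
            · exact Or.inl (mem_image_of_mem J h)
            · obtain ⟨y, hy, rfl⟩ := hEG.symm.subset h
              rw [hJE y (hDA hy)] at hx
              exact absurd hy (disjoint_left.1 hDD hx)
          · exact Or.inr hxc
      refine ⟨E '' D', ⟨D', hD', ?_, rfl⟩, ⟨J z, hzD', hEJ z hz'.1 hz'.2⟩, ?_⟩
      · intro x hx
        obtain ⟨w, hw, rfl⟩ := hsub hx
        exact hJA w (show G w < 0 from hw).le
      · rintro _ ⟨x, hx, rfl⟩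
        obtain ⟨w, hw, rfl⟩ := hsub hx
        have hw' := hann' w (show G w < 0 from hw).le
        rw [hEJ w hw'.1 hw'.2]
        exact hw
  obtain ⟨k, hkc, hki, hk0, hk1, hkG, hkimg⟩ := hG.exists_annulus hin
  have hklt : ∀ c, ∀ t ∈ Icc (0 : ℝ) 1, ‖k (c, t)‖ < Real.exp 1 := fun c t ht =>
    not_le.1 fun h => (hout _ h).not_ge (hkG c t ht)
  have hkge : ∀ c, ∀ t ∈ Icc (0 : ℝ) 1, Real.exp (-1) ≤ ‖k (c, t)‖ := fun c t ht => by
    refine hexp.le.trans ?_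
    rcases ht.1.eq_or_lt with rfl | h
    · rw [hk0, Circle.norm_coe]
    · exact (hk1 c t ⟨h, ht.2⟩).le
  refine ⟨J ∘ k, hJc.comp hkc fun p hp => ⟨hkge _ _ hp.2, (hklt _ _ hp.2).le⟩, ?_, ?_, ?_, ?_⟩
  · rintro ⟨c, t⟩ hp ⟨c', t'⟩ hp' heq
    refine hki hp hp' ?_
    rw [← hEJ _ (hkge c t hp.2) (hklt c t hp.2).le, ← hEJ _ (hkge c' t' hp'.2) (hklt c' t' hp'.2).le]
    exact congrArg E heq
  · intro c
    have := hJ c 0 (by norm_num)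
    simpa [hk0] using this
  · exact fun c t ht => hJpos _ (hk1 c t ht) (hklt c t ⟨ht.1.le, ht.2⟩)
  · have : J '' (E '' D) = D := by
      rw [← image_comp]
      exact (EqOn.image_eq fun x hx => hJE x (hDA hx)).trans (image_id D)
    rw [image_comp, hkimg, ← hEG, this]
    exact hD

/-- Let `S` be a boundaryless surface and `𝒞` a circle decomposition of `S` all of whose
elements are two-sided. If `𝒞` is upper semicontinuous, then every `C ∈ 𝒞` admits a
`𝒞`-annular neighborhood. -/
theorem usc_implies_annular_nbhds
    {S : Type*} [TopologicalSpace S] [T2Space S] [SecondCountableTopology S]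
    [ConnectedSpace S] [Nonempty S] [ChartedSpace (EuclideanSpace ℝ (Fin 2)) S]
    (𝒞 : Set (Set S)) (h𝒞 : IsCircleDecomposition 𝒞)
    (hts : ∀ C ∈ 𝒞, IsTwoSided C)
    (husc : IsUpperSemicontinuousDecomposition 𝒞) :
    ∀ C ∈ 𝒞, HasAnnularNbhd 𝒞 C := by
  intro C hC
  obtain ⟨H, hH, rfl⟩ := (hts C hC).exists_isCollar
  obtain ⟨k, hkc, hki, hk0, hk, hk1⟩ := exists_one_sided_annulus h𝒞 hts husc hH hC
  have hflip : (fun p : Circle × ℝ => H (p.1, -p.2)) '' (univ ×ˢ {0}) = H '' (univ ×ˢ {0}) :=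
    EqOn.image_eq (by rintro ⟨c, t⟩ ⟨-, rfl⟩; simp)
  obtain ⟨l, hlc, hli, hl0, hl, hl1⟩ := exists_one_sided_annulus h𝒞 hts husc hH.flip
    (by rwa [hflip])
  simp only [neg_zero] at hl0
  have hlmem : ∀ c, ∀ t ∈ Ioc (0 : ℝ) 1, l (c, t) ∈ H '' (univ ×ˢ Ioo (-1) 0) := fun c t ht => by
    obtain ⟨⟨c', t'⟩, ⟨-, ht'⟩, heq⟩ := hl c t ht
    exact ⟨(c', -t'), ⟨mem_univ _, neg_lt_neg ht'.2, neg_neg_of_pos ht'.1⟩, heq⟩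
  have hkmem : ∀ c, ∀ t ∈ Icc (0 : ℝ) 1, k (c, t) ∈ H '' (univ ×ˢ Ico 0 1) := fun c t ht => by
    rcases ht.1.eq_or_lt with rfl | h
    · rw [hk0]
      exact ⟨_, ⟨mem_univ _, le_rfl, one_pos⟩, rfl⟩
    · exact image_mono (prod_mono_right Ioo_subset_Ico_self) (hk c t ⟨h, ht.2⟩)
  have hkl : ∀ c c', ∀ t ∈ Icc (0 : ℝ) 1, ∀ t' ∈ Ioc (0 : ℝ) 1, k (c, t) ≠ l (c', t') := by
    intro c c' t ht t' ht' heq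
    obtain ⟨⟨a, s⟩, ⟨-, hs⟩, has⟩ := hkmem c t ht
    obtain ⟨⟨b, r⟩, ⟨-, hr⟩, hbr⟩ := hlmem c' t' ht'
    have := (hH.eq_of_eq ⟨by linarith [hs.1], hs.2.le⟩ ⟨hr.1.le, by linarith [hr.2]⟩
      (has.trans (heq.trans hbr.symm))).2
    linarith [hs.1, hr.2]
  let f : Circle × Icc (-1 : ℝ) 1 → S := fun p =>
    if 0 ≤ (p.2 : ℝ) then k (p.1, max p.2 0) else l (p.1, max (-p.2) 0)
  have hfk : ∀ (c : Circle) (t : Icc (-1 : ℝ) 1), 0 ≤ (t : ℝ) → f (c, t) = k (c, t) :=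
    fun c t ht => by simp [f, ht]
  have hfl : ∀ (c : Circle) (t : Icc (-1 : ℝ) 1), (t : ℝ) < 0 → f (c, t) = l (c, -t) :=
    fun c t ht => by simp [f, not_le.2 ht, ht.le]
  have hf : Continuous f := by
    refine Continuous.if_le (hkc.comp_continuous (by fun_prop) fun p => ?_)
      (hlc.comp_continuous (by fun_prop) fun p => ?_) continuous_const (by fun_prop) fun p hp => ?_
    · exact ⟨mem_univ _, le_max_right _ _, max_le p.2.2.2 zero_le_one⟩
    · exact ⟨mem_univ _, le_max_right _ _, max_le (by linarith [p.2.2.1]) zero_le_one⟩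
    · rw [← hp]
      simp [hk0, hl0]
  have hfi : Function.Injective f := by
    rintro ⟨c, t⟩ ⟨c', t'⟩ heq
    rcases le_or_gt 0 (t : ℝ) with h | h <;> rcases le_or_gt 0 (t' : ℝ) with h' | h'
    · rw [hfk c t h, hfk c' t' h'] at heq
      have := hki (show ((c, (t : ℝ)) : Circle × ℝ) ∈ _ from ⟨mem_univ _, h, t.2.2⟩)
        ⟨mem_univ _, h', t'.2.2⟩ heq
      simpa [Subtype.ext_iff] using this
    · rw [hfk c t h, hfl c' t' h'] at heq
      exact absurd heq (hkl _ _ _ ⟨h, t.2.2⟩ _ ⟨by linarith, by linarith [t'.2.1]⟩)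
    · rw [hfl c t h, hfk c' t' h'] at heq
      exact absurd heq.symm (hkl _ _ _ ⟨h', t'.2.2⟩ _ ⟨by linarith, by linarith [t.2.1]⟩)
    · rw [hfl c t h, hfl c' t' h'] at heq
      have := hli (show ((c, -(t : ℝ)) : Circle × ℝ) ∈ _ from
        ⟨mem_univ _, by linarith, by linarith [t.2.1]⟩)
        ⟨mem_univ _, by linarith, by linarith [t'.2.1]⟩ heq
      simpa [Subtype.ext_iff] using this
  have hcore : f '' {p | (p.2 : ℝ) = 0} = H '' (univ ×ˢ {0}) := by
    ext x
    constructor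
    · rintro ⟨⟨c, t⟩, ht, rfl⟩
      have ht : (t : ℝ) = 0 := ht
      exact ⟨(c, 0), ⟨mem_univ _, rfl⟩, by rw [hfk c t ht.ge, ht, hk0]⟩
    · rintro ⟨⟨c, t⟩, ⟨-, rfl⟩, rfl⟩
      exact ⟨(c, ⟨0, by norm_num⟩), rfl, by rw [hfk c _ le_rfl, hk0]⟩
  have h1 : (-1 : ℝ) ≤ 1 := by norm_num
  refine ⟨f, (hf.isClosedEmbedding hfi).isEmbedding, hcore, ?_, ?_, ?_⟩
  · have hopen : IsOpen ((fun p : Circle × ℝ => f (p.1, projIcc (-1) 1 h1 p.2)) ''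
        (univ ×ˢ Ioo (-1) 1)) := by
      refine (isLocallyPlanar_of_chartedSpace S).isOpen_image_cylinder
        (isOpen_univ.prod isOpen_Ioo) (hf.comp (continuous_fst.prodMk
          ((continuous_projIcc (h := h1)).comp continuous_snd))).continuousOn ?_
      rintro ⟨c, t⟩ ⟨-, ht⟩ ⟨c', t'⟩ ⟨-, ht'⟩ heq
      have := hfi heq
      rw [projIcc_of_mem _ (Ioo_subset_Icc_self ht),
        projIcc_of_mem _ (Ioo_subset_Icc_self ht')] at this
      simpa using this
    refine mem_nhdsSet_iff_exists.2 ⟨_, hopen, ?_, ?_⟩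
    · rw [← hcore]
      rintro _ ⟨⟨c, t⟩, ht, rfl⟩
      have ht : (t : ℝ) = 0 := ht
      exact ⟨(c, t), ⟨mem_univ _, by simp [ht]⟩, by simp⟩
    · rintro _ ⟨p, -, rfl⟩
      exact mem_range_self _
  · convert hl1 using 1
    ext x
    constructor
    · rintro ⟨⟨c, t⟩, ht, rfl⟩
      have ht : (t : ℝ) = -1 := ht
      exact ⟨(c, 1), ⟨mem_univ _, rfl⟩, by rw [hfl c t (by rw [ht]; norm_num), ht, neg_neg]⟩
    · rintro ⟨⟨c, t⟩, ⟨-, rfl⟩, rfl⟩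
      exact ⟨(c, ⟨-1, by norm_num⟩), rfl, by rw [hfl c _ (by norm_num), neg_neg]⟩
  · convert hk1 using 1
    ext x
    constructor
    · rintro ⟨⟨c, t⟩, ht, rfl⟩
      have ht : (t : ℝ) = 1 := ht
      exact ⟨(c, 1), ⟨mem_univ _, rfl⟩, by rw [hfk c t (by rw [ht]; norm_num), ht]⟩
    · rintro ⟨⟨c, t⟩, ⟨-, rfl⟩, rfl⟩
      exact ⟨(c, ⟨1, by norm_num⟩), rfl, by rw [hfk c _ (by norm_num)]⟩
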